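/- Let 0 < p ≤ ∞ and let F belong to the Hardy space ℍ^p. Then there exists a function G ∈ QA such that the zeros of F' and G' in 𝔻 coincide with the same multiplicities, i.e., for every z ∈ 𝔻 the order of vanishing of F' at z equals the order of vanishing of G' at z. -/

import Mathlib

open MeasureTheory Filter Set Topology

noncomputable section

/-- The open unit disc in `ℂ`. -/
def unitDisc : Set ℂ := {z : ℂ | ‖z‖ < 1}

/-- The point `e^{iθ}` on the unit circle. -/
def circlePt (θ : ℝ) : ℂ := Complex.exp ((θ : ℂ) * Complex.I)

/-- The Carleson square based on the arc centered at `e^{iθ₀}` of normalized length `t`. -/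
def carlesonSquare (θ₀ t : ℝ) : Set ℂ :=
  {z : ℂ | z ∈ unitDisc ∧ 1 - t ≤ ‖z‖ ∧
    ∃ θ : ℝ, |θ - θ₀| ≤ Real.pi * t ∧ z = (‖z‖ : ℂ) * circlePt θ}

/-- `μ` is a Carleson measure. -/
def IsCarleson (μ : Measure ℂ) : Prop :=
  ∃ C : ℝ, 0 < C ∧ ∀ θ₀ t : ℝ, 0 < t → t ≤ 1 →
    μ (carlesonSquare θ₀ t) ≤ ENNReal.ofReal (C * t)

/-- `μ` is a vanishing Carleson measure. -/
def IsVanishingCarleson (μ : Measure ℂ) : Prop :=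
  IsCarleson μ ∧ ∀ ε : ℝ, 0 < ε → ∃ δ : ℝ, 0 < δ ∧ ∀ θ₀ t : ℝ, 0 < t → t < δ →
    μ (carlesonSquare θ₀ t) ≤ ENNReal.ofReal (ε * t)

/-- The measure `|E| μ`, i.e. `d(|E|μ)(z) = |E(z)| dμ(z)`. -/
def absDensity (E : ℂ → ℂ) (μ : Measure ℂ) : Measure ℂ :=
  μ.withDensity (fun z => ENNReal.ofReal ‖E z‖)

/-- Average of a boundary function (in the angle variable) over the arc
centered at `e^{iθ₀}` of normalized length `t`; `dm = dθ/(2π)`. -/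
def arcAvg (f : ℝ → ℂ) (θ₀ t : ℝ) : ℂ :=
  ((2 * Real.pi * t)⁻¹ : ℝ) •
    ∫ θ in Set.Ioo (θ₀ - Real.pi * t) (θ₀ + Real.pi * t), f θ

/-- Mean oscillation of a boundary function over the arc centered at `e^{iθ₀}`
of normalized length `t`. -/
def meanOsc (f : ℝ → ℂ) (θ₀ t : ℝ) : ℝ :=
  (2 * Real.pi * t)⁻¹ *
    ∫ θ in Set.Ioo (θ₀ - Real.pi * t) (θ₀ + Real.pi * t), ‖f θ - arcAvg f θ₀ t‖

/-- A (2π-periodic, integrable) boundary function has bounded mean oscillation. -/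
def IsBMO (f : ℝ → ℂ) : Prop :=
  (∀ θ : ℝ, f (θ + 2 * Real.pi) = f θ) ∧
  IntegrableOn f (Set.Ioc 0 (2 * Real.pi)) ∧
  ∃ C : ℝ, ∀ θ₀ t : ℝ, 0 < t → t ≤ 1 → meanOsc f θ₀ t ≤ C

/-- A boundary function has vanishing mean oscillation. -/
def IsVMO (f : ℝ → ℂ) : Prop :=
  IsBMO f ∧ ∀ ε : ℝ, 0 < ε → ∃ δ : ℝ, 0 < δ ∧
    ∀ θ₀ t : ℝ, 0 < t → t < δ → meanOsc f θ₀ t ≤ ε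

/-- The BMO seminorm of a boundary function. -/
def bmoSeminorm (f : ℝ → ℂ) : ℝ :=
  sSup {c : ℝ | ∃ θ₀ t : ℝ, 0 < t ∧ t ≤ 1 ∧ c = meanOsc f θ₀ t}

/-- `Fb` is the (a.e.) radial boundary function of `F`. -/
def HasRadialLimits (F : ℂ → ℂ) (Fb : ℝ → ℂ) : Prop :=
  ∀ᵐ θ ∂(volume.restrict (Set.Ioc 0 (2 * Real.pi))),
    Tendsto (fun r : ℝ => F ((r : ℂ) * circlePt θ))
      (nhdsWithin 1 (Set.Iio 1)) (nhds (Fb θ))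

/-- `F` is a bounded analytic function on the unit disc. -/
def MemHinf (F : ℂ → ℂ) : Prop :=
  DifferentiableOn ℂ F unitDisc ∧ ∃ M : ℝ, ∀ z ∈ unitDisc, ‖F z‖ ≤ M

/-- `F` belongs to `QA` with boundary function `Fb`: it is a bounded analytic
function on the disc whose radial boundary values are in VMO. -/
def MemQA (F : ℂ → ℂ) (Fb : ℝ → ℂ) : Prop :=
  MemHinf F ∧ HasRadialLimits F Fb ∧ IsVMO Fb

/-- `E` is an outer function. -/
def IsOuter (E : ℂ → ℂ) : Prop :=
  DifferentiableOn ℂ E unitDisc ∧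
  ∃ h : ℝ → ℝ, IntegrableOn h (Set.Ioc 0 (2 * Real.pi)) ∧ ∀ z ∈ unitDisc,
    E z = Complex.exp (((2 * Real.pi)⁻¹ : ℝ) • ∫ θ in Set.Ioc 0 (2 * Real.pi),
      ((circlePt θ + z) / (circlePt θ - z)) * (h θ : ℂ))

/-- The integral means appearing in the definition of the Hardy space `ℍ^p`. -/
def hardyIntegral (p : ℝ) (F : ℂ → ℂ) (r : ℝ) : ℝ :=
  ∫ θ in Set.Ioc 0 (2 * Real.pi), ‖F ((r : ℂ) * circlePt θ)‖ ^ p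

/-- `F` belongs to the Hardy space `ℍ^p`, `0 < p < ∞`. -/
def MemHardy (p : ℝ) (F : ℂ → ℂ) : Prop :=
  DifferentiableOn ℂ F unitDisc ∧
  ∃ M : ℝ, ∀ r : ℝ, 0 < r → r < 1 → hardyIntegral p F r ≤ M

/-- `F` belongs to `BMOA` with boundary function `Fb`. -/
def MemBMOA (F : ℂ → ℂ) (Fb : ℝ → ℂ) : Prop :=
  MemHardy 2 F ∧ HasRadialLimits F Fb ∧ IsBMO Fb

/-- `F` belongs to `VMOA` with boundary function `Fb`. -/
def MemVMOA (F : ℂ → ℂ) (Fb : ℝ → ℂ) : Prop :=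
  MemHardy 2 F ∧ HasRadialLimits F Fb ∧ IsVMO Fb

/-- The generalized Volterra operator `T_G(F)(z) = ∫₀^z F(w) G'(w) dw`. -/
def volterra (G F : ℂ → ℂ) (z : ℂ) : ℂ :=
  ∫ t in (0:ℝ)..1, z * F ((t : ℂ) * z) * deriv G ((t : ℂ) * z)


/-- `F` belongs to the Hardy space `ℍ^p` for `0 < p ≤ ∞` (`p = ⊤` meaning `p = ∞`). -/
def MemHardyE (p : ENNReal) (F : ℂ → ℂ) : Prop :=
  if p = ⊤ then MemHinf F else MemHardy p.toReal F

/-- Lower bound `L` for `Δψ/4` at `z`, up to the real part of a quadratic polynomial. -/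
def SubJet (ψ : ℂ → ℝ) (z : ℂ) (L : ℝ) : Prop :=
  ∃ b c : ℂ, ∀ ε > 0, ∀ᶠ w in 𝓝 (0 : ℂ),
    ψ z + (b * w + c * w ^ 2).re + (L - ε) * ‖w‖ ^ 2 ≤ ψ (z + w)

namespace SubJet

variable {ψ χ : ℂ → ℝ} {z : ℂ} {L K : ℝ}

theorem add (h₁ : SubJet ψ z L) (h₂ : SubJet χ z K) :
    SubJet (fun x => ψ x + χ x) z (L + K) := by
  obtain ⟨b, c, h⟩ := h₁
  obtain ⟨b', c', h'⟩ := h₂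
  refine ⟨b + b', c + c', fun ε hε => ?_⟩
  filter_upwards [h (ε / 2) (by positivity), h' (ε / 2) (by positivity)] with w h1 h2
  have : ((b + b') * w + (c + c') * w ^ 2).re
      = (b * w + c * w ^ 2).re + (b' * w + c' * w ^ 2).re := by
    rw [← Complex.add_re]; congr 1; ring
  rw [this]; nlinarith

theorem const_mul (h : SubJet ψ z L) {s : ℝ} (hs : 0 ≤ s) :
    SubJet (fun x => s * ψ x) z (s * L) := by
  obtain ⟨b, c, h⟩ := h
  refine ⟨s * b, s * c, fun ε hε => ?_⟩
  filter_upwards [h (ε / (s + 1)) (by positivity)] with w h1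
  have e : ((s : ℂ) * b * w + s * c * w ^ 2).re = s * (b * w + c * w ^ 2).re := by
    rw [← Complex.re_ofReal_mul]; congr 1; ring
  have h2 := mul_le_mul_of_nonneg_left h1 hs
  have h3 : s * (ε / (s + 1)) ≤ ε := by
    rw [mul_div_assoc', div_le_iff₀ (by positivity)]; nlinarith
  rw [e]
  nlinarith [mul_le_mul_of_nonneg_right h3 (sq_nonneg ‖w‖)]

theorem mono (h : SubJet ψ z L) (hLK : K ≤ L) : SubJet ψ z K := by
  obtain ⟨b, c, h⟩ := h
  refine ⟨b, c, fun ε hε => ?_⟩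
  filter_upwards [h ε hε] with w h1
  nlinarith [mul_le_mul_of_nonneg_right hLK (sq_nonneg ‖w‖)]

theorem of_touching (h : SubJet χ z L) (he : χ z = ψ z) (hle : ∀ᶠ x in 𝓝 z, χ x ≤ ψ x) :
    SubJet ψ z L := by
  obtain ⟨b, c, h⟩ := h
  refine ⟨b, c, fun ε hε => ?_⟩
  have ht : Tendsto (fun w : ℂ => z + w) (𝓝 0) (𝓝 z) := by
    have : ContinuousAt (fun w : ℂ => z + w) 0 := by fun_prop
    simpa [ContinuousAt] using this
  filter_upwards [h ε hε, ht.eventually hle] with w h1 h2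
  rw [← he]; exact h1.trans h2

theorem congr (h : SubJet χ z L) (he : ∀ᶠ x in 𝓝 z, χ x = ψ x) : SubJet ψ z L :=
  h.of_touching he.self_of_nhds (he.mono fun _ h => h.le)

theorem const (s : ℝ) (z : ℂ) : SubJet (fun _ => s) z 0 :=
  ⟨0, 0, fun ε hε => Eventually.of_forall fun w => by
    simp; positivity⟩

end SubJet

/-- Maximum principle for functions that are subharmonic where positive. -/
theorem nonpos_of_subJet {ψ : ℂ → ℝ} (hc : ContinuousOn ψ (Metric.closedBall 0 1))
    (hb : ∀ z, ‖z‖ = 1 → ψ z ≤ 0)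
    (hj : ∀ z, ‖z‖ < 1 → 0 < ψ z → SubJet ψ z 0) (z : ℂ) (hz : ‖z‖ ≤ 1) : ψ z ≤ 0 := by
  by_contra! hpos
  set ε := ψ z / 2 with hε
  have hε0 : 0 < ε := by positivity
  obtain ⟨z₀, hz₀, hmax⟩ := (isCompact_closedBall (0 : ℂ) 1).exists_isMaxOn ⟨0, by simp⟩
    (hc.add (f := ψ) (g := fun x => ε * ‖x‖ ^ 2) (by fun_prop))
  have hmax' : ∀ x : ℂ, ‖x‖ ≤ 1 → ψ x + ε * ‖x‖ ^ 2 ≤ ψ z₀ + ε * ‖z₀‖ ^ 2 := fun x hx =>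
    hmax (by simpa using hx)
  have hz₀' : ‖z₀‖ ≤ 1 := by simpa using hz₀
  have hsq : ‖z₀‖ ^ 2 ≤ 1 := pow_le_one₀ (norm_nonneg _) hz₀'
  have h1 := hmax' z hz
  have hp : 0 < ψ z₀ := by nlinarith [mul_nonneg hε0.le (sq_nonneg ‖z‖)]
  have hlt : ‖z₀‖ < 1 := lt_of_le_of_ne hz₀' fun h => by linarith [hb z₀ h]
  obtain ⟨b, c, h⟩ := hj z₀ hlt hp
  have hev := h (ε / 2) (by positivity)
  obtain ⟨r, hr, hball⟩ := Metric.eventually_nhds_iff_ball.1 hev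
  set t := min (r / 2) (1 - ‖z₀‖) with ht
  have ht0 : 0 < t := lt_min (by positivity) (by linarith)
  have key : ∀ u : ℂ, ‖u‖ = 1 →
      (b * (t * u) + c * (t * u) ^ 2).re + (-ε / 2) * t ^ 2 +
        ε * (‖z₀ + t * u‖ ^ 2 - ‖z₀‖ ^ 2) ≤ 0 := by
    intro u hu
    have hn : ‖(t : ℂ) * u‖ = t := by simp [hu, abs_of_pos ht0]
    have h2 := hball (t * u) (by
      rw [mem_ball_zero_iff, hn]; linarith [min_le_left (r / 2) (1 - ‖z₀‖)])
    have h3 := hmax' (z₀ + t * u) (by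
      refine (norm_add_le _ _).trans ?_
      rw [hn]; linarith [min_le_right (r / 2) (1 - ‖z₀‖)])
    rw [hn] at h2
    linarith
  have k1 := key 1 (by simp)
  have k2 := key (-1) (by simp)
  have k3 := key Complex.I (by simp)
  have k4 := key (-Complex.I) (by simp)
  simp only [← Complex.normSq_eq_norm_sq, Complex.normSq_apply] at k1 k2 k3 k4
  simp [pow_two] at k1 k2 k3 k4
  nlinarith [mul_pos hε0 (mul_pos ht0 ht0)]

theorem tendsto_add_left_nhds_zero (z : ℂ) : Tendsto (fun w : ℂ => z + w) (𝓝 0) (𝓝 z) := by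
  have : ContinuousAt (fun w : ℂ => z + w) 0 := by fun_prop
  simpa [ContinuousAt] using this

theorem AnalyticAt.exists_taylor_two {f : ℂ → ℂ} {z : ℂ} (hf : AnalyticAt ℂ f z) :
    ∃ c : ℂ, ∀ ε > 0, ∀ᶠ w in 𝓝 (0 : ℂ),
      ‖f (z + w) - f z - deriv f z * w - c * w ^ 2‖ ≤ ε * ‖w‖ ^ 2 := by
  obtain ⟨p, hp⟩ := hf
  have h1 := hp.has_fpower_series_dslope_fslope
  have h2 := h1.has_fpower_series_dslope_fslope
  have hc := h2.continuousAt
  set g := dslope f z with hg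
  set h := dslope g z with hh
  refine ⟨h z, fun ε hε => ?_⟩
  have hev := (Metric.continuousAt_iff'.1 hc) ε hε
  filter_upwards [(tendsto_add_left_nhds_zero z).eventually hev] with w hw
  have e1 : w * g (z + w) = f (z + w) - f z := by
    have := sub_smul_dslope f z (z + w)
    simpa using this
  have e2 : w * h (z + w) = g (z + w) - deriv f z := by
    have := sub_smul_dslope g z (z + w)
    rw [hg, dslope_same] at this
    simpa [hh, hg] using this
  have e3 : f (z + w) - f z - deriv f z * w - h z * w ^ 2 = (h (z + w) - h z) * w ^ 2 := by
    rw [← e1]; linear_combination -w * e2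
  rw [e3, norm_mul, norm_pow]
  rw [dist_eq_norm] at hw
  gcongr

namespace SubJet

variable {ψ χ : ℂ → ℝ} {z : ℂ} {L K : ℝ} {f G : ℂ → ℂ}

theorem of_littleO (h : SubJet χ z L) (he : χ z = ψ z)
    (hle : ∀ ε > 0, ∀ᶠ w in 𝓝 (0 : ℂ), χ (z + w) - ε * ‖w‖ ^ 2 ≤ ψ (z + w)) :
    SubJet ψ z L := by
  obtain ⟨b, c, h⟩ := h
  refine ⟨b, c, fun ε hε => ?_⟩
  filter_upwards [h (ε / 2) (by positivity), hle (ε / 2) (by positivity)] with w h1 h2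
  rw [← he]; linarith

theorem re (hf : AnalyticAt ℂ f z) : SubJet (fun x => (f x).re) z 0 := by
  obtain ⟨c, hc⟩ := hf.exists_taylor_two
  refine ⟨deriv f z, c, fun ε hε => ?_⟩
  filter_upwards [hc ε hε] with w hw
  have h1 := (abs_le.1 ((Complex.abs_re_le_norm _).trans hw)).1
  simp only [Complex.sub_re] at h1
  simp only [Complex.add_re]
  linarith

theorem normSq_aux (hf : AnalyticAt ℂ f z) : ∃ b c : ℂ, ∀ ε > 0, ∀ᶠ w in 𝓝 (0 : ℂ),
    |‖f (z + w)‖ ^ 2 - (‖f z‖ ^ 2 + (b * w + c * w ^ 2).re + ‖deriv f z‖ ^ 2 * ‖w‖ ^ 2)|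
      ≤ ε * ‖w‖ ^ 2 := by
  obtain ⟨c, hc⟩ := hf.exists_taylor_two
  refine ⟨2 * starRingEnd ℂ (f z) * deriv f z, 2 * starRingEnd ℂ (f z) * c, fun ε hε => ?_⟩
  set A := ‖f z‖
  set B := ‖deriv f z‖
  set δ := min 1 (ε / (2 * A + 2 * (2 * B + 1) + 1)) with hδ
  have hA : 0 ≤ A := norm_nonneg _
  have hB : 0 ≤ B := norm_nonneg _
  have hδ0 : 0 < δ := lt_min one_pos (by positivity)
  have hδ1 : δ * (2 * A + 2 * (2 * B + 1) + 1) ≤ ε := by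
    rw [← le_div_iff₀ (by positivity)]; exact min_le_right _ _
  have hδ2 : δ ≤ 1 := min_le_left _ _
  have hd := hf.differentiableAt.hasDerivAt
  rw [hasDerivAt_iff_isLittleO_nhds_zero] at hd
  filter_upwards [hc δ hδ0, hd.bound hδ0] with w h1 h2
  set y := f (z + w) - f z with hy
  have e1 : ‖f (z + w)‖ ^ 2 = A ^ 2 + 2 * (starRingEnd ℂ (f z) * y).re + ‖y‖ ^ 2 := by
    have : f (z + w) = f z + y := by rw [hy]; ring
    rw [this]
    simp only [A, ← Complex.normSq_eq_norm_sq, Complex.normSq_apply, Complex.add_re,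
      Complex.add_im, Complex.mul_re, Complex.conj_re, Complex.conj_im]
    ring
  have e2 : (2 * starRingEnd ℂ (f z) * deriv f z * w + 2 * starRingEnd ℂ (f z) * c * w ^ 2).re
      = 2 * (starRingEnd ℂ (f z) * y).re
        - 2 * (starRingEnd ℂ (f z) * (y - deriv f z * w - c * w ^ 2)).re := by
    have : ∀ x : ℂ, 2 * x.re = ((2 : ℂ) * x).re := fun x => by simp
    rw [this, this, ← Complex.sub_re]; congr 1; ring
  have h3 : |(starRingEnd ℂ (f z) * (y - deriv f z * w - c * w ^ 2)).re| ≤ A * (δ * ‖w‖ ^ 2) := by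
    refine (Complex.abs_re_le_norm _).trans ?_
    rw [norm_mul, RCLike.norm_conj]
    gcongr
  have h4 : ‖y - deriv f z * w‖ ≤ δ * ‖w‖ := by
    simpa [hy, mul_comm] using h2
  have h5 : |‖y‖ ^ 2 - B ^ 2 * ‖w‖ ^ 2| ≤ 2 * (2 * B + 1) * δ * ‖w‖ ^ 2 := by
    have e3 : ‖deriv f z * w‖ = B * ‖w‖ := norm_mul _ _
    have h6 := (abs_norm_sub_norm_le y (deriv f z * w)).trans h4
    rw [e3] at h6
    have h7 : ‖y‖ + B * ‖w‖ ≤ (2 * B + 1) * ‖w‖ := by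
      have := (abs_le.1 h6).2
      nlinarith [norm_nonneg w]
    have : ‖y‖ ^ 2 - B ^ 2 * ‖w‖ ^ 2 = (‖y‖ - B * ‖w‖) * (‖y‖ + B * ‖w‖) := by ring
    rw [this, abs_mul, abs_of_nonneg (a := ‖y‖ + B * ‖w‖) (by positivity)]
    calc _ ≤ (δ * ‖w‖) * ((2 * B + 1) * ‖w‖) := by gcongr
      _ ≤ _ := by
        have : 0 ≤ (2 * B + 1) * δ * ‖w‖ ^ 2 := by positivity
        nlinarith
  rw [e1, e2]
  have h8 : (2 * A * δ + 2 * (2 * B + 1) * δ) * ‖w‖ ^ 2 ≤ ε * ‖w‖ ^ 2 := by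
    gcongr; linarith
  rw [abs_le] at *
  constructor <;> linarith [h3.1, h3.2, h5.1, h5.2]

theorem normSq (hf : AnalyticAt ℂ f z) :
    SubJet (fun x => ‖f x‖ ^ 2) z (‖deriv f z‖ ^ 2) := by
  obtain ⟨b, c, h⟩ := normSq_aux hf
  refine ⟨b, c, fun ε hε => ?_⟩
  filter_upwards [h ε hε] with w hw
  linarith [(abs_le.1 hw).1]

theorem neg_normSq (hf : AnalyticAt ℂ f z) :
    SubJet (fun x => -‖f x‖ ^ 2) z (-‖deriv f z‖ ^ 2) := by
  obtain ⟨b, c, h⟩ := normSq_aux hf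
  refine ⟨-b, -c, fun ε hε => ?_⟩
  filter_upwards [h ε hε] with w hw
  have : (-b * w + -c * w ^ 2).re = -(b * w + c * w ^ 2).re := by
    rw [← Complex.neg_re]; congr 1; ring
  rw [this]
  linarith [(abs_le.1 hw).2]

theorem re_conj_mul (hf : AnalyticAt ℂ f z) (hG : AnalyticAt ℂ G z) :
    SubJet (fun x => 2 * (starRingEnd ℂ (f x) * G x).re) z
      (2 * (starRingEnd ℂ (deriv f z) * deriv G z).re) := by
  have key : ∀ a b : ℂ, 2 * (starRingEnd ℂ a * b).re = ‖a + b‖ ^ 2 + -‖a‖ ^ 2 + -‖b‖ ^ 2 := by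
    intro a b
    simp only [← Complex.normSq_eq_norm_sq, Complex.normSq_apply, Complex.add_re,
      Complex.add_im, Complex.mul_re, Complex.conj_re, Complex.conj_im]
    ring
  have := ((normSq (hf.add hG)).add (neg_normSq hf)).add (neg_normSq hG)
  have hd : deriv (f + G) z = deriv f z + deriv G z :=
    deriv_add hf.differentiableAt hG.differentiableAt
  rw [hd, ← key] at this
  exact this.congr (Eventually.of_forall fun x => (key _ _).symm)

theorem neg_log_one_sub_normSq (hG : AnalyticAt ℂ G z) (h1 : ‖G z‖ < 1) :
    SubJet (fun x => -Real.log (1 - ‖G x‖ ^ 2)) z 0 := by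
  have hs : 0 < 1 - ‖G z‖ ^ 2 := by nlinarith [norm_nonneg (G z)]
  have h := ((normSq hG).const_mul (s := (1 - ‖G z‖ ^ 2)⁻¹) (by positivity)).add
    (const (-Real.log (1 - ‖G z‖ ^ 2) - (1 - ‖G z‖ ^ 2)⁻¹ * ‖G z‖ ^ 2) z)
  refine (h.mono (K := 0) (by positivity)).of_touching (by ring) ?_
  have hev : ∀ᶠ x in 𝓝 z, ‖G x‖ < 1 := hG.continuousAt.norm.eventually_lt_const h1
  filter_upwards [hev] with x hx
  have hx' : 0 < 1 - ‖G x‖ ^ 2 := by nlinarith [norm_nonneg (G x)]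
  have := Real.log_le_sub_one_of_pos (div_pos hx' hs)
  rw [Real.log_div hx'.ne' hs.ne'] at this
  have e : (1 - ‖G x‖ ^ 2) / (1 - ‖G z‖ ^ 2) - 1
      = (1 - ‖G z‖ ^ 2)⁻¹ * (‖G z‖ ^ 2 - ‖G x‖ ^ 2) := by field_simp; ring
  rw [e] at this
  linarith

end SubJet

theorem one_sub_conj_mul_ne_zero {g x : ℂ} (hg : ‖g‖ < 1) (hx : ‖x‖ < 1) :
    1 - starRingEnd ℂ g * x ≠ 0 := by
  intro h
  have : ‖starRingEnd ℂ g * x‖ = 1 := by rw [← sub_eq_zero.1 h]; simp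
  rw [norm_mul, RCLike.norm_conj] at this
  nlinarith [norm_nonneg g, norm_nonneg x]

theorem one_sub_normSq_mobius {g x : ℂ} (hg : ‖g‖ < 1) (hx : ‖x‖ < 1) :
    1 - ‖(x - g) / (1 - starRingEnd ℂ g * x)‖ ^ 2
      = (1 - ‖g‖ ^ 2) * (1 - ‖x‖ ^ 2) / ‖1 - starRingEnd ℂ g * x‖ ^ 2 := by
  have h := one_sub_conj_mul_ne_zero hg hx
  have h' : ‖1 - starRingEnd ℂ g * x‖ ≠ 0 := norm_ne_zero_iff.2 h
  rw [norm_div, div_pow, eq_div_iff (by positivity), sub_mul, div_mul_cancel₀ _ (by positivity)]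
  simp only [← Complex.normSq_eq_norm_sq, Complex.normSq_apply, Complex.sub_re,
      Complex.sub_im, Complex.mul_re, Complex.mul_im, Complex.conj_re, Complex.conj_im,
      Complex.one_re, Complex.one_im]
  ring

/-- The composition of `G` with the disc automorphism sending `G z` to `0`. -/
def mobAt (G : ℂ → ℂ) (z : ℂ) (x : ℂ) : ℂ := (G x - G z) / (1 - starRingEnd ℂ (G z) * G x)

section mobAt

variable {G : ℂ → ℂ} {z : ℂ}

theorem one_sub_conj_mul_self (g : ℂ) : 1 - starRingEnd ℂ g * g = ((1 - ‖g‖ ^ 2 : ℝ) : ℂ) := by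
  rw [← Complex.normSq_eq_conj_mul_self, Complex.normSq_eq_norm_sq]; push_cast; rfl

theorem analyticAt_mobAt (hG : AnalyticAt ℂ G z) (h1 : ‖G z‖ < 1) :
    AnalyticAt ℂ (mobAt G z) z :=
  (hG.sub analyticAt_const).div (analyticAt_const.sub (analyticAt_const.mul hG))
    (one_sub_conj_mul_ne_zero h1 h1)

theorem mobAt_self : mobAt G z z = 0 := by simp [mobAt]

theorem deriv_mobAt (hG : AnalyticAt ℂ G z) (h1 : ‖G z‖ < 1) :
    deriv (mobAt G z) z = deriv G z / ((1 - ‖G z‖ ^ 2 : ℝ) : ℂ) := by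
  have hd := hG.differentiableAt.hasDerivAt
  have h := (hd.sub_const (G z)).div ((hd.const_mul (starRingEnd ℂ (G z))).const_sub 1)
    (one_sub_conj_mul_ne_zero h1 h1)
  have h2 := h.deriv
  have hne := one_sub_conj_mul_ne_zero h1 h1
  have e : mobAt G z = ((fun x => G x - G z) / fun x => 1 - starRingEnd ℂ (G z) * G x) := rfl
  rw [e, h2, ← one_sub_conj_mul_self]
  field_simp
  ring

theorem normSq_mobAt_isLittleO (hG : AnalyticAt ℂ G z) (h1 : ‖G z‖ < 1) :
    ∃ C > 0, ∀ᶠ w in 𝓝 (0 : ℂ), ‖mobAt G z (z + w)‖ ≤ C * ‖w‖ := by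
  have hd := (analyticAt_mobAt hG h1).differentiableAt.hasDerivAt
  rw [hasDerivAt_iff_isLittleO_nhds_zero] at hd
  refine ⟨1 + ‖deriv (mobAt G z) z‖, by positivity, ?_⟩
  filter_upwards [hd.bound one_pos] with w hw
  rw [mobAt_self, sub_zero, smul_eq_mul, one_mul] at hw
  have := norm_le_norm_add_norm_sub (w * deriv (mobAt G z) z) (mobAt G z (z + w))
  rw [norm_mul] at this
  linarith [norm_sub_rev (mobAt G z (z + w)) (w * deriv (mobAt G z) z)]

theorem SubJet.log_one_sub_normSq (hG : AnalyticAt ℂ G z) (h1 : ‖G z‖ < 1) :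
    SubJet (fun x => Real.log (1 - ‖G x‖ ^ 2)) z (-(‖deriv G z‖ / (1 - ‖G z‖ ^ 2)) ^ 2) := by
  have hs : 0 < 1 - ‖G z‖ ^ 2 := by nlinarith [norm_nonneg (G z)]
  have hM := analyticAt_mobAt hG h1
  have hden : AnalyticAt ℂ (fun x => 2 * Complex.log (1 - starRingEnd ℂ (G z) * G x)) z := by
    refine analyticAt_const.mul ((analyticAt_const.sub (analyticAt_const.mul hG)).clog ?_)
    left
    simp only [Pi.sub_apply, Pi.mul_apply]
    rw [one_sub_conj_mul_self]
    exact_mod_cast hs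
  have hj := ((SubJet.neg_normSq hM).add (SubJet.re hden)).add
    (SubJet.const (-Real.log (1 - ‖G z‖ ^ 2)) z)
  rw [deriv_mobAt hG h1, norm_div, Complex.norm_real, Real.norm_of_nonneg hs.le, add_zero,
    add_zero] at hj
  have hlog2 : ∀ y : ℂ, y ≠ 0 → (2 * Complex.log y).re = Real.log (‖y‖ ^ 2) := by
    intro y hy
    rw [Real.log_pow]; simp [Complex.log_re]
  obtain ⟨C, hC, hCw⟩ := normSq_mobAt_isLittleO hG h1
  refine hj.of_littleO ?_ fun ε hε => ?_
  · have hne := one_sub_conj_mul_ne_zero h1 h1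
    rw [mobAt_self, hlog2 _ hne, one_sub_conj_mul_self, Complex.norm_real,
      Real.norm_of_nonneg hs.le, Real.log_pow]
    simp; ring
  · have hev : ∀ᶠ w in 𝓝 (0 : ℂ), ‖G (z + w)‖ < 1 :=
      (tendsto_add_left_nhds_zero z).eventually (hG.continuousAt.norm.eventually_lt_const h1)
    have hev2 : ∀ᶠ w in 𝓝 (0 : ℂ), C ^ 2 * ‖w‖ ^ 2 < 1 / 2 := by
      have : ContinuousAt (fun w : ℂ => C ^ 2 * ‖w‖ ^ 2) 0 := by fun_prop
      exact this.eventually_lt_const (by norm_num)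
    have hev3 : ∀ᶠ w in 𝓝 (0 : ℂ), 2 * C ^ 4 * ‖w‖ ^ 2 < ε := by
      have : ContinuousAt (fun w : ℂ => 2 * C ^ 4 * ‖w‖ ^ 2) 0 := by fun_prop
      exact this.eventually_lt_const (by simpa using hε)
    filter_upwards [hev, hev2, hev3, hCw] with w hw h2 h3 h4
    have hne := one_sub_conj_mul_ne_zero h1 hw
    have hx' : 0 < 1 - ‖G (z + w)‖ ^ 2 := by nlinarith [norm_nonneg (G (z + w))]
    have hn : 0 < ‖1 - starRingEnd ℂ (G z) * G (z + w)‖ ^ 2 := by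
      have := norm_pos_iff.2 hne
      positivity
    have hmob := one_sub_normSq_mobius h1 hw
    change 1 - ‖mobAt G z (z + w)‖ ^ 2 = _ at hmob
    set m := ‖mobAt G z (z + w)‖ ^ 2 with hm
    have hm0 : 0 ≤ m := by positivity
    have hmle : m ≤ C ^ 2 * ‖w‖ ^ 2 := by
      rw [hm, ← mul_pow]; gcongr
    have hlog : -m - 2 * m ^ 2 ≤ Real.log (1 - m) := by
      have hpos : 0 < 1 - m := by linarith
      have h5 := Real.one_sub_inv_le_log_of_pos hpos
      have h6 : 1 - (1 - m)⁻¹ = -m - m ^ 2 * (1 - m)⁻¹ := by field_simp; ring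
      have h7 : (1 - m)⁻¹ ≤ 2 := by
        rw [inv_le_comm₀ hpos two_pos]; linarith
      have := mul_le_mul_of_nonneg_left h7 (sq_nonneg m)
      linarith
    have hlm : Real.log (1 - m) = Real.log (1 - ‖G z‖ ^ 2) + Real.log (1 - ‖G (z + w)‖ ^ 2)
        - Real.log (‖1 - starRingEnd ℂ (G z) * G (z + w)‖ ^ 2) := by
      rw [hmob, Real.log_div (by positivity) hn.ne', Real.log_mul hs.ne' hx'.ne']
    rw [hlog2 _ hne]
    have hm2 : 2 * m ^ 2 ≤ ε * ‖w‖ ^ 2 := by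
      calc 2 * m ^ 2 ≤ 2 * (C ^ 2 * ‖w‖ ^ 2) ^ 2 := by gcongr
        _ = 2 * C ^ 4 * ‖w‖ ^ 2 * ‖w‖ ^ 2 := by ring
        _ ≤ _ := by gcongr
    linarith

end mobAt

/-- First variation of `log (exp (re a) / (1 - ‖G‖ ^ 2))` in the direction `(K, X)`. -/
def logVar (G K X : ℂ → ℂ) (x : ℂ) : ℝ :=
  (K x).re + 2 * (starRingEnd ℂ (G x) * X x).re / (1 - ‖G x‖ ^ 2)

theorem logVar_eq_mobius {g x k y : ℂ} (hg : ‖g‖ < 1) (hx : ‖x‖ < 1) :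
    k.re + 2 * (starRingEnd ℂ x * y).re / (1 - ‖x‖ ^ 2)
      = (k + 2 * starRingEnd ℂ g * y / (1 - starRingEnd ℂ g * x)).re
        + 2 * (starRingEnd ℂ ((x - g) / (1 - starRingEnd ℂ g * x))
            * ((1 - ‖g‖ ^ 2 : ℝ) * y / (1 - starRingEnd ℂ g * x) ^ 2)).re
          / (1 - ‖(x - g) / (1 - starRingEnd ℂ g * x)‖ ^ 2) := by
  have hne := one_sub_conj_mul_ne_zero hg hx
  have hgp : 0 < 1 - ‖g‖ ^ 2 := by nlinarith [norm_nonneg g]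
  have hxp : 0 < 1 - ‖x‖ ^ 2 := by nlinarith [norm_nonneg x]
  rw [one_sub_normSq_mobius hg hx]
  set d := 1 - starRingEnd ℂ g * x with hd
  have hdn : (0 : ℝ) < ‖d‖ ^ 2 := by have := norm_pos_iff.2 hne; positivity
  have hc : starRingEnd ℂ d ≠ 0 := by simpa using hne
  have hnd : ((‖d‖ ^ 2 : ℝ) : ℂ) = d * starRingEnd ℂ d := by
    rw [Complex.mul_conj, Complex.normSq_eq_norm_sq]
  have hnx : ((1 - ‖x‖ ^ 2 : ℝ) : ℂ) = 1 - x * starRingEnd ℂ x := by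
    rw [Complex.mul_conj, Complex.normSq_eq_norm_sq]; push_cast; rfl
  have hgc : ((1 - ‖g‖ ^ 2 : ℝ) : ℂ) ≠ 0 := by exact_mod_cast hgp.ne'
  have hxc : ((1 - ‖x‖ ^ 2 : ℝ) : ℂ) ≠ 0 := by exact_mod_cast hxp.ne'
  have hdc : ((‖d‖ ^ 2 : ℝ) : ℂ) ≠ 0 := by exact_mod_cast hdn.ne'
  have h2 : ∀ (c : ℂ) (r : ℝ), 2 * c.re / r = (2 * c / (r : ℂ)).re := by
    intro c r
    rw [Complex.div_ofReal_re]; simp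
  rw [h2, h2, ← Complex.add_re, ← Complex.add_re]
  congr 1
  rw [add_assoc]
  congr 1
  have e3 : ((((1 - ‖g‖ ^ 2) * (1 - ‖x‖ ^ 2) / ‖d‖ ^ 2 : ℝ)) : ℂ)
      = ((1 - ‖g‖ ^ 2 : ℝ) : ℂ) * ((1 - ‖x‖ ^ 2 : ℝ) : ℂ) / (d * starRingEnd ℂ d) := by
    rw [← hnd]; push_cast; rfl
  have hxc2 := hxc
  rw [e3, map_div₀, map_sub, hnx]
  rw [hnx] at hxc2
  have hxc3 : 1 - starRingEnd ℂ x * x ≠ 0 := by rwa [mul_comm]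
  have hdd : d = 1 - starRingEnd ℂ g * x := hd
  field_simp
  rw [hdd]
  ring

theorem SubJet.logVar {G K X : ℂ → ℂ} {z : ℂ} (hG : AnalyticAt ℂ G z) (hK : AnalyticAt ℂ K z)
    (hX : AnalyticAt ℂ X z) (h1 : ‖G z‖ < 1) (hd : deriv X z = deriv G z * K z) :
    SubJet (logVar G K X) z (2 * (‖deriv G z‖ / (1 - ‖G z‖ ^ 2)) ^ 2 * logVar G K X z) := by
  set g := G z with hg
  have hs : 0 < 1 - ‖g‖ ^ 2 := by nlinarith [norm_nonneg g]
  have hsc : ((1 - ‖g‖ ^ 2 : ℝ) : ℂ) ≠ 0 := by exact_mod_cast hs.ne'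
  have hM := analyticAt_mobAt hG h1
  have hne := one_sub_conj_mul_ne_zero h1 h1
  set Kt : ℂ → ℂ := fun x => K x + 2 * starRingEnd ℂ g * X x / (1 - starRingEnd ℂ g * G x) with hKt
  set Y : ℂ → ℂ := fun x => (1 - ‖g‖ ^ 2 : ℝ) * X x / (1 - starRingEnd ℂ g * G x) ^ 2 with hY
  have hKta : AnalyticAt ℂ Kt z := hK.add ((analyticAt_const.mul hX).div
    (analyticAt_const.sub (analyticAt_const.mul hG)) hne)
  have hYa : AnalyticAt ℂ Y z := (analyticAt_const.mul hX).div
    ((analyticAt_const.sub (analyticAt_const.mul hG)).pow 2) (pow_ne_zero 2 hne)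
  have hYd : deriv Y z = deriv (mobAt G z) z * Kt z := by
    have h2 := ((hX.differentiableAt.hasDerivAt.const_mul ((1 - ‖g‖ ^ 2 : ℝ) : ℂ)).div
      (((hG.differentiableAt.hasDerivAt.const_mul (starRingEnd ℂ g)).const_sub 1).pow 2)
      (pow_ne_zero 2 hne)).deriv
    have e : Y = ((fun x => ((1 - ‖g‖ ^ 2 : ℝ) : ℂ) * X x) /
      ((fun x => 1 - starRingEnd ℂ g * G x) ^ 2)) := rfl
    rw [e, h2, deriv_mobAt hG h1, hKt, hd]
    simp only [Pi.pow_apply, ← hg]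
    rw [one_sub_conj_mul_self]
    push_cast at hsc ⊢
    field_simp
    ring
  have hz : _root_.logVar G K X z = (Kt z).re := by
    rw [_root_.logVar, logVar_eq_mobius h1 h1]
    simp [hKt, hg]
  have hj := (SubJet.re hKta).add (SubJet.re_conj_mul hM hYa)
  have hL : 0 + 2 * (starRingEnd ℂ (deriv (mobAt G z) z) * deriv Y z).re
      = 2 * (‖deriv G z‖ / (1 - ‖g‖ ^ 2)) ^ 2 * _root_.logVar G K X z := by
    rw [hz, hYd, ← mul_assoc, ← Complex.normSq_eq_conj_mul_self, Complex.re_ofReal_mul,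
      Complex.normSq_eq_norm_sq, deriv_mobAt hG h1, norm_div, Complex.norm_real,
      Real.norm_of_nonneg hs.le]
    ring
  rw [hL] at hj
  obtain ⟨C, hC, hCw⟩ := normSq_mobAt_isLittleO hG h1
  refine hj.of_littleO ?_ fun ε hε => ?_
  · rw [hz, mobAt_self]; simp
  · have hev : ∀ᶠ w in 𝓝 (0 : ℂ), ‖G (z + w)‖ < 1 :=
      (tendsto_add_left_nhds_zero z).eventually (hG.continuousAt.norm.eventually_lt_const h1)
    have hev1 : ∀ᶠ w in 𝓝 (0 : ℂ), ‖Y (z + w)‖ < ‖Y z‖ + 1 :=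
      (tendsto_add_left_nhds_zero z).eventually
        (hYa.continuousAt.norm.eventually_lt_const (by linarith))
    have hev2 : ∀ᶠ w in 𝓝 (0 : ℂ), C ^ 2 * ‖w‖ ^ 2 < 1 / 2 := by
      have : ContinuousAt (fun w : ℂ => C ^ 2 * ‖w‖ ^ 2) 0 := by fun_prop
      exact this.eventually_lt_const (by norm_num)
    have hev3 : ∀ᶠ w in 𝓝 (0 : ℂ), 4 * C ^ 3 * (‖Y z‖ + 1) * ‖w‖ < ε := by
      have : ContinuousAt (fun w : ℂ => 4 * C ^ 3 * (‖Y z‖ + 1) * ‖w‖) 0 := by fun_prop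
      exact this.eventually_lt_const (by simpa using hε)
    filter_upwards [hev, hev1, hev2, hev3, hCw] with w hw hy h2 h3 h4
    have heq : _root_.logVar G K X (z + w) = (Kt (z + w)).re
        + 2 * (starRingEnd ℂ (mobAt G z (z + w)) * Y (z + w)).re
          / (1 - ‖mobAt G z (z + w)‖ ^ 2) := by
      rw [_root_.logVar, logVar_eq_mobius h1 hw]; rfl
    rw [heq]
    set M := mobAt G z (z + w) with hMdef
    set m := ‖M‖ ^ 2 with hm
    have hm0 : 0 ≤ m := by positivity
    have hmle : m ≤ C ^ 2 * ‖w‖ ^ 2 := by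
      rw [hm, ← mul_pow]; gcongr
    set T := 2 * (starRingEnd ℂ M * Y (z + w)).re with hT
    have hTle : |T| ≤ 2 * (C * ‖w‖ * (‖Y z‖ + 1)) := by
      rw [hT, abs_mul, abs_two]
      gcongr
      refine (Complex.abs_re_le_norm _).trans ?_
      rw [norm_mul, RCLike.norm_conj]
      gcongr
    have hpos : 0 < 1 - m := by linarith
    have h7 : (1 - m)⁻¹ ≤ 2 := by rw [inv_le_comm₀ hpos two_pos]; linarith
    have e5 : T / (1 - m) - T = T * (m * (1 - m)⁻¹) := by field_simp; ring
    have h8 : |T / (1 - m) - T| ≤ ε * ‖w‖ ^ 2 := by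
      rw [e5, abs_mul, abs_of_nonneg (a := m * (1 - m)⁻¹) (by positivity)]
      calc _ ≤ 2 * (C * ‖w‖ * (‖Y z‖ + 1)) * (C ^ 2 * ‖w‖ ^ 2 * 2) := by gcongr
        _ = 4 * C ^ 3 * (‖Y z‖ + 1) * ‖w‖ * ‖w‖ ^ 2 := by ring
        _ ≤ _ := by gcongr
    linarith [(abs_le.1 h8).1]

/-- The algebra of absolutely summable families, with convolution. -/
def Wien (M : Type) : Type := lp (fun _ : M => ℂ) 1

namespace Wien

variable {M : Type}

instance : NormedAddCommGroup (Wien M) := inferInstanceAs (NormedAddCommGroup (lp (fun _ : M => ℂ) 1))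
instance : NormedSpace ℂ (Wien M) := inferInstanceAs (NormedSpace ℂ (lp (fun _ : M => ℂ) 1))
instance : CompleteSpace (Wien M) := inferInstanceAs (CompleteSpace (lp (fun _ : M => ℂ) 1))

/-- Coefficients of an element. -/
def coef (f : Wien M) (m : M) : ℂ := (show lp (fun _ : M => ℂ) 1 from f) m

@[ext] theorem ext {f g : Wien M} (h : ∀ m, f.coef m = g.coef m) : f = g :=
  lp.ext (funext h)

@[simp] theorem coef_add (f g : Wien M) (m : M) : (f + g).coef m = f.coef m + g.coef m := rfl
@[simp] theorem coef_sub (f g : Wien M) (m : M) : (f - g).coef m = f.coef m - g.coef m := rfl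
@[simp] theorem coef_smul (c : ℂ) (f : Wien M) (m : M) : (c • f).coef m = c * f.coef m := rfl
@[simp] theorem coef_zero (m : M) : (0 : Wien M).coef m = 0 := rfl

theorem summable_norm (f : Wien M) : Summable fun m => ‖f.coef m‖ := by
  have := (memℓp_gen_iff (p := 1) (by simp)).1 (lp.memℓp (show lp (fun _ : M => ℂ) 1 from f))
  simpa [coef] using this

theorem norm_eq (f : Wien M) : ‖f‖ = ∑' m, ‖f.coef m‖ := by
  have := lp.norm_eq_tsum_rpow (p := 1) (by simp) (show lp (fun _ : M => ℂ) 1 from f)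
  simp only [ENNReal.toReal_one, Real.rpow_one, div_one] at this
  exact this

/-- Element with prescribed summable coefficients. -/
def mk (c : M → ℂ) (h : Summable fun m => ‖c m‖) : Wien M :=
  (⟨c, (memℓp_gen_iff (p := 1) (by simp)).2 (by simpa using h)⟩ : lp (fun _ : M => ℂ) 1)

@[simp] theorem coef_mk (c : M → ℂ) (h) (m : M) : (mk c h).coef m = c m := rfl

section lift

variable {E : Type*} [NormedAddCommGroup E] [NormedSpace ℂ E] [CompleteSpace E]

theorem summable_smul (f : Wien M) {φ : M → E} {C : ℝ} (h : ∀ m, ‖φ m‖ ≤ C) :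
    Summable fun m => f.coef m • φ m :=
  Summable.of_norm_bounded (f.summable_norm.mul_right C) fun m => by
    rw [norm_smul]; gcongr; exact h m

/-- The continuous linear map with prescribed bounded values on the basis. -/
def lift (φ : M → E) (C : ℝ) (h : ∀ m, ‖φ m‖ ≤ C) : Wien M →L[ℂ] E :=
  LinearMap.mkContinuous
    { toFun := fun f => ∑' m, f.coef m • φ m
      map_add' := fun f g => by
        simp only [coef_add, add_smul]
        exact (f.summable_smul h).tsum_add (g.summable_smul h)
      map_smul' := fun c f => by
        simp only [coef_smul, mul_smul, RingHom.id_apply]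
        exact (f.summable_smul h).tsum_const_smul c } C fun f => by
    have hs : Summable fun m => ‖f.coef m • φ m‖ :=
      Summable.of_nonneg_of_le (fun _ => norm_nonneg _) (fun m => by
        rw [norm_smul]; gcongr; exact h m) (f.summable_norm.mul_right C)
    refine (norm_tsum_le_tsum_norm hs).trans ?_
    rw [norm_eq, mul_comm, ← tsum_mul_right]
    refine hs.tsum_le_tsum (fun m => ?_) (f.summable_norm.mul_right C)
    rw [norm_smul]; gcongr; exact h m

theorem lift_apply (φ : M → E) (C : ℝ) (h) (f : Wien M) :
    lift φ C h f = ∑' m, f.coef m • φ m := rfl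

theorem norm_lift_apply_le (φ : M → E) (C : ℝ) (h) (f : Wien M) :
    ‖lift φ C h f‖ ≤ C * ‖f‖ := by
  have hs : Summable fun m => ‖f.coef m • φ m‖ :=
    Summable.of_nonneg_of_le (fun _ => norm_nonneg _) (fun m => by
      rw [norm_smul]; gcongr; exact h m) (f.summable_norm.mul_right C)
  refine (norm_tsum_le_tsum_norm hs).trans ?_
  rw [norm_eq, mul_comm, ← tsum_mul_right]
  refine hs.tsum_le_tsum (fun m => ?_) (f.summable_norm.mul_right C)
  rw [norm_smul]; gcongr; exact h m

end lift

variable [DecidableEq M]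

/-- Basis elements. -/
def single (m : M) : Wien M := lp.single (E := fun _ : M => ℂ) 1 m (1 : ℂ)

theorem coef_single (m k : M) : (single m).coef k = if k = m then 1 else 0 := by
  have : (single m).coef k = (Pi.single m (1 : ℂ) : M → ℂ) k := by
    simp only [coef, single, lp.coeFn_single]
  rw [this, Pi.single_apply]

@[simp] theorem norm_single (m : M) : ‖single m‖ = 1 := by
  rw [norm_eq, tsum_eq_single m]
  · simp [coef_single]
  · intro k hk; simp [coef_single, hk]

theorem hasSum_single (f : Wien M) : HasSum (fun m => f.coef m • single m) f := by
  have h := lp.hasSum_single (p := 1) (by simp) (show lp (fun _ : M => ℂ) 1 from f)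
  have e : (fun m => f.coef m • single m)
      = fun m => (show Wien M from lp.single (E := fun _ : M => ℂ) 1 m (f.coef m)) := by
    funext m
    apply ext
    intro k
    rw [coef_smul, coef_single]
    have : coef (show Wien M from lp.single (E := fun _ : M => ℂ) 1 m (f.coef m)) k
        = (Pi.single m (f.coef m) : M → ℂ) k := by
      simp only [coef, lp.coeFn_single]
    rw [this, Pi.single_apply]
    split_ifs with hk <;> simp
  rw [e]
  exact h

theorem lift_single {E : Type*} [NormedAddCommGroup E] [NormedSpace ℂ E] [CompleteSpace E]
    (φ : M → E) (C : ℝ) (h) (m : M) : lift φ C h (single m) = φ m := by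
  rw [lift_apply, tsum_eq_single m]
  · simp [coef_single]
  · intro k hk; simp [coef_single, hk]

theorem clm_ext {E : Type*} [NormedAddCommGroup E] [NormedSpace ℂ E] {A B : Wien M →L[ℂ] E}
    (h : ∀ m, A (single m) = B (single m)) : A = B := by
  ext f
  have hA := (hasSum_single f).mapL A
  have hB := (hasSum_single f).mapL B
  simp only [map_smul, h] at hA hB
  exact hA.unique hB

variable [AddCommMonoid M]

/-- Convolution. -/
def mulL : Wien M →L[ℂ] Wien M →L[ℂ] Wien M :=
  lift (fun m => lift (fun k => single (m + k)) 1 fun _ => (norm_single _).le) 1 fun _ =>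
    ContinuousLinearMap.opNorm_le_bound _ zero_le_one fun f => norm_lift_apply_le _ _ _ f

@[simp] theorem mulL_single (m k : M) : mulL (single m) (single k) = single (m + k) := by
  rw [mulL, lift_single, lift_single]

instance : Mul (Wien M) := ⟨fun f g => mulL f g⟩
instance : One (Wien M) := ⟨single 0⟩

theorem mul_def (f g : Wien M) : f * g = mulL f g := rfl
theorem one_def : (1 : Wien M) = single 0 := rfl

theorem single_mul_single (m k : M) : single m * single k = single (m + k) := mulL_single m k

protected theorem mul_comm' (f g : Wien M) : f * g = g * f := by
  have : (mulL : Wien M →L[ℂ] Wien M →L[ℂ] Wien M) = mulL.flip := by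
    refine clm_ext fun m => clm_ext fun k => ?_
    simp [add_comm]
  exact congrArg (fun A => A f g) this

protected theorem one_mul' (f : Wien M) : 1 * f = f := by
  have : mulL (1 : Wien M) = ContinuousLinearMap.id ℂ (Wien M) := by
    refine clm_ext fun k => ?_
    simp [one_def]
  exact congrArg (fun A => A f) this

protected theorem mul_assoc' (f g h : Wien M) : f * g * h = f * (g * h) := by
  have h1 : ∀ m k : M, (mulL (single m * single k) : Wien M →L[ℂ] Wien M)
      = (mulL (single m)).comp (mulL (single k)) := by
    intro m k
    refine clm_ext fun n => ?_
    simp [single_mul_single, add_assoc]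
  have h2 : ∀ m : M, (mulL.comp (mulL (single m)) : Wien M →L[ℂ] Wien M →L[ℂ] Wien M)
      = (ContinuousLinearMap.compL ℂ (Wien M) (Wien M) (Wien M) (mulL (single m))).comp mulL := by
    intro m
    refine clm_ext fun k => ?_
    exact h1 m k
  have h3 : (mulL.comp (mulL.flip g) : Wien M →L[ℂ] Wien M →L[ℂ] Wien M)
      = ((ContinuousLinearMap.compL ℂ (Wien M) (Wien M) (Wien M)).flip (mulL g)).comp mulL := by
    refine clm_ext fun m => ?_
    exact congrArg (fun A => A g) (h2 m)
  exact congrArg (fun A => A f h) h3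

instance : NormedCommRing (Wien M) :=
  { (inferInstance : NormedAddCommGroup (Wien M)) with
    mul := fun f g => f * g
    one := 1
    left_distrib := fun f g h => map_add (mulL f) g h
    right_distrib := fun f g h => by simp only [mul_def, map_add]; rfl
    zero_mul := fun f => by simp only [mul_def, map_zero]; rfl
    mul_zero := fun f => by simp only [mul_def, map_zero]
    mul_assoc := Wien.mul_assoc'
    one_mul := Wien.one_mul'
    mul_one := fun f => by rw [Wien.mul_comm']; exact Wien.one_mul' f
    mul_comm := Wien.mul_comm'
    norm_mul_le := fun f g => by
      have h1 := (mulL f).le_opNorm g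
      have h2 : ‖(mulL f : Wien M →L[ℂ] Wien M)‖ ≤ 1 * ‖f‖ := norm_lift_apply_le _ _ _ f
      calc ‖mulL f g‖ ≤ ‖(mulL f : Wien M →L[ℂ] Wien M)‖ * ‖g‖ := h1
        _ ≤ 1 * ‖f‖ * ‖g‖ := by gcongr
        _ = _ := by ring }

instance : NormedAlgebra ℂ (Wien M) :=
  { Algebra.ofModule (fun c f g => by simp only [mul_def, map_smul]; rfl)
      (fun c f g => by simp only [mul_def, map_smul]) with
    norm_smul_le := fun c f => (norm_smul c f).le }

instance : NormOneClass (Wien M) := ⟨norm_single _⟩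

/-- Evaluation at a bounded multiplicative character of `M`. -/
def ev (χ : M → ℂ) (hχ : ∀ m, ‖χ m‖ ≤ 1) (h0 : χ 0 = 1) (ha : ∀ m k, χ (m + k) = χ m * χ k) :
    Wien M →ₐ[ℂ] ℂ :=
  AlgHom.ofLinearMap (lift χ 1 hχ : Wien M →ₗ[ℂ] ℂ) (by
      change lift χ 1 hχ (single 0) = 1
      rw [lift_single, h0]) (by
    intro f g
    have : (ContinuousLinearMap.compL ℂ _ _ _ (lift χ 1 hχ)).comp mulL
        = (((ContinuousLinearMap.mul ℂ ℂ).comp (lift χ 1 hχ)).flip.comp (lift χ 1 hχ)).flip := by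
      refine clm_ext fun m => clm_ext fun k => ?_
      simp [lift_single, ha]
    exact congrArg (fun A => A f g) this)

theorem continuous_ev (χ : M → ℂ) (hχ h0 ha) : Continuous (ev χ hχ h0 ha) :=
  (lift χ 1 hχ).continuous

end Wien

namespace Wien

section general
variable {M : Type} [DecidableEq M]

/-- The coefficient functional. -/
def coefL (m : M) : Wien M →L[ℂ] ℂ :=
  lift (fun k => if k = m then 1 else 0) 1 fun k => by split_ifs <;> simp

@[simp] theorem coefL_apply (m : M) (f : Wien M) : coefL m f = f.coef m := by
  rw [coefL, lift_apply, tsum_eq_single m]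
  · simp
  · intro k hk; simp [hk]

end general

section circle

/-- Evaluation at a point of the unit circle. -/
def evC (ζ : Circle) : Wien ℤ →ₐ[ℂ] ℂ :=
  ev (fun k : ℤ => ((ζ ^ k : Circle) : ℂ)) (fun _ => (Circle.norm_coe _).le) (by simp)
    (fun m k => by rw [zpow_add, Circle.coe_mul])

theorem evC_apply (ζ : Circle) (f : Wien ℤ) :
    evC ζ f = ∑' k : ℤ, f.coef k * ((ζ ^ k : Circle) : ℂ) := rfl

theorem continuous_evC (ζ : Circle) : Continuous (evC ζ) := continuous_ev _ _ _ _

theorem norm_evC_le (ζ : Circle) (f : Wien ℤ) : ‖evC ζ f‖ ≤ ‖f‖ := by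
  have := norm_lift_apply_le (E := ℂ) (fun k : ℤ => ((ζ ^ k : Circle) : ℂ)) 1
    (fun _ => (Circle.norm_coe _).le) f
  rw [one_mul] at this
  exact this

@[simp] theorem evC_single (ζ : Circle) (k : ℤ) : evC ζ (single k) = ((ζ ^ k : Circle) : ℂ) :=
  lift_single (E := ℂ) _ _ _ k

instance : Fact (0 < 2 * Real.pi) := ⟨by positivity⟩

/-- The continuous function on the circle defined by a summable Fourier series. -/
def toC : Wien ℤ →L[ℂ] C(AddCircle (2 * Real.pi), ℂ) :=
  lift (fun k => fourier k) 1 fun k => (fourier_norm k).le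

theorem toC_apply (f : Wien ℤ) (x : AddCircle (2 * Real.pi)) :
    toC f x = evC (AddCircle.toCircle x) f := by
  have : (ContinuousMap.evalCLM ℂ x).comp toC
      = lift (E := ℂ) (fun k : ℤ => ((AddCircle.toCircle x ^ k : Circle) : ℂ)) 1
    (fun _ => (Circle.norm_coe _).le) := by
    refine clm_ext fun k => ?_
    simp only [ContinuousLinearMap.comp_apply, toC, lift_single, ContinuousMap.evalCLM_apply]
    rw [fourier_apply, AddCircle.toCircle_zsmul]
  exact congrArg (fun A => A f) this

theorem coef_eq_inner (f : Wien ℤ) (k : ℤ) :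
    f.coef k = inner ℂ (fourierLp (T := 2 * Real.pi) 2 k)
      (ContinuousMap.toLp 2 AddCircle.haarAddCircle ℂ (toC f)) := by
  have : coefL k = (innerSL ℂ (fourierLp (T := 2 * Real.pi) 2 k)).comp
      ((ContinuousMap.toLp 2 AddCircle.haarAddCircle ℂ).comp toC) := by
    refine clm_ext fun j => ?_
    have ho := orthonormal_iff_ite.1 (orthonormal_fourier (T := 2 * Real.pi)) k j
    simp only [coefL_apply, coef_single, ContinuousLinearMap.comp_apply, toC, lift_single,
      innerSL_apply_apply]
    exact ho.symm
  rw [← coefL_apply, this]; rfl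

theorem evC_injective {f g : Wien ℤ} (h : ∀ ζ, evC ζ f = evC ζ g) : f = g := by
  have : toC f = toC g := by
    ext x; rw [toC_apply, toC_apply, h]
  ext k
  rw [coef_eq_inner, coef_eq_inner, this]

theorem sum_normSq_coef_le (f : Wien ℤ) {C : ℝ} (h : ∀ ζ, ‖evC ζ f‖ ≤ C) (s : Finset ℤ) :
    ∑ k ∈ s, ‖f.coef k‖ ^ 2 ≤ C ^ 2 := by
  have h0 : 0 ≤ C := (norm_nonneg _).trans (h 1)
  simp only [coef_eq_inner]
  refine ((orthonormal_fourier (T := 2 * Real.pi)).sum_inner_products_le _).trans ?_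
  gcongr
  refine (Lp.norm_le_of_ae_bound (C := C) h0 ?_).trans ?_
  · filter_upwards [ContinuousMap.coeFn_toLp (p := 2) (𝕜 := ℂ) AddCircle.haarAddCircle (toC f)]
      with x hx
    rw [hx, toC_apply]; exact h _
  · simp [measureUnivNNReal]

instance : Star (Wien ℤ) :=
  ⟨fun f => mk (fun k => (starRingEnd ℂ) (f.coef (-k))) (by
    simpa [Function.comp_def] using (Equiv.neg ℤ).summable_iff.2 f.summable_norm)⟩

theorem coef_star (f : Wien ℤ) (k : ℤ) : (star f).coef k = (starRingEnd ℂ) (f.coef (-k)) := rfl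

@[simp] theorem evC_star (ζ : Circle) (f : Wien ℤ) :
    evC ζ (star f) = (starRingEnd ℂ) (evC ζ f) := by
  rw [evC_apply, evC_apply, Complex.conj_tsum, ← (Equiv.neg ℤ).tsum_eq]
  congr 1
  funext k
  simp only [Equiv.neg_apply, coef_star, neg_neg, map_mul, zpow_neg]
  rw [Circle.coe_inv_eq_conj]

instance : StarRing (Wien ℤ) where
  star_involutive f := by ext k; simp [coef_star]
  star_mul f g := evC_injective fun ζ => by simp [mul_comm]
  star_add f g := evC_injective fun ζ => by simp

instance : StarModule ℂ (Wien ℤ) := ⟨fun c f => evC_injective fun ζ => by simp⟩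

instance : NormedStarGroup (Wien ℤ) := ⟨fun f => by
  rw [norm_eq, norm_eq, ← (Equiv.neg ℤ).tsum_eq]
  simp [coef_star]⟩

theorem isSelfAdjoint_iff {f : Wien ℤ} : IsSelfAdjoint f ↔ ∀ ζ, (evC ζ f).im = 0 := by
  constructor
  · intro h ζ
    have := evC_star ζ f
    rw [h.star_eq] at this
    exact Complex.conj_eq_iff_im.1 this.symm
  · intro h
    exact evC_injective fun ζ => by
      rw [evC_star]; exact Complex.conj_eq_iff_im.2 (h ζ)

/-- Wiener's lemma. -/
theorem isUnit_of_evC_ne_zero {u : Wien ℤ} (h : ∀ ζ, evC ζ u ≠ 0) : IsUnit u := by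
  by_contra hu
  obtain ⟨f, hf⟩ := WeakDual.CharacterSpace.exists_apply_eq_zero hu
  have hv : ∀ k : ℤ, ‖f (single k)‖ ≤ 1 := fun k => by
    have := AlgHom.norm_apply_le_self_mul_norm_one
      (WeakDual.CharacterSpace.toAlgHom f) (single k)
    simpa using this
  have hm : ∀ k j : ℤ, f (single (k + j)) = f (single k) * f (single j) := fun k j => by
    rw [← single_mul_single, map_mul]
  have h0 : f (single (0 : ℤ)) = 1 := by rw [← one_def, map_one]
  have h1 : ‖f (single (1 : ℤ))‖ = 1 := by
    refine le_antisymm (hv 1) ?_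
    have h2 := hm 1 (-1)
    rw [add_neg_cancel, h0] at h2
    have h3 := congrArg norm h2
    rw [norm_one, norm_mul] at h3
    nlinarith [hv (-1), norm_nonneg (f (single (1 : ℤ)))]
  let ζ : Circle := ⟨f (single 1), by rw [Submonoid.unitSphere]; simpa using h1⟩
  have hz : ∀ k : ℤ, f (single k) = ((ζ ^ k : Circle) : ℂ) := by
    have hu0 : f (single (1 : ℤ)) ≠ 0 := fun h => by rw [h, norm_zero] at h1; exact zero_ne_one h1
    intro k
    rw [Circle.coe_zpow]
    change _ = f (single (1 : ℤ)) ^ k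
    induction k using Int.induction_on with
    | zero => simpa using h0
    | succ n ih => rw [hm, ih, zpow_add₀ hu0, zpow_one]
    | pred n ih =>
      have := hm (-(n : ℤ) - 1) 1
      rw [sub_add_cancel, ih] at this
      rw [zpow_sub₀ hu0, zpow_one, this]
      field_simp
  have hE : (WeakDual.CharacterSpace.toCLM f : Wien ℤ →L[ℂ] ℂ)
      = lift (E := ℂ) (fun k : ℤ => ((ζ ^ k : Circle) : ℂ)) 1
    (fun _ => (Circle.norm_coe _).le) := by
    refine clm_ext fun k => ?_
    rw [lift_single]
    exact hz k
  exact h ζ ((congrArg (fun A => A u) hE).symm.trans hf)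

end circle

section shift

/-- The weighted shift on one-sided sequences. -/
def shiftL (a : ℕ → ℝ) (C : ℝ) (h : ∀ n, |a n| ≤ C) : Wien ℕ →L[ℂ] Wien ℕ :=
  lift (fun n => (a n : ℂ) • single (n + 1)) C fun n => by
    rw [norm_smul, norm_single, mul_one, Complex.norm_real]; exact h n

theorem coef_shiftL_zero (a : ℕ → ℝ) (C h) (c : Wien ℕ) : (shiftL a C h c).coef 0 = 0 := by
  have : (coefL 0).comp (shiftL a C h) = 0 := clm_ext fun n => by
    simp [shiftL, lift_single, coef_single]
  rw [← coefL_apply]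
  exact congrArg (fun A => A c) this

theorem coef_shiftL_succ (a : ℕ → ℝ) (C h) (c : Wien ℕ) (n : ℕ) :
    (shiftL a C h c).coef (n + 1) = a n * c.coef n := by
  have : (coefL (n + 1)).comp (shiftL a C h) = (a n : ℂ) • coefL n := clm_ext fun m => by
    simp only [shiftL, ContinuousLinearMap.comp_apply, lift_single, coefL_apply, coef_smul,
      coef_single, _root_.smul_apply, smul_eq_mul, add_left_inj]
    by_cases hm : n = m
    · simp [hm]
    · simp [hm]
  rw [← coefL_apply, ← coefL_apply]
  exact congrArg (fun A => A c) this

theorem isCompactOperator_shiftL (a : ℕ → ℝ) (C h) (ha : Tendsto a atTop (𝓝 0)) :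
    IsCompactOperator (shiftL a C h) := by
  have hC : 0 ≤ C := (abs_nonneg _).trans (h 0)
  let T : ℕ → Wien ℕ →L[ℂ] Wien ℕ := fun N =>
    ∑ n ∈ Finset.range N, (coefL n).smulRight ((a n : ℂ) • single (n + 1))
  have hT : ∀ N, IsCompactOperator (T N) := fun N => by
    have : (T N : Wien ℕ → Wien ℕ) = ∑ n ∈ Finset.range N,
        ((coefL n).smulRight ((a n : ℂ) • single (n + 1)) : Wien ℕ → Wien ℕ) := by
      funext x; simp [T]
    rw [this]
    refine Finset.sum_induction _ (fun g : Wien ℕ → Wien ℕ => IsCompactOperator g)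
      (fun _ _ => IsCompactOperator.add) isCompactOperator_zero fun n _ => ?_
    have h1 : IsCompactOperator (ContinuousLinearMap.smulRight (1 : ℂ →L[ℂ] ℂ) ((a n : ℂ) • single (n + 1) : Wien ℕ)) :=
      ⟨_, (isCompact_closedBall (0 : ℂ) 1).image
        (ContinuousLinearMap.smulRight (1 : ℂ →L[ℂ] ℂ) ((a n : ℂ) • single (n + 1) : Wien ℕ)).continuous,
        mem_of_superset (Metric.closedBall_mem_nhds 0 one_pos) (subset_preimage_image _ _)⟩
    have := h1.comp_clm (coefL n)
    have e : ((coefL n).smulRight ((a n : ℂ) • single (n + 1)) : Wien ℕ → Wien ℕ)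
        = ContinuousLinearMap.smulRight (1 : ℂ →L[ℂ] ℂ) ((a n : ℂ) • single (n + 1) : Wien ℕ) ∘
          (coefL n) := by funext x; simp
    rw [e]; exact this
  refine isCompactOperator_of_tendsto (l := atTop) (F := T) ?_ (Eventually.of_forall hT)
  rw [Metric.tendsto_atTop]
  intro ε hε
  obtain ⟨N, hN⟩ := Metric.tendsto_atTop.1 ha (ε / 2) (by positivity)
  refine ⟨N, fun n hn => ?_⟩
  rw [dist_eq_norm]
  refine lt_of_le_of_lt ?_ (half_lt_self hε)
  have hb : ∀ m, ‖(if m < n then 0 else (-(a m : ℂ)) • single (m + 1) : Wien ℕ)‖ ≤ ε / 2 := by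
    intro m
    split_ifs with hm
    · simp; positivity
    · rw [norm_smul, norm_single, mul_one, norm_neg, Complex.norm_real]
      have := hN m (hn.trans (not_lt.1 hm))
      rw [dist_zero_right] at this
      exact this.le
  have : T n - shiftL a C h = lift _ (ε / 2) hb := by
    refine clm_ext fun m => ?_
    rw [lift_single]
    simp only [_root_.sub_apply, T, _root_.sum_apply,
      ContinuousLinearMap.smulRight_apply, coefL_apply, coef_single, ite_smul, one_smul, zero_smul,
      shiftL, lift_single]
    by_cases hm : m < n
    · rw [Finset.sum_ite_eq' (Finset.range n) m, if_pos (Finset.mem_range.2 hm), if_pos hm, sub_self]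
    · rw [Finset.sum_ite_eq' (Finset.range n) m, if_neg (by simpa using hm), if_neg hm, zero_sub,
        neg_smul]
  rw [this]
  exact ContinuousLinearMap.opNorm_le_bound _ (by positivity) fun f => norm_lift_apply_le _ _ _ f

end shift

end Wien

namespace Wien

/-- Evaluation of the power series in the closed disc, as an algebra map. -/
def evD (z : ℂ) (hz : ‖z‖ ≤ 1) : Wien ℕ →ₐ[ℂ] ℂ :=
  ev (fun n : ℕ => z ^ n) (fun n => by rw [norm_pow]; exact pow_le_one₀ (norm_nonneg _) hz)
    (pow_zero z) (pow_add z)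

/-- The sum of the power series. -/
def disc (c : Wien ℕ) (z : ℂ) : ℂ := ∑' n, c.coef n * z ^ n

theorem evD_apply (z : ℂ) (hz) (c : Wien ℕ) : evD z hz c = disc c z := rfl

theorem norm_term_le (c : Wien ℕ) {z : ℂ} (hz : ‖z‖ ≤ 1) (n : ℕ) :
    ‖c.coef n * z ^ n‖ ≤ ‖c.coef n‖ := by
  rw [norm_mul, norm_pow]
  exact mul_le_of_le_one_right (norm_nonneg _) (pow_le_one₀ (norm_nonneg _) hz)

theorem norm_disc_le (c : Wien ℕ) {z : ℂ} (hz : ‖z‖ ≤ 1) : ‖disc c z‖ ≤ ‖c‖ := by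
  rw [norm_eq]
  exact tsum_of_norm_bounded c.summable_norm.hasSum (norm_term_le c hz)

theorem continuousOn_disc (c : Wien ℕ) : ContinuousOn (disc c) (Metric.closedBall 0 1) :=
  continuousOn_tsum (fun n => by fun_prop) c.summable_norm fun n z hz =>
    norm_term_le c (by simpa using hz) n

theorem differentiableOn_disc (c : Wien ℕ) : DifferentiableOn ℂ (disc c) (Metric.ball 0 1) :=
  Complex.differentiableOn_tsum_of_summable_norm c.summable_norm (fun n => by fun_prop) Metric.isOpen_ball
    fun n z hz => norm_term_le c (by simpa using (mem_ball_zero_iff.1 hz).le) n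

theorem analyticAt_disc (c : Wien ℕ) {z : ℂ} (hz : ‖z‖ < 1) : AnalyticAt ℂ (disc c) z :=
  (differentiableOn_disc c).analyticAt (Metric.isOpen_ball.mem_nhds (by simpa using hz))

theorem disc_add (c d : Wien ℕ) {z : ℂ} (hz : ‖z‖ ≤ 1) : disc (c + d) z = disc c z + disc d z :=
  map_add (evD z hz) c d

theorem disc_sub (c d : Wien ℕ) {z : ℂ} (hz : ‖z‖ ≤ 1) : disc (c - d) z = disc c z - disc d z :=
  map_sub (evD z hz) c d

theorem disc_mul (c d : Wien ℕ) {z : ℂ} (hz : ‖z‖ ≤ 1) : disc (c * d) z = disc c z * disc d z :=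
  map_mul (evD z hz) c d

theorem disc_smul (s : ℂ) (c : Wien ℕ) {z : ℂ} (hz : ‖z‖ ≤ 1) : disc (s • c) z = s * disc c z :=
  map_smul (evD z hz) s c

instance {M : Type} [DecidableEq M] [AddCommMonoid M] : NormedAlgebra ℚ (Wien M) :=
  NormedAlgebra.restrictScalars ℚ ℂ (Wien M)

theorem disc_exp (c : Wien ℕ) {z : ℂ} (hz : ‖z‖ ≤ 1) :
    disc (NormedSpace.exp c) z = Complex.exp (disc c z) := by
  have := NormedSpace.map_exp (evD z hz) (continuous_ev _ _ _ _) c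
  rw [evD_apply, evD_apply, ← Complex.exp_eq_exp_ℂ] at this
  exact this

theorem evC_exp (f : Wien ℤ) (ζ : Circle) :
    evC ζ (NormedSpace.exp f) = Complex.exp (evC ζ f) := by
  have := NormedSpace.map_exp (evC ζ) (continuous_evC ζ) f
  rw [← Complex.exp_eq_exp_ℂ] at this
  exact this

theorem disc_zero_right (c : Wien ℕ) : disc c 0 = c.coef 0 := by
  rw [disc, tsum_eq_single 0]
  · simp
  · intro n hn; simp [hn]

/-- Antiderivative vanishing at the origin. -/
def integ : Wien ℕ →L[ℂ] Wien ℕ :=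
  shiftL (fun n => 1 / ((n : ℝ) + 1)) 1 fun n => by
    rw [abs_of_nonneg (by positivity), div_le_one (by positivity)]; linarith [n.cast_nonneg (α := ℝ)]

theorem isCompactOperator_integ : IsCompactOperator integ :=
  isCompactOperator_shiftL _ _ _ tendsto_one_div_add_atTop_nhds_zero_nat

theorem disc_integ_eq (c : Wien ℕ) {z : ℂ} (hz : ‖z‖ ≤ 1) :
    disc (integ c) z = ∑' n : ℕ, c.coef n * z ^ (n + 1) / (n + 1) := by
  have hs : Summable fun n => (integ c).coef n * z ^ n :=
    Summable.of_norm_bounded (integ c).summable_norm (norm_term_le _ hz)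
  rw [disc, hs.tsum_eq_zero_add, integ, coef_shiftL_zero]
  simp only [coef_shiftL_succ, zero_mul, zero_add]
  congr 1; funext n
  push_cast
  ring

theorem disc_integ_zero (c : Wien ℕ) : disc (integ c) 0 = 0 := by
  rw [disc_zero_right, integ, coef_shiftL_zero]

theorem hasDerivAt_disc_integ (c : Wien ℕ) {z : ℂ} (hz : ‖z‖ < 1) :
    HasDerivAt (disc (integ c)) (disc c z) z := by
  have h := hasDerivAt_tsum_of_isPreconnected (g := fun n (z : ℂ) => c.coef n * z ^ (n + 1) / (n + 1))
    (g' := fun n (z : ℂ) => c.coef n * z ^ n) c.summable_norm (Metric.isOpen_ball (x := (0 : ℂ)) (ε := 1))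
    (convex_ball 0 1).isPreconnected (fun n y _ => ?_)
    (fun n y hy => norm_term_le c (by simpa using (mem_ball_zero_iff.1 hy).le) n)
    (y₀ := 0) (by simp) (by simp) (y := z) (by simpa using hz)
  · refine h.congr_of_eventuallyEq ?_
    filter_upwards [Metric.isOpen_ball.mem_nhds (mem_ball_zero_iff.2 hz)] with w hw
    exact disc_integ_eq c (mem_ball_zero_iff.1 hw).le
  · have := ((hasDerivAt_pow (n + 1) y).const_mul (c.coef n)).div_const ((n : ℂ) + 1)
    refine this.congr_deriv ?_
    have : (n : ℂ) + 1 ≠ 0 := Nat.cast_add_one_ne_zero n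
    push_cast
    field_simp

/-- Inclusion of one-sided sequences. -/
def incl : Wien ℕ →L[ℂ] Wien ℤ := lift (fun n => single (n : ℤ)) 1 fun _ => (norm_single _).le

theorem evC_incl (ζ : Circle) (c : Wien ℕ) : evC ζ (incl c) = disc c ζ := by
  have : (lift (E := ℂ) (fun k : ℤ => ((ζ ^ k : Circle) : ℂ)) 1
      (fun _ => (Circle.norm_coe _).le)).comp incl = lift (E := ℂ) (fun n : ℕ => (ζ : ℂ) ^ n) 1
      (fun n => by rw [norm_pow, Circle.norm_coe, one_pow]) := clm_ext fun n => by
    simp [incl, lift_single]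
  exact congrArg (fun A => A c) this

theorem coef_incl (c : Wien ℕ) (n : ℕ) : (incl c).coef n = c.coef n := by
  have : (coefL (n : ℤ)).comp incl = coefL n := clm_ext fun m => by
    simp [incl, lift_single, coef_single]
  rw [← coefL_apply, ← coefL_apply, ← this]; rfl

theorem sum_normSq_coef_le_disc (c : Wien ℕ) {C : ℝ} (h : ∀ z : ℂ, ‖z‖ = 1 → ‖disc c z‖ ≤ C)
    (s : Finset ℕ) : ∑ k ∈ s, ‖c.coef k‖ ^ 2 ≤ C ^ 2 := by
  have := sum_normSq_coef_le (incl c) (fun ζ => by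
    rw [evC_incl]; exact h ζ (Circle.norm_coe ζ)) (s.map Nat.castEmbedding)
  simpa [coef_incl] using this

/-- The Schwarz (Herglotz) transform on Fourier series. -/
def schw : Wien ℤ →L[ℂ] Wien ℕ :=
  lift (fun k : ℤ => if k = 0 then single 0 else if 0 < k then (2 : ℂ) • single k.toNat else 0) 2
    fun k => by split_ifs <;> simp [norm_smul]

theorem coef_schw (f : Wien ℤ) (n : ℕ) :
    (schw f).coef n = (if n = 0 then 1 else 2) * f.coef n := by
  have : (coefL n).comp schw = (if n = 0 then 1 else 2 : ℂ) • coefL (n : ℤ) := clm_ext fun m => by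
    simp only [schw, ContinuousLinearMap.comp_apply, lift_single, coefL_apply,
      _root_.smul_apply, smul_eq_mul, coef_single]
    rcases lt_trichotomy m 0 with hm | rfl | hm
    · have h1 : ¬ ((n : ℤ) = m) := by omega
      simp [hm.ne, hm.not_gt, h1]
    · by_cases hn : n = 0 <;> simp [hn, coef_single]
    · lift m to ℕ using hm.le
      have hm' : m ≠ 0 := by omega
      have : 0 < m := by omega
      by_cases hn : n = m
      · subst hn; simp [this, hm', coef_single]
      · simp [this, hm', coef_single, hn]
  rw [← coefL_apply, ← coefL_apply]
  exact congrArg (fun A => A f) this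

theorem star_incl_schw (f : Wien ℤ) : incl (schw f) + star (incl (schw (star f))) = (2 : ℂ) • f := by
  have h2 : ∀ k : ℤ, ∀ c : Wien ℕ, (incl c).coef k = if 0 ≤ k then c.coef k.toNat else 0 := by
    intro k c
    split_ifs with hk
    · lift k to ℕ using hk
      rw [coef_incl]; simp
    · have : (coefL k).comp incl = 0 := clm_ext fun m => by
        have h1 : ¬ (k = m) := by omega
        simp [incl, lift_single, coef_single, h1]
      rw [← coefL_apply]
      exact congrArg (fun A => A c) this
  ext k
  simp only [coef_add, coef_star, h2, coef_smul, coef_schw]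
  rcases lt_trichotomy k 0 with hk | rfl | hk
  · have h3 : 0 ≤ -k := by omega
    have h4 : (-k).toNat ≠ 0 := by omega
    have h5 : ((-k).toNat : ℤ) = -k := by omega
    simp [hk.not_ge, h4, h5, hk.le]; left; exact Complex.conj_ofNat 2
  · simp; ring
  · have h3 : ¬ (0 ≤ -k) := by omega
    have h4 : k.toNat ≠ 0 := by omega
    have h5 : (k.toNat : ℤ) = k := by omega
    simp [hk.not_ge, h4, h5, hk.le]

theorem re_disc_schw {f : Wien ℤ} (hf : IsSelfAdjoint f) (ζ : Circle) :
    (disc (schw f) ζ).re = (evC ζ f).re := by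
  have := congrArg (fun g => (evC ζ g).re) (star_incl_schw f)
  simp only [hf.star_eq, map_add, evC_star, evC_incl, map_smul] at this
  simp at this
  linarith

theorem im_coef_schw_zero {f : Wien ℤ} (hf : IsSelfAdjoint f) : ((schw f).coef 0).im = 0 := by
  rw [coef_schw]
  have := coef_star f 0
  rw [hf.star_eq, neg_zero] at this
  simpa using Complex.conj_eq_iff_im.1 this.symm

theorem exists_tendsto_integ {c : ℕ → Wien ℕ} {C : ℝ}
    (h : ∀ n z, ‖z‖ = 1 → ‖disc (c n) z‖ ≤ C) :
    ∃ d : Wien ℕ, ∃ φ : ℕ → ℕ, StrictMono φ ∧ Tendsto (fun n => integ (c (φ n))) atTop (𝓝 d) := by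
  have hp : Summable fun n : ℕ => 1 / ((n : ℝ) + 1) ^ (3 / 2 : ℝ) := by
    have := (summable_nat_add_iff 1).2 (Real.summable_one_div_nat_rpow.2 (by norm_num : (1 : ℝ) < 3 / 2))
    simpa using this
  let w : ℕ → ℝ := fun n => 1 / ((n : ℝ) + 1) ^ (3 / 4 : ℝ)
  have hw0 : ∀ n, 0 ≤ w n := fun n => by positivity
  have hw : ∀ n, w n ^ 2 = 1 / ((n : ℝ) + 1) ^ (3 / 2 : ℝ) := fun n => by
    rw [div_pow, one_pow, ← Real.rpow_natCast, ← Real.rpow_mul (by positivity)]; norm_num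
  have hb : ∀ n k, ‖(w k : ℂ) * (c n).coef k‖ ≤ ‖(c n).coef k‖ ^ 2 + w k ^ 2 := fun n k => by
    rw [norm_mul, Complex.norm_real, Real.norm_of_nonneg (hw0 k)]
    nlinarith [sq_nonneg (‖(c n).coef k‖ - w k), sq_nonneg (‖(c n).coef k‖), sq_nonneg (w k)]
  have hs2 : ∀ n, Summable fun k => ‖(c n).coef k‖ ^ 2 := fun n =>
    summable_of_sum_le (fun _ => by positivity) (sum_normSq_coef_le_disc (c n) (h n))
  have hws : Summable fun k => w k ^ 2 := by simpa only [hw] using hp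
  have hs1 : ∀ n, Summable fun k => ‖(w k : ℂ) * (c n).coef k‖ := fun n =>
    Summable.of_nonneg_of_le (fun _ => norm_nonneg _) (hb n) ((hs2 n).add hws)
  let D : ℕ → Wien ℕ := fun n => mk _ (hs1 n)
  have hD : ∀ n, ‖D n‖ ≤ C ^ 2 + ∑' k, w k ^ 2 := fun n => by
    rw [norm_eq]
    simp only [D, coef_mk]
    refine ((hs1 n).tsum_le_tsum (hb n) ((hs2 n).add hws)).trans ?_
    rw [(hs2 n).tsum_add hws]
    gcongr
    exact Real.tsum_le_of_sum_le (fun _ => by positivity) (sum_normSq_coef_le_disc (c n) (h n))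
  have ha1 : ∀ n : ℕ, |1 / ((n : ℝ) + 1) ^ (1 / 4 : ℝ)| ≤ 1 := fun n => by
    rw [abs_of_nonneg (by positivity), div_le_one (by positivity)]
    exact Real.one_le_rpow (by linarith [n.cast_nonneg (α := ℝ)]) (by norm_num)
  have hT := isCompactOperator_shiftL (fun n => 1 / ((n : ℝ) + 1) ^ (1 / 4 : ℝ)) 1 ha1 (by
    have h1 : Tendsto (fun n : ℕ => ((n : ℝ) + 1) ^ (1 / 4 : ℝ)) atTop atTop :=
      (tendsto_rpow_atTop (by norm_num)).comp (tendsto_natCast_atTop_atTop.atTop_add tendsto_const_nhds)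
    simpa [Pi.inv_def] using h1.inv_tendsto_atTop)
  have he : ∀ n, integ (c n) = shiftL (fun n => 1 / ((n : ℝ) + 1) ^ (1 / 4 : ℝ)) 1 ha1 (D n) := by
    intro n
    ext k
    cases k with
    | zero => rw [integ, coef_shiftL_zero, coef_shiftL_zero]
    | succ k =>
      rw [integ, coef_shiftL_succ, coef_shiftL_succ]
      simp only [D, coef_mk]
      rw [← mul_assoc, ← Complex.ofReal_mul]
      congr 2
      simp only [w]
      rw [div_mul_div_comm, ← Real.rpow_add (by positivity)]
      norm_num
  have hK := hT.isCompact_closure_image_closedBall (C ^ 2 + ∑' k, w k ^ 2)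
  obtain ⟨d, -, φ, hφ, ht⟩ := hK.tendsto_subseq (x := fun n => integ (c n)) fun n => by
    rw [he]
    exact subset_closure ⟨D n, by simpa using hD n, rfl⟩
  exact ⟨d, φ, hφ, ht⟩

end Wien

namespace Wien

theorem norm_disc_le_of_circle (g : Wien ℕ) {m : ℝ} (h : ∀ ζ : Circle, ‖disc g ζ‖ ≤ m) {z : ℂ}
    (hz : ‖z‖ ≤ 1) : ‖disc g z‖ ≤ m := by
  refine Complex.norm_le_of_forall_mem_frontier_norm_le (U := Metric.ball 0 1) Metric.isBounded_ball
    ⟨differentiableOn_disc g, ?_⟩ (fun w hw => ?_) (z := z) ?_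
  · rw [closure_ball _ one_ne_zero]; exact continuousOn_disc g
  · rw [frontier_ball _ one_ne_zero] at hw
    exact h ⟨w, hw⟩
  · rw [closure_ball _ one_ne_zero]; simpa using hz

theorem norm_disc_lt_one (g : Wien ℕ) (h : ∀ ζ : Circle, ‖disc g ζ‖ < 1) {z : ℂ}
    (hz : ‖z‖ ≤ 1) : ‖disc g z‖ < 1 := by
  have hc : Continuous fun ζ : Circle => ‖disc g ζ‖ :=
    ((continuousOn_disc g).comp_continuous continuous_subtype_val fun ζ => by
      rw [mem_closedBall_zero_iff]; exact (Circle.norm_coe ζ).le).norm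
  obtain ⟨ζ, -, hζ⟩ := isCompact_univ.exists_isMaxOn (univ_nonempty (α := Circle)) hc.continuousOn
  exact (norm_disc_le_of_circle g (fun ξ => hζ (mem_univ ξ)) hz).trans_lt (h ζ)

theorem disc_eq_zero_of_eventually (k : Wien ℕ) (h : ∀ᶠ z in 𝓝 (0 : ℂ), disc k z = 0) {z : ℂ}
    (hz : ‖z‖ ≤ 1) : disc k z = 0 := by
  have h1 : EqOn (disc k) 0 (Metric.ball 0 1) :=
    ((differentiableOn_disc k).analyticOnNhd Metric.isOpen_ball).eqOn_zero_of_preconnected_of_eventuallyEq_zero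
      (convex_ball 0 1).isPreconnected (Metric.mem_ball_self one_pos) h
  have h2 : EqOn (disc k) 0 (closure (Metric.ball 0 1)) := by
    refine h1.of_subset_closure ?_ continuousOn_const subset_closure subset_rfl
    rw [closure_ball _ one_ne_zero]; exact continuousOn_disc k
  exact h2 (by rw [closure_ball _ one_ne_zero]; simpa using hz)

theorem norm_le_mul_pow_of_deriv {X K : ℂ → ℂ} {C ρ : ℝ} {n : ℕ} (hX0 : X 0 = 0)
    (hX : ∀ z, ‖z‖ < ρ → HasDerivAt X (K z) z) (hK : ∀ z, ‖z‖ < ρ → ‖K z‖ ≤ C * ‖z‖ ^ n)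
    (hC : 0 ≤ C) {z : ℂ} (hz : ‖z‖ < ρ) : ‖X z‖ ≤ C * ‖z‖ ^ (n + 1) := by
  have hseg : ∀ x ∈ segment ℝ (0 : ℂ) z, ‖x‖ ≤ ‖z‖ := fun x hx => by
    have := (convex_closedBall (0 : ℂ) ‖z‖).segment_subset (x := 0) (y := z) (by simp) (by simp) hx
    simpa using this
  have := (convex_segment (0 : ℂ) z).norm_image_sub_le_of_norm_hasDerivWithin_le (f := X) (f' := K)
    (C := C * ‖z‖ ^ n) (x := 0) (y := z)
    (fun x hx => (hX x ((hseg x hx).trans_lt hz)).hasDerivWithinAt)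
    (fun x hx => (hK x ((hseg x hx).trans_lt hz)).trans (by gcongr; exact hseg x hx))
    (left_mem_segment ℝ _ _) (right_mem_segment ℝ _ _)
  rw [hX0, sub_zero, sub_zero] at this
  rwa [pow_succ, ← mul_assoc]

/-- A vanishing order argument: an analytic function whose real part is dominated by its
weighted primitive vanishes. -/
theorem eventually_eq_zero_of_re_eq {K X G Y : ℂ → ℂ} (hK : AnalyticAt ℂ K 0) (hK0 : K 0 = 0)
    (hX0 : X 0 = 0) (hG0 : G 0 = 0) (hY : ContinuousAt Y 0)
    (hX : ∀ᶠ z in 𝓝 0, HasDerivAt X (Y z * K z) z) (hG : ∀ᶠ z in 𝓝 0, HasDerivAt G (Y z) z)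
    (h : ∀ᶠ z in 𝓝 (0 : ℂ), logVar G K X z = 0) : ∀ᶠ z in 𝓝 (0 : ℂ), K z = 0 := by
  by_contra hne
  obtain ⟨n, g, hg, hg0, hgK⟩ := (hK.exists_eventuallyEq_pow_smul_nonzero_iff).2 hne
  simp only [sub_zero, smul_eq_mul] at hgK
  have hn : n ≠ 0 := by
    rintro rfl
    have := hgK.self_of_nhds
    simp only [pow_zero, one_mul] at this
    exact hg0 (this.symm.trans hK0)
  obtain ⟨A, hA⟩ : ∃ A, ∀ᶠ z in 𝓝 (0 : ℂ), ‖Y z‖ ≤ A :=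
    ⟨_, (hY.norm.eventually (gt_mem_nhds (lt_add_one _))).mono fun _ h => h.le⟩
  have hB : ∀ᶠ z in 𝓝 (0 : ℂ), ‖g z‖ ≤ ‖g 0‖ + 1 :=
    (hg.continuousAt.norm.eventually (gt_mem_nhds (lt_add_one _))).mono fun _ h => h.le
  obtain ⟨ρ, hρ, hall⟩ := Metric.eventually_nhds_iff.1 (hX.and (hG.and (h.and (hgK.and (hA.and hB)))))
  simp only [dist_zero_right] at hall
  have hA0 : 0 ≤ A := (norm_nonneg _).trans (hall (y := 0) (by simpa using hρ)).2.2.2.2.1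
  set B := ‖g 0‖ + 1
  have hXb : ∀ z : ℂ, ‖z‖ < ρ → ‖X z‖ ≤ A * B * ‖z‖ ^ (n + 1) := fun z hz =>
    norm_le_mul_pow_of_deriv (K := fun z => Y z * K z) hX0 (fun z hz => (hall hz).1)
      (fun z hz => by
        obtain ⟨-, -, -, h1, h2, h3⟩ := hall hz
        rw [h1, norm_mul, norm_mul, norm_pow]
        calc ‖Y z‖ * (‖z‖ ^ n * ‖g z‖) ≤ A * (‖z‖ ^ n * B) := by gcongr
          _ = _ := by ring) (by positivity) hz
  have hGb : ∀ z : ℂ, ‖z‖ < ρ → ‖G z‖ ≤ A * ‖z‖ := fun z hz => by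
    have := norm_le_mul_pow_of_deriv (n := 0) hG0 (fun z hz => (hall hz).2.1)
      (fun z hz => by simpa using (hall hz).2.2.2.2.1) hA0 hz
    simpa using this
  -- choose a direction along which the leading term is positive
  obtain ⟨θ, hθ⟩ : ∃ u : ℂ, u ^ n = (starRingEnd ℂ) (g 0) / ‖g 0‖ := IsAlgClosed.exists_pow_nat_eq _ (Nat.pos_of_ne_zero hn)
  have hθ1 : ‖θ‖ = 1 := by
    have := congrArg norm hθ
    rw [norm_pow, norm_div, RCLike.norm_conj, Complex.norm_real, norm_norm,
      div_self (norm_ne_zero_iff.2 hg0)] at this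
    exact (pow_eq_one_iff_of_nonneg (norm_nonneg _) hn).1 this
  have hlim : Tendsto (fun s : ℝ => (θ ^ n * g (s * θ)).re) (𝓝[>] 0) (𝓝 ‖g 0‖) := by
    have h1 : Tendsto (fun s : ℝ => (θ ^ n * g (s * θ)).re) (𝓝 0) (𝓝 (θ ^ n * g 0).re) := by
      have h2 : ContinuousAt (fun s : ℝ => (s : ℂ) * θ) 0 := by fun_prop
      have h3 : ContinuousAt g ((fun s : ℝ => (s : ℂ) * θ) 0) := by simpa using hg.continuousAt
      have h4 := (ContinuousAt.comp (f := fun s : ℝ => (s : ℂ) * θ) h3 h2).tendsto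
      simp only [Function.comp_def, Complex.ofReal_zero, zero_mul] at h4
      exact (Complex.continuous_re.tendsto _).comp (h4.const_mul _)
    have h5 : (θ ^ n * g 0).re = ‖g 0‖ := by
      rw [hθ, div_mul_eq_mul_div, mul_comm, Complex.mul_conj, Complex.normSq_eq_norm_sq,
        ← Complex.ofReal_div, Complex.ofReal_re, pow_two, mul_self_div_self]
    rw [h5] at h1
    exact h1.mono_left nhdsWithin_le_nhds
  have hz : Tendsto (fun s : ℝ => 2 * (A * (A * B)) * s ^ 2 / (1 - A ^ 2 * s ^ 2)) (𝓝[>] 0) (𝓝 0) := by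
    have : ContinuousAt (fun s : ℝ => 2 * (A * (A * B)) * s ^ 2 / (1 - A ^ 2 * s ^ 2)) 0 :=
      ContinuousAt.div (by fun_prop) (by fun_prop) (by simp)
    have h2 := this.tendsto
    simp only [ne_eq, OfNat.ofNat_ne_zero, not_false_eq_true, zero_pow, mul_zero, zero_div] at h2
    exact h2.mono_left nhdsWithin_le_nhds
  have hle : ∀ᶠ s : ℝ in 𝓝[>] 0, (θ ^ n * g (s * θ)).re
      ≤ 2 * (A * (A * B)) * s ^ 2 / (1 - A ^ 2 * s ^ 2) := by
    have hAs : ∀ᶠ s : ℝ in 𝓝[>] 0, 0 < 1 - A ^ 2 * s ^ 2 := by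
      have : ContinuousAt (fun s : ℝ => 1 - A ^ 2 * s ^ 2) 0 := by fun_prop
      exact (this.eventually (lt_mem_nhds (by norm_num))).filter_mono nhdsWithin_le_nhds
    filter_upwards [self_mem_nhdsWithin, hAs, (gt_mem_nhds hρ).filter_mono nhdsWithin_le_nhds]
      with s hs hs1 hsρ
    have hs : 0 < s := hs
    have hsn : ‖(s : ℂ) * θ‖ = s := by rw [norm_mul, hθ1, Complex.norm_real, Real.norm_of_nonneg hs.le, mul_one]
    have hlt : ‖(s : ℂ) * θ‖ < ρ := by rw [hsn]; exact hsρ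
    obtain ⟨-, -, h1, h2, -, -⟩ := hall hlt
    have h3 := hXb _ hlt
    have h4 := hGb _ hlt
    rw [hsn] at h3 h4
    rw [logVar, h2] at h1
    have h5 : (((s : ℂ) * θ) ^ n * g (s * θ)).re = s ^ n * (θ ^ n * g (s * θ)).re := by
      rw [mul_pow, mul_assoc, ← Complex.ofReal_pow, Complex.re_ofReal_mul]
    rw [h5] at h1
    have h6 : -(2 * ((starRingEnd ℂ) (G (s * θ)) * X (s * θ)).re) ≤ 2 * (A * s * (A * B * s ^ (n + 1))) := by
      have h61 := (Complex.abs_re_le_norm ((starRingEnd ℂ) (G (s * θ)) * X (s * θ)))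
      rw [norm_mul, RCLike.norm_conj] at h61
      have h62 : ‖G (s * θ)‖ * ‖X (s * θ)‖ ≤ A * s * (A * B * s ^ (n + 1)) := by gcongr
      linarith [neg_abs_le ((starRingEnd ℂ) (G (s * θ)) * X (s * θ)).re]
    have h7 : 1 - A ^ 2 * s ^ 2 ≤ 1 - ‖G (s * θ)‖ ^ 2 := by
      rw [← mul_pow]; gcongr
    rw [le_div_iff₀ hs1]
    have h8 : (0 : ℝ) < s ^ n := by positivity
    have hd : 0 < 1 - ‖G (s * θ)‖ ^ 2 := hs1.trans_le h7
    rw [add_eq_zero_iff_eq_neg, ← neg_div, eq_div_iff hd.ne'] at h1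
    refine le_of_mul_le_mul_left ?_ h8
    rcases le_total 0 (θ ^ n * g (s * θ)).re with h9 | h9
    · calc s ^ n * ((θ ^ n * g (s * θ)).re * (1 - A ^ 2 * s ^ 2))
          ≤ s ^ n * ((θ ^ n * g (s * θ)).re * (1 - ‖G (s * θ)‖ ^ 2)) := by gcongr
        _ = -(2 * ((starRingEnd ℂ) (G (s * θ)) * X (s * θ)).re) := by rw [← h1]; ring
        _ ≤ _ := h6
        _ = _ := by ring
    · have hB : 0 ≤ B := by positivity
      calc s ^ n * ((θ ^ n * g (s * θ)).re * (1 - A ^ 2 * s ^ 2)) ≤ 0 :=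
          mul_nonpos_of_nonneg_of_nonpos h8.le (mul_nonpos_of_nonpos_of_nonneg h9 hs1.le)
        _ ≤ _ := by positivity
  have := le_of_tendsto_of_tendsto hlim hz hle
  exact hg0 (norm_le_zero_iff.1 this)

/-- Uniqueness for the linearised equation. -/
theorem eq_zero_of_linearized {c : Wien ℕ} {η : Wien ℤ} (hη : IsSelfAdjoint η)
    (hG : ∀ ζ : Circle, ‖disc (integ c) ζ‖ < 1)
    (h : ∀ ζ : Circle, logVar (disc (integ c)) (disc (schw η)) (disc (integ (c * schw η))) ζ = 0) :
    η = 0 := by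
  set G := disc (integ c)
  set K := disc (schw η)
  set X := disc (integ (c * schw η))
  have hG1 : ∀ z : ℂ, ‖z‖ ≤ 1 → ‖G z‖ < 1 := fun z => norm_disc_lt_one _ hG
  have hX : ∀ z : ℂ, ‖z‖ < 1 → HasDerivAt X (disc c z * K z) z := fun z hz => by
    rw [← disc_mul _ _ hz.le]; exact hasDerivAt_disc_integ _ hz
  have hGd : ∀ z : ℂ, ‖z‖ < 1 → HasDerivAt G (disc c z) z := fun z hz => hasDerivAt_disc_integ _ hz
  have hcont : ContinuousOn (logVar G K X) (Metric.closedBall 0 1) := by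
    have h1 := continuousOn_disc (integ c)
    have h2 := continuousOn_disc (schw η)
    have h3 := continuousOn_disc (integ (c * schw η))
    refine ContinuousOn.add (Complex.continuous_re.comp_continuousOn h2) (ContinuousOn.div ?_ ?_ ?_)
    · exact continuousOn_const.mul (Complex.continuous_re.comp_continuousOn
        ((Complex.continuous_conj.comp_continuousOn h1).mul h3))
    · exact continuousOn_const.sub (h1.norm.pow 2)
    · intro z hz
      have := hG1 z (by simpa using hz)
      have : ‖G z‖ ^ 2 < 1 := by
        have := norm_nonneg (G z); nlinarith
      exact (sub_pos.2 this).ne'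
  have hjet : ∀ z : ℂ, ‖z‖ < 1 → SubJet (logVar G K X) z
      (2 * (‖deriv G z‖ / (1 - ‖G z‖ ^ 2)) ^ 2 * logVar G K X z) := fun z hz =>
    SubJet.logVar (analyticAt_disc _ hz) (analyticAt_disc _ hz) (analyticAt_disc _ hz) (hG1 z hz.le)
      (by rw [(hX z hz).deriv, (hGd z hz).deriv])
  have hneg : ∀ z, logVar G (fun x => -K x) (fun x => -X x) z = -logVar G K X z := fun z => by
    simp only [logVar, mul_neg, Complex.neg_re]; ring
  have hjet' : ∀ z : ℂ, ‖z‖ < 1 → SubJet (logVar G (fun x => -K x) (fun x => -X x)) z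
      (2 * (‖deriv G z‖ / (1 - ‖G z‖ ^ 2)) ^ 2 * logVar G (fun x => -K x) (fun x => -X x) z) := fun z hz =>
    SubJet.logVar (analyticAt_disc _ hz) (analyticAt_disc _ hz).fun_neg (analyticAt_disc _ hz).fun_neg (hG1 z hz.le)
      (by rw [(hX z hz).fun_neg.deriv, (hGd z hz).deriv]; ring)
  have hle : ∀ z : ℂ, ‖z‖ ≤ 1 → logVar G K X z ≤ 0 := nonpos_of_subJet hcont
    (fun z hz => (h ⟨z, by simpa [Submonoid.unitSphere] using hz⟩).le)
    (fun z hz hp => (hjet z hz).mono (by positivity))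
  have hge : ∀ z : ℂ, ‖z‖ ≤ 1 → logVar G (fun x => -K x) (fun x => -X x) z ≤ 0 := nonpos_of_subJet
    (by rw [funext hneg]; exact hcont.fun_neg)
    (fun z hz => by rw [hneg, neg_nonpos]; exact (h ⟨z, by simpa [Submonoid.unitSphere] using hz⟩).ge)
    (fun z hz hp => (hjet' z hz).mono (by positivity))
  have heq : ∀ z : ℂ, ‖z‖ ≤ 1 → logVar G K X z = 0 := fun z hz =>
    le_antisymm (hle z hz) (by have := hge z hz; rw [hneg] at this; linarith)
  have hG0 : G 0 = 0 := disc_integ_zero _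
  have hK0 : K 0 = 0 := by
    have h1 := heq 0 (by simp)
    simp only [logVar, hG0, map_zero, zero_mul, Complex.zero_re, mul_zero, zero_div, add_zero] at h1
    refine Complex.ext h1 ?_
    rw [Complex.zero_im, ← im_coef_schw_zero hη, ← disc_zero_right]
  have hb : ∀ᶠ z in 𝓝 (0 : ℂ), ‖z‖ < 1 := by
    filter_upwards [Metric.ball_mem_nhds (0 : ℂ) one_pos] with z hz using mem_ball_zero_iff.1 hz
  have hev : ∀ᶠ z in 𝓝 (0 : ℂ), K z = 0 :=
    eventually_eq_zero_of_re_eq (analyticAt_disc _ (by simp)) hK0 (disc_integ_zero _) hG0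
      (analyticAt_disc c (by simp)).continuousAt (hb.mono hX) (hb.mono hGd)
      (hb.mono fun z hz => heq z hz.le)
  refine evC_injective fun ζ => ?_
  rw [map_zero]
  refine Complex.ext ?_ (isSelfAdjoint_iff.1 hη ζ)
  rw [← re_disc_schw hη, disc_eq_zero_of_eventually _ hev (Circle.norm_coe ζ).le]

end Wien

namespace Wien

/-- The squared modulus on the circle. -/
def sqMod (g : Wien ℕ) : Wien ℤ := incl g * star (incl g)

theorem evC_sqMod (ζ : Circle) (g : Wien ℕ) : evC ζ (sqMod g) = ((‖disc g ζ‖ ^ 2 : ℝ) : ℂ) := by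
  rw [sqMod, map_mul, evC_star, evC_incl, Complex.mul_conj, Complex.normSq_eq_norm_sq]

theorem isSelfAdjoint_sqMod (g : Wien ℕ) : IsSelfAdjoint (sqMod g) :=
  isSelfAdjoint_iff.2 fun ζ => by rw [evC_sqMod, Complex.ofReal_im]

theorem continuous_sqMod : Continuous sqMod :=
  incl.continuous.mul (continuous_star.comp incl.continuous)

/-- The integrand of the nonlinear problem. -/
def source (c : Wien ℕ) (f : Wien ℤ) : Wien ℕ := c * NormedSpace.exp (schw f)

theorem continuous_exp_wien {M : Type} [DecidableEq M] [AddCommMonoid M] :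
    Continuous (NormedSpace.exp : Wien M → Wien M) := NormedSpace.exp_continuous

/-- The nonlinear boundary problem `e^f = 1 - |∫ c e^{Sf}|²` on the circle. -/
def Sol (c : Wien ℕ) (f : Wien ℤ) : Prop :=
  IsSelfAdjoint f ∧ NormedSpace.exp f = 1 - sqMod (integ (source c f))

theorem disc_source (c : Wien ℕ) (f : Wien ℤ) {z : ℂ} (hz : ‖z‖ ≤ 1) :
    disc (source c f) z = disc c z * Complex.exp (disc (schw f) z) := by
  rw [source, disc_mul _ _ hz, disc_exp _ hz]

variable {c : Wien ℕ} {f : Wien ℤ}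

theorem Sol.exp_eq (h : Sol c f) (ζ : Circle) :
    Real.exp (disc (schw f) ζ).re = 1 - ‖disc (integ (source c f)) ζ‖ ^ 2 := by
  have h1 := congrArg (evC ζ) h.2
  rw [evC_exp, map_sub, map_one, evC_sqMod] at h1
  have h2 : evC ζ f = ((evC ζ f).re : ℂ) := Complex.ext rfl (by
    rw [isSelfAdjoint_iff.1 h.1, Complex.ofReal_im])
  rw [h2, ← re_disc_schw h.1] at h1
  exact_mod_cast h1

theorem Sol.norm_lt_one (h : Sol c f) {z : ℂ} (hz : ‖z‖ ≤ 1) :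
    ‖disc (integ (source c f)) z‖ < 1 :=
  norm_disc_lt_one _ (fun ζ => by
    have h1 := h.exp_eq ζ
    have h2 := Real.exp_pos (disc (schw f) ζ).re
    have := norm_nonneg (disc (integ (source c f)) ζ)
    nlinarith) hz

theorem Sol.one_sub_pos (h : Sol c f) {z : ℂ} (hz : ‖z‖ ≤ 1) :
    0 < 1 - ‖disc (integ (source c f)) z‖ ^ 2 := by
  have := h.norm_lt_one hz
  have := norm_nonneg (disc (integ (source c f)) z)
  nlinarith

theorem Sol.continuousOn_log (h : Sol c f) :
    ContinuousOn (fun z => Real.log (1 - ‖disc (integ (source c f)) z‖ ^ 2)) (Metric.closedBall 0 1) :=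
  (continuousOn_const.sub ((continuousOn_disc _).norm.pow 2)).log fun _ hz =>
    (h.one_sub_pos (by simpa using hz)).ne'

theorem Sol.re_le_log (h : Sol c f) {z : ℂ} (hz : ‖z‖ ≤ 1) :
    (disc (schw f) z).re ≤ Real.log (1 - ‖disc (integ (source c f)) z‖ ^ 2) := by
  have := nonpos_of_subJet (ψ := fun z => (disc (schw f) z).re +
      -Real.log (1 - ‖disc (integ (source c f)) z‖ ^ 2))
    ((Complex.continuous_re.comp_continuousOn (continuousOn_disc _)).add h.continuousOn_log.fun_neg)
    (fun z hz => by
      have := h.exp_eq ⟨z, by simpa [Submonoid.unitSphere] using hz⟩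
      change Real.exp (disc (schw f) z).re = _ at this
      change _ + -Real.log (1 - ‖disc (integ (source c f)) z‖ ^ 2) ≤ 0
      have h2 := congrArg Real.log this
      rw [Real.log_exp] at h2
      rw [h2]; exact (add_neg_cancel _).le)
    (fun z hz _ => by
      have := (SubJet.re (analyticAt_disc (schw f) hz)).add
        (SubJet.neg_log_one_sub_normSq (analyticAt_disc (integ (source c f)) hz) (h.norm_lt_one hz.le))
      rwa [add_zero] at this) z hz
  linarith

theorem Sol.exp_le (h : Sol c f) {z : ℂ} (hz : ‖z‖ ≤ 1) :
    Real.exp (disc (schw f) z).re ≤ 1 - ‖disc (integ (source c f)) z‖ ^ 2 := by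
  rw [← Real.le_log_iff_exp_le (h.one_sub_pos hz)]; exact h.re_le_log hz

theorem Sol.norm_source_le (h : Sol c f) {M : ℝ} (hM : ∀ z, ‖z‖ ≤ 1 → ‖disc c z‖ ≤ M) {z : ℂ}
    (hz : ‖z‖ ≤ 1) :
    ‖disc (source c f) z‖ ≤ M * (1 - ‖disc (integ (source c f)) z‖ ^ 2) := by
  rw [disc_source _ _ hz, norm_mul, Complex.norm_exp]
  exact mul_le_mul (hM z hz) (h.exp_le hz) (Real.exp_pos _).le ((norm_nonneg _).trans (hM z hz))

/-- Gronwall-type lower bound. -/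
theorem Sol.le_one_sub (h : Sol c f) {M : ℝ} (hM : ∀ z, ‖z‖ ≤ 1 → ‖disc c z‖ ≤ M) {z : ℂ}
    (hz : ‖z‖ ≤ 1) :
    Real.exp (-(2 * M)) ≤ 1 - ‖disc (integ (source c f)) z‖ ^ 2 := by
  have hM0 : 0 ≤ M := (norm_nonneg _).trans (hM 0 (by simp))
  set G := disc (integ (source c f)) with hGdef
  have hn : ∀ s ∈ Icc (0 : ℝ) 1, ‖(s : ℂ) * z‖ ≤ 1 := fun s hs => by
    rw [norm_mul, Complex.norm_real, Real.norm_of_nonneg hs.1]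
    exact mul_le_one₀ hs.2 (norm_nonneg _) hz
  have hn' : ∀ s ∈ Ioo (0 : ℝ) 1, ‖(s : ℂ) * z‖ < 1 := fun s hs => by
    rw [norm_mul, Complex.norm_real, Real.norm_of_nonneg hs.1.le]
    exact (mul_le_of_le_one_right hs.1.le hz).trans_lt hs.2
  let D : ℝ → ℝ := fun s => (1 - ‖G (s * z)‖ ^ 2) * Real.exp (2 * M * s)
  have hcG : ContinuousOn (fun s : ℝ => G (s * z)) (Icc 0 1) :=
    (continuousOn_disc _).comp (by fun_prop) fun s hs => by simpa using hn s hs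
  have hmono : MonotoneOn D (Icc 0 1) := by
    refine monotoneOn_of_deriv_nonneg (convex_Icc 0 1) ?_ ?_ ?_
    · exact (continuousOn_const.sub (hcG.norm.pow 2)).mul (by fun_prop)
    all_goals
      intro s hs
      rw [interior_Icc] at hs
      have hd : HasDerivAt (fun s : ℝ => G (s * z)) (disc (source c f) (s * z) * z) s := by
        have h1 := hasDerivAt_disc_integ (source c f) (hn' s hs)
        have h2 : HasDerivAt (fun s : ℝ => (s : ℂ) * z) (1 * z) s :=
          (Complex.ofRealCLM.hasDerivAt (x := s)).mul_const z
        rw [one_mul] at h2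
        exact h1.comp s h2
      have hd2 := hd.norm_sq
      have hd3 : HasDerivAt D _ s := (hd2.const_sub 1).mul
        (((hasDerivAt_id s).const_mul (2 * M)).exp)
    · exact hd3.differentiableAt.differentiableWithinAt
    · rw [hd3.deriv]
      have h4 := h.norm_source_le hM (hn' s hs).le
      rw [← hGdef] at h4
      have h5 : inner ℝ (G (s * z)) (disc (source c f) (s * z) * z) ≤ M * (1 - ‖G (s * z)‖ ^ 2) := by
        refine (real_inner_le_norm _ _).trans ?_
        have h6 := (h.norm_lt_one (hn' s hs).le).le
        rw [← hGdef] at h6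
        rw [norm_mul]
        calc ‖G (s * z)‖ * (‖disc (source c f) (s * z)‖ * ‖z‖)
            ≤ 1 * (‖disc (source c f) (s * z)‖ * 1) := by gcongr
          _ ≤ _ := by linarith
      have h7 := Real.exp_pos (2 * M * s)
      simp only [id, mul_one]
      nlinarith
  have h1 := hmono (left_mem_Icc.2 zero_le_one) (right_mem_Icc.2 zero_le_one) zero_le_one
  simp only [D, Complex.ofReal_zero, zero_mul, Complex.ofReal_one, one_mul, mul_zero, Real.exp_zero, mul_one] at h1
  rw [show G 0 = 0 from disc_integ_zero _, norm_zero] at h1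
  rw [Real.exp_neg, inv_le_iff_one_le_mul₀ (Real.exp_pos _)]
  linarith

/-- A small perturbation of the identity has a small self-adjoint logarithm. -/
theorem exists_log_near_one {e : ℕ → Wien ℤ} (he : Tendsto e atTop (𝓝 1))
    (hs : ∀ n, IsSelfAdjoint (e n)) :
    ∃ s : ℕ → Wien ℤ, Tendsto s atTop (𝓝 0) ∧ (∀ n, IsSelfAdjoint (s n)) ∧
      ∀ᶠ n in atTop, NormedSpace.exp (s n) = e n := by
  have hd : HasStrictFDerivAt (NormedSpace.exp : Wien ℤ → Wien ℤ)
      ((ContinuousLinearEquiv.refl ℂ (Wien ℤ) : Wien ℤ ≃L[ℂ] Wien ℤ) : Wien ℤ →L[ℂ] Wien ℤ) 0 :=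
    hasStrictFDerivAt_exp_zero
  have h0 : NormedSpace.exp (0 : Wien ℤ) = 1 := NormedSpace.exp_zero
  have hc := hd.localInverse_continuousAt
  have h1 := hd.localInverse_apply_image
  rw [h0] at hc h1
  have hr := hd.eventually_right_inverse
  rw [h0] at hr
  set L := hd.localInverse
  let s : ℕ → Wien ℤ := fun n => (2⁻¹ : ℝ) • (L (e n) + star (L (e n)))
  have hL : Tendsto (fun n => L (e n)) atTop (𝓝 0) := by
    have := hc.tendsto.comp he
    rwa [h1] at this
  refine ⟨s, ?_, fun n => ?_, ?_⟩
  · have : Tendsto s atTop (𝓝 ((2⁻¹ : ℝ) • (0 + star 0))) := (hL.add hL.star).const_smul _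
    simpa using this
  · exact (IsSelfAdjoint.all (2⁻¹ : ℝ)).smul (IsSelfAdjoint.add_star_self _)
  · have hpos : ∀ᶠ n in atTop, ‖e n - 1‖ < 1 := by
      have := (he.sub_const 1).norm
      rw [sub_self, norm_zero] at this
      exact this.eventually (gt_mem_nhds one_pos)
    filter_upwards [he.eventually hr, hpos] with n hn hp
    refine evC_injective fun ζ => ?_
    have h2 : evC ζ (e n) = ((evC ζ (e n)).re : ℂ) := Complex.ext rfl (by
      rw [isSelfAdjoint_iff.1 (hs n), Complex.ofReal_im])
    have h3 : 0 < (evC ζ (e n)).re := by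
      have h4 := (norm_evC_le ζ (e n - 1)).trans_lt hp
      rw [map_sub, map_one] at h4
      have h5 := (Complex.abs_re_le_norm _).trans_lt h4
      rw [Complex.sub_re, Complex.one_re] at h5
      linarith [(abs_lt.1 h5).1]
    have h6 : Complex.exp (evC ζ (L (e n))) = evC ζ (e n) := by rw [← evC_exp, hn]
    have h7 : evC ζ (s n) = ((evC ζ (L (e n))).re : ℂ) := by
      have : s n = (2⁻¹ : ℂ) • (L (e n) + star (L (e n))) := by
        simp only [s]
        rw [← Complex.coe_smul]; norm_num
      rw [this, map_smul, map_add, evC_star, Complex.add_conj, smul_eq_mul]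
      push_cast; ring
    rw [evC_exp, h7, h2, ← Complex.ofReal_exp, ← Complex.norm_exp, h6, h2, Complex.norm_real,
      Real.norm_of_nonneg h3.le, Complex.ofReal_re]

theorem exp_injective_of_isSelfAdjoint {f g : Wien ℤ} (hf : IsSelfAdjoint f) (hg : IsSelfAdjoint g)
    (h : NormedSpace.exp f = NormedSpace.exp g) : f = g := evC_injective fun ζ => by
  have h1 := congrArg (evC ζ) h
  rw [evC_exp, evC_exp] at h1
  have h2 := congrArg norm h1
  rw [Complex.norm_exp, Complex.norm_exp] at h2
  exact Complex.ext (Real.exp_injective h2) (by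
    rw [isSelfAdjoint_iff.1 hf, isSelfAdjoint_iff.1 hg])

theorem isSelfAdjoint_exp {f : Wien ℤ} (hf : IsSelfAdjoint f) : IsSelfAdjoint (NormedSpace.exp f) := by
  refine isSelfAdjoint_iff.2 fun ζ => ?_
  rw [evC_exp, Complex.exp_im, isSelfAdjoint_iff.1 hf, Real.sin_zero, mul_zero]

/-- Closedness in the continuity method. -/
theorem exists_sol_of_tendsto {c : ℕ → Wien ℕ} {c₀ : Wien ℕ} {f : ℕ → Wien ℤ}
    (hc : Tendsto c atTop (𝓝 c₀)) (h : ∀ n, Sol (c n) (f n)) : ∃ f₀, Sol c₀ f₀ := by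
  obtain ⟨M, hM⟩ : ∃ M, ∀ n, ‖c n‖ ≤ M := by
    obtain ⟨M, hM⟩ := hc.norm.bddAbove_range
    exact ⟨M, fun n => hM ⟨n, rfl⟩⟩
  have hM' : ∀ n z, ‖z‖ ≤ 1 → ‖disc (c n) z‖ ≤ M := fun n z hz => (norm_disc_le _ hz).trans (hM n)
  have hM0 : 0 ≤ M := (norm_nonneg _).trans (hM 0)
  obtain ⟨g, φ, hφ, hg⟩ := exists_tendsto_integ (c := fun n => source (c n) (f n)) (C := M)
    fun n z hz => ((h n).norm_source_le (hM' n) hz.le).trans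
      (mul_le_of_le_one_right hM0 (by nlinarith [norm_nonneg (disc (integ (source (c n) (f n))) z)]))
  have hexp : Tendsto (fun n => NormedSpace.exp (f (φ n))) atTop (𝓝 (1 - sqMod g)) := by
    simp only [(h _).2]
    exact tendsto_const_nhds.sub ((continuous_sqMod.tendsto _).comp hg)
  set u := 1 - sqMod g
  have hus : IsSelfAdjoint u := (IsSelfAdjoint.one _).sub (isSelfAdjoint_sqMod g)
  have hu : IsUnit u := isUnit_of_evC_ne_zero fun ζ h0 => by
    have h1 : Tendsto (fun n => ‖evC ζ (NormedSpace.exp (f (φ n)))‖) atTop (𝓝 ‖evC ζ u‖) :=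
      (((continuous_evC ζ).tendsto _).comp hexp).norm
    have h2 : Real.exp (-(2 * M)) ≤ ‖evC ζ u‖ := ge_of_tendsto' h1 fun n => by
      rw [evC_exp, Complex.norm_exp, ← re_disc_schw (h _).1, (h _).exp_eq]
      exact (h (φ n)).le_one_sub (hM' _) (Circle.norm_coe ζ).le
    rw [h0, norm_zero] at h2
    exact (Real.exp_pos _).not_ge h2
  obtain ⟨u, hu'⟩ := hu
  have hinv : IsSelfAdjoint (↑u⁻¹ : Wien ℤ) := isSelfAdjoint_iff.2 fun ζ => by
    have h1 : evC ζ (u : Wien ℤ) * evC ζ (↑u⁻¹ : Wien ℤ) = 1 := by rw [← map_mul, Units.mul_inv, map_one]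
    have h2 := eq_inv_of_mul_eq_one_right h1
    rw [h2, Complex.inv_im, hu', isSelfAdjoint_iff.1 hus, neg_zero, zero_div]
  obtain ⟨s, hs0, hss, hse⟩ := exists_log_near_one
    (e := fun n => NormedSpace.exp (f (φ n)) * (↑u⁻¹ : Wien ℤ)) (by
      have := hexp.mul_const (↑u⁻¹ : Wien ℤ)
      rwa [← hu', Units.mul_inv] at this) fun n => (isSelfAdjoint_exp (h _).1).mul hinv
  have hf : ∀ᶠ n in atTop, NormedSpace.exp (f (φ n) - s n) = u := hse.mono fun n hn => by
    rw [sub_eq_add_neg, NormedSpace.exp_add]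
    have h1 : NormedSpace.exp (s n) * NormedSpace.exp (-s n) = 1 := by
      rw [← NormedSpace.exp_add, add_neg_cancel, NormedSpace.exp_zero]
    rw [hn] at h1
    have h2 : NormedSpace.exp (f (φ n)) * NormedSpace.exp (-s n)
      = u * (NormedSpace.exp (f (φ n)) * (↑u⁻¹ : Wien ℤ) * NormedSpace.exp (-s n)) := by
      have h3 := u.mul_inv
      linear_combination (-NormedSpace.exp (f (φ n)) * NormedSpace.exp (-s n)) * h3
    rw [h2, h1, mul_one]
  obtain ⟨N, hN⟩ := hf.exists
  set f₀ := f (φ N) - s N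
  have hf₀ : IsSelfAdjoint f₀ := (h _).1.sub (hss N)
  have hlim : Tendsto (fun n => f (φ n)) atTop (𝓝 f₀) := by
    have h1 : ∀ᶠ n in atTop, f₀ + s n = f (φ n) := hf.mono fun n hn => by
      rw [exp_injective_of_isSelfAdjoint hf₀ ((h (φ n)).1.sub (hss n)) (hN.trans hn.symm), sub_add_cancel]
    have h2 := (hs0.const_add f₀).congr' h1
    rwa [add_zero] at h2
  refine ⟨f₀, hf₀, ?_⟩
  have h3 : Tendsto (fun n => integ (source (c (φ n)) (f (φ n)))) atTop (𝓝 (integ (source c₀ f₀))) :=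
    (integ.continuous.tendsto _).comp ((hc.comp hφ.tendsto_atTop).mul
      ((continuous_exp_wien.tendsto _).comp ((schw.continuous.tendsto _).comp hlim)))
  rw [tendsto_nhds_unique h3 hg, hN, hu']

end Wien

namespace Wien

instance : CompleteSpace (selfAdjoint (Wien ℤ)) :=
  IsClosed.completeSpace_coe (hs := (isClosed_eq continuous_star continuous_id :
    IsClosed {x : Wien ℤ | star x = x}))

/-- Inclusion of the self-adjoint elements. -/
def saL : selfAdjoint (Wien ℤ) →L[ℝ] Wien ℤ :=
  ⟨{ toFun := fun f => f, map_add' := fun _ _ => rfl, map_smul' := fun _ _ => rfl },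
    continuous_subtype_val⟩

@[simp] theorem saL_apply (f : selfAdjoint (Wien ℤ)) : saL f = f := rfl

/-- Projection onto the self-adjoint elements. -/
def saP : Wien ℤ →L[ℝ] selfAdjoint (Wien ℤ) := selfAdjointPartL ℝ (Wien ℤ)

theorem saP_of_isSelfAdjoint {x : Wien ℤ} (hx : IsSelfAdjoint x) : (saP x : Wien ℤ) = x :=
  hx.coe_selfAdjointPart_apply ℝ

/-- The defect of the nonlinear problem. -/
def defect (c : Wien ℕ) (p : ℝ × selfAdjoint (Wien ℤ)) : selfAdjoint (Wien ℤ) :=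
  saP (NormedSpace.exp (p.2 : Wien ℤ) - 1 + sqMod (integ (source (p.1 • c) p.2)))

theorem defect_eq_zero_iff (c : Wien ℕ) (p : ℝ × selfAdjoint (Wien ℤ)) :
    defect c p = 0 ↔ Sol (p.1 • c) p.2 := by
  have hs : IsSelfAdjoint (NormedSpace.exp (p.2 : Wien ℤ) - 1 + sqMod (integ (source (p.1 • c) p.2))) :=
    ((isSelfAdjoint_exp p.2.2).sub (IsSelfAdjoint.one _)).add (isSelfAdjoint_sqMod _)
  rw [← Subtype.coe_inj, defect, saP_of_isSelfAdjoint hs]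
  constructor
  · intro h
    refine ⟨p.2.2, ?_⟩
    change NormedSpace.exp (p.2 : Wien ℤ) - 1 + sqMod (integ (source (p.1 • c) p.2)) = 0 at h
    linear_combination h
  · intro h
    change NormedSpace.exp (p.2 : Wien ℤ) - 1 + sqMod (integ (source (p.1 • c) p.2)) = 0
    linear_combination h.2

theorem exists_hasStrictFDerivAt_defect (c : Wien ℕ) (p : ℝ × selfAdjoint (Wien ℤ)) :
    ∃ D : ℝ × selfAdjoint (Wien ℤ) →L[ℝ] selfAdjoint (Wien ℤ), HasStrictFDerivAt (defect c) D p ∧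
      ∀ η : selfAdjoint (Wien ℤ), D (0, η) = saP (NormedSpace.exp (p.2 : Wien ℤ) * η +
        (incl (integ (source (p.1 • c) p.2)) * star (incl (integ (source (p.1 • c) p.2 * schw η))) +
         star (incl (integ (source (p.1 • c) p.2))) * incl (integ (source (p.1 • c) p.2 * schw η)))) := by
  let S := selfAdjoint (Wien ℤ)
  let i2 : ℝ × S →L[ℝ] Wien ℤ := saL.comp (ContinuousLinearMap.snd ℝ ℝ S)
  let s2 : ℝ × S →L[ℝ] Wien ℕ := (schw.restrictScalars ℝ).comp i2
  let i1 : ℝ × S →L[ℝ] Wien ℕ := (ContinuousLinearMap.fst ℝ ℝ S).smulRight c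
  let L : Wien ℕ →L[ℝ] Wien ℤ := (incl.comp integ).restrictScalars ℝ
  let st : Wien ℤ →L[ℝ] Wien ℤ := (starL' ℝ (A := Wien ℤ)).toContinuousLinearMap
  have d1 : HasStrictFDerivAt (fun q : ℝ × S => NormedSpace.exp (i2 q)) (NormedSpace.exp (i2 p) • i2) p :=
    (hasStrictFDerivAt_exp (𝕂 := ℝ) (x := i2 p)).comp p i2.hasStrictFDerivAt
  have d2 : HasStrictFDerivAt (fun q : ℝ × S => NormedSpace.exp (s2 q)) (NormedSpace.exp (s2 p) • s2) p :=
    (hasStrictFDerivAt_exp (𝕂 := ℝ) (x := s2 p)).comp p s2.hasStrictFDerivAt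
  have d3 : HasStrictFDerivAt (fun q : ℝ × S => i1 q * NormedSpace.exp (s2 q))
      (i1 p • (NormedSpace.exp (s2 p) • s2) + NormedSpace.exp (s2 p) • i1) p :=
    i1.hasStrictFDerivAt.mul d2
  set E := i1 p • (NormedSpace.exp (s2 p) • s2) + NormedSpace.exp (s2 p) • i1
  have d4 : HasStrictFDerivAt (fun q : ℝ × S => L (i1 q * NormedSpace.exp (s2 q))) (L.comp E) p :=
    L.hasStrictFDerivAt.comp p d3
  have d5 : HasStrictFDerivAt (fun q : ℝ × S => st (L (i1 q * NormedSpace.exp (s2 q)))) (st.comp (L.comp E)) p :=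
    st.hasStrictFDerivAt.comp p d4
  have d45 := d4.mul d5
  have d6 := saP.hasStrictFDerivAt.comp p ((d1.sub_const 1).add d45)
  refine ⟨_, d6, fun η => ?_⟩
  have hE : E (0, η) = source (p.1 • c) p.2 * schw η := by
    change (p.1 • c) * (NormedSpace.exp (schw (p.2 : Wien ℤ)) * schw η) +
      NormedSpace.exp (schw (p.2 : Wien ℤ)) * ((0 : ℝ) • c) = _
    rw [zero_smul, mul_zero, add_zero, source, mul_assoc]
  change saP (NormedSpace.exp (p.2 : Wien ℤ) * η +
    (incl (integ (source (p.1 • c) p.2)) * star (incl (integ (E (0, η)))) +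
     star (incl (integ (source (p.1 • c) p.2))) * incl (integ (E (0, η))))) = _
  rw [hE]

/-- Openness in the continuity method. -/
theorem eventually_exists_sol {c : Wien ℕ} {t : ℝ} {f : Wien ℤ} (h : Sol (t • c) f) :
    ∀ᶠ s : ℝ in 𝓝 t, ∃ g, Sol (s • c) g := by
  let p : ℝ × selfAdjoint (Wien ℤ) := (t, ⟨f, h.1⟩)
  have hp : defect c p = 0 := (defect_eq_zero_iff c p).2 h
  obtain ⟨D, hD, hDη⟩ := exists_hasStrictFDerivAt_defect c p
  -- the linearised operator is a compact perturbation of the identity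
  set g := integ (source (t • c) f)
  let U : selfAdjoint (Wien ℤ) → Wien ℕ := fun η => integ (source (t • c) f * schw η)
  let B : selfAdjoint (Wien ℤ) →L[ℝ] Wien ℕ :=
    (ContinuousLinearMap.mul ℝ (Wien ℕ) (source (t • c) f)).comp ((schw.restrictScalars ℝ).comp saL)
  let A : Wien ℕ →L[ℝ] selfAdjoint (Wien ℤ) :=
    saP.comp ((ContinuousLinearMap.mul ℝ (Wien ℤ) (NormedSpace.exp (-f))).comp
      (((ContinuousLinearMap.mul ℝ (Wien ℤ) (incl g)).comp (starL' ℝ (A := Wien ℤ)).toContinuousLinearMap +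
      ContinuousLinearMap.mul ℝ (Wien ℤ) (star (incl g))).comp (incl.restrictScalars ℝ)))
  let T : selfAdjoint (Wien ℤ) →L[ℝ] selfAdjoint (Wien ℤ) := A.comp ((integ.restrictScalars ℝ).comp B)
  have hT : IsCompactOperator T := by
    have h1 : IsCompactOperator (integ.restrictScalars ℝ) := isCompactOperator_integ
    exact (h1.comp_clm B).clm_comp A
  have hef : NormedSpace.exp f * NormedSpace.exp (-f) = 1 := by
    rw [← NormedSpace.exp_add, add_neg_cancel, NormedSpace.exp_zero]
  have hsa : ∀ η : selfAdjoint (Wien ℤ), IsSelfAdjoint (incl g * star (incl (U η)) + star (incl g) * incl (U η)) := by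
    intro η
    rw [IsSelfAdjoint, star_add, star_mul, star_mul, star_star, star_star]
    ring
  have hTη : ∀ η, (T η : Wien ℤ) = NormedSpace.exp (-f) * (incl g * star (incl (U η)) + star (incl g) * incl (U η)) := by
    intro η
    have : T η = saP (NormedSpace.exp (-f) * (incl g * star (incl (U η)) + star (incl g) * incl (U η))) := rfl
    rw [this, saP_of_isSelfAdjoint ((isSelfAdjoint_exp h.1.neg).mul (hsa η))]
  have hDT : ∀ η, (D (0, η) : Wien ℤ) = NormedSpace.exp f * ((η + T η : selfAdjoint (Wien ℤ)) : Wien ℤ) := by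
    intro η
    have h1 : D (0, η) = saP (NormedSpace.exp f * η + (incl g * star (incl (U η)) + star (incl g) * incl (U η))) := hDη η
    rw [h1, saP_of_isSelfAdjoint (((isSelfAdjoint_exp h.1).mul η.2).add (hsa η)), AddSubgroup.coe_add, hTη]
    linear_combination (-(incl g * star (incl (U η)) + star (incl g) * incl (U η))) * hef
  have hinj : ∀ η, η + T η = 0 → η = 0 := by
    intro η hη
    have h1 := congrArg Subtype.val (hDη η)
    have h2 := hDT η
    rw [hη, AddSubgroup.coe_zero, mul_zero] at h2
    have h3 : NormedSpace.exp f * η + (incl g * star (incl (U η)) + star (incl g) * incl (U η)) = 0 := by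
      have h4 := congrArg Subtype.val hη
      rw [AddSubgroup.coe_add, hTη, AddSubgroup.coe_zero] at h4
      linear_combination NormedSpace.exp f * h4 - (incl g * star (incl (U η)) + star (incl g) * incl (U η)) * hef
    refine Subtype.ext (eq_zero_of_linearized (c := source (t • c) f) η.2
      (fun ζ => h.norm_lt_one (Circle.norm_coe ζ).le) fun ζ => ?_)
    have h5 := congrArg (fun x => (evC ζ x).re) h3
    simp only [map_add, map_mul, evC_star, evC_incl, map_zero, Complex.zero_re, evC_exp] at h5
    have h6 : evC ζ f = ((evC ζ f).re : ℂ) := Complex.ext rfl (by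
      rw [isSelfAdjoint_iff.1 h.1, Complex.ofReal_im])
    rw [h6, ← re_disc_schw h.1, ← Complex.ofReal_exp, h.exp_eq, Complex.add_re, Complex.re_ofReal_mul,
      ← re_disc_schw η.2] at h5
    have h7 := h.one_sub_pos (Circle.norm_coe ζ).le
    rw [logVar, eq_comm]
    have h8 : (disc g ζ * (starRingEnd ℂ) (disc (U η) ζ) + (starRingEnd ℂ) (disc g ζ) * disc (U η) ζ).re
        = 2 * ((starRingEnd ℂ) (disc g ζ) * disc (U η) ζ).re := by
      simp; ring
    rw [h8] at h5
    change 0 = _ + 2 * ((starRingEnd ℂ) (disc g ζ) * disc (U η) ζ).re / (1 - ‖disc g ζ‖ ^ 2)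
    change 0 < 1 - ‖disc g ζ‖ ^ 2 at h7
    field_simp
    linarith
  have hsurj : ∀ ψ : selfAdjoint (Wien ℤ), ∃ η, η + T η = ψ := by
    rcases hT.hasEigenvalue_or_mem_resolventSet (μ := (-1 : ℝ)) (by norm_num) with he | hr
    · obtain ⟨η, hη⟩ := he.exists_hasEigenvector
      refine absurd (hinj η ?_) hη.2
      have := hη.apply_eq_smul
      change T η = _ at this
      rw [this, neg_one_smul, add_neg_cancel]
    · intro ψ
      have hu : IsUnit (algebraMap ℝ (selfAdjoint (Wien ℤ) →L[ℝ] selfAdjoint (Wien ℤ)) (-1) - T) := hr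
      obtain ⟨V, hV⟩ := hu.exists_right_inv
      refine ⟨-V ψ, ?_⟩
      have := congrArg (fun L => L ψ) hV
      simp only [map_neg, map_one] at this
      change -(V ψ) - T (V ψ) = ψ at this
      rw [map_neg, ← sub_eq_add_neg]; exact this
  have hΘ : HasStrictFDerivAt (fun q : ℝ × selfAdjoint (Wien ℤ) => (q.1, defect c q))
      ((ContinuousLinearMap.fst ℝ ℝ (selfAdjoint (Wien ℤ))).prod D) p := hasStrictFDerivAt_fst.prodMk hD
  have hmap := hΘ.map_nhds_eq_of_surj (by
    rw [LinearMap.range_eq_top]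
    rintro ⟨s, ψ⟩
    have hψ : IsSelfAdjoint (NormedSpace.exp (-f) * ((ψ - D (s, 0) : selfAdjoint (Wien ℤ)) : Wien ℤ)) :=
      (isSelfAdjoint_exp h.1.neg).mul (ψ - D (s, 0)).2
    obtain ⟨η, hη⟩ := hsurj ⟨_, hψ⟩
    refine ⟨(s, η), Prod.ext rfl ?_⟩
    change D (s, η) = ψ
    have h1 : (s, η) = (s, (0 : selfAdjoint (Wien ℤ))) + (0, η) := by simp
    rw [h1, map_add]
    have h2 : D (0, η) = ψ - D (s, 0) := by
      refine Subtype.ext ?_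
      rw [hDT, hη]
      change NormedSpace.exp f * (NormedSpace.exp (-f) * _) = _
      rw [← mul_assoc, hef, one_mul]
    rw [h2]; abel)
  have hmem : (fun q : ℝ × selfAdjoint (Wien ℤ) => (q.1, defect c q)) '' univ ∈ 𝓝 (t, (0 : selfAdjoint (Wien ℤ))) := by
    have := Filter.image_mem_map (m := fun q : ℝ × selfAdjoint (Wien ℤ) => (q.1, defect c q)) (univ_mem (f := 𝓝 p))
    rw [hmap, hp] at this
    exact this
  have hc : Tendsto (fun s : ℝ => (s, (0 : selfAdjoint (Wien ℤ)))) (𝓝 t) (𝓝 (t, 0)) :=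
    (Continuous.prodMk_left (0 : selfAdjoint (Wien ℤ))).tendsto t
  filter_upwards [hc hmem] with s hs
  obtain ⟨q, -, hq⟩ := hs
  have h1 : q.1 = s := congrArg Prod.fst hq
  have h2 : defect c q = 0 := congrArg Prod.snd hq
  exact ⟨q.2, h1 ▸ (defect_eq_zero_iff c q).1 h2⟩

theorem exists_sol (c : Wien ℕ) : ∃ f, Sol c f := by
  have key : Icc (0 : ℝ) 1 ⊆ {t : ℝ | ∃ f, Sol (t • c) f} := by
    refine IsClosed.Icc_subset_of_forall_mem_nhdsWithin ?_ ?_ ?_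
    · refine IsSeqClosed.isClosed fun t t₀ ht hlim => ⟨?_, ?_⟩
      · choose f hf using fun n => (ht n).1
        exact exists_sol_of_tendsto (hlim.smul_const c) hf
      · exact isClosed_Icc.mem_of_tendsto hlim (Eventually.of_forall fun n => (ht n).2)
    · refine ⟨0, IsSelfAdjoint.zero _, ?_⟩
      rw [zero_smul, source, zero_mul, map_zero, sqMod, map_zero, zero_mul, sub_zero, NormedSpace.exp_zero]
    · rintro t ⟨⟨f, hf⟩, -⟩
      exact (eventually_exists_sol hf).filter_mono nhdsWithin_le_nhds
  simpa using key (right_mem_Icc.2 zero_le_one)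

end Wien

namespace Wien

theorem coef_eq_integral (f : Wien ℤ) (k : ℤ) :
    f.coef k = ∫ x, toC f x * (starRingEnd ℂ) (fourier k x) ∂(AddCircle.haarAddCircle (T := 2 * Real.pi)) := by
  rw [coef_eq_inner, fourierLp, ContinuousMap.inner_toLp]

theorem norm_coef_le_coef_zero {f : Wien ℤ} (hf : IsSelfAdjoint f) (h : ∀ ζ, 0 ≤ (evC ζ f).re) (k : ℤ) :
    ‖f.coef k‖ ≤ (f.coef 0).re := by
  have hx : ∀ x, toC f x = ((evC (AddCircle.toCircle x) f).re : ℂ) := fun x => by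
    rw [toC_apply]
    exact Complex.ext rfl (by rw [isSelfAdjoint_iff.1 hf, Complex.ofReal_im])
  have h0 : f.coef 0 = ((∫ x, (evC (AddCircle.toCircle x) f).re
      ∂(AddCircle.haarAddCircle (T := 2 * Real.pi)) : ℝ) : ℂ) := by
    rw [coef_eq_integral, ← integral_complex_ofReal]
    simp [hx]
  rw [h0, Complex.ofReal_re, coef_eq_integral]
  refine (norm_integral_le_integral_norm _).trans_eq (integral_congr_ae (Eventually.of_forall fun x => ?_))
  have h1 : ‖fourier k x‖ = 1 := by rw [fourier_apply]; exact Circle.norm_coe _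
  simp only [norm_mul, RCLike.norm_conj, h1, hx, Complex.norm_real, Real.norm_of_nonneg (h _), mul_one]

/-- A positive element has a logarithm. -/
theorem exists_exp_eq_one_add {s : Wien ℤ} (hs : IsSelfAdjoint s) (h : ∀ ζ, 0 ≤ (evC ζ s).re) :
    ∃ f, IsSelfAdjoint f ∧ NormedSpace.exp f = 1 + s := by
  have hev : ∀ ζ, evC ζ s = ((evC ζ s).re : ℂ) := fun ζ =>
    Complex.ext rfl (by rw [isSelfAdjoint_iff.1 hs, Complex.ofReal_im])
  have hu : ∀ t ∈ Icc (0 : ℝ) 1, IsUnit (1 + (t : ℂ) • s) := fun t ht =>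
    isUnit_of_evC_ne_zero fun ζ => by
      rw [map_add, map_one, map_smul, hev, smul_eq_mul]
      norm_cast
      have := mul_nonneg ht.1 (h ζ)
      positivity
  let q : ℝ → Wien ℤ := fun t => s * Ring.inverse (1 + (t : ℂ) • s)
  have hq : ContinuousOn q (uIcc 0 1) := by
    rw [uIcc_of_le zero_le_one]
    intro t ht
    obtain ⟨u, hu'⟩ := hu t ht
    have h1 : ContinuousAt Ring.inverse (1 + (t : ℂ) • s) := hu' ▸ NormedRing.inverse_continuousAt u
    have h2 : ContinuousAt (fun t : ℝ => 1 + (t : ℂ) • s) t := by fun_prop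
    exact (continuousAt_const.mul (ContinuousAt.comp (f := fun t : ℝ => 1 + (t : ℂ) • s) h1 h2)).continuousWithinAt
  have hqi : IntervalIntegrable q volume 0 1 := hq.intervalIntegrable
  have hval : ∀ ζ, evC ζ (∫ t in (0 : ℝ)..1, q t) = (Real.log (1 + (evC ζ s).re) : ℂ) := by
    intro ζ
    let L : Wien ℤ →L[ℂ] ℂ := ⟨(evC ζ).toLinearMap, continuous_evC ζ⟩
    have h1 : evC ζ (∫ t in (0 : ℝ)..1, q t) = ∫ t in (0 : ℝ)..1, L (q t) :=
      (L.intervalIntegral_comp_comm hqi).symm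
    set x := (evC ζ s).re
    have hx : 0 ≤ x := h ζ
    have h2 : ∫ t in (0 : ℝ)..1, L (q t) = ∫ t in (0 : ℝ)..1, ((x / (1 + t * x) : ℝ) : ℂ) := by
      refine intervalIntegral.integral_congr fun t ht => ?_
      rw [uIcc_of_le zero_le_one] at ht
      change evC ζ (s * Ring.inverse (1 + (t : ℂ) • s)) = _
      have h3 := congrArg (evC ζ) (Ring.mul_inverse_cancel _ (hu t ht))
      rw [map_mul, map_add, map_one, map_smul, hev, smul_eq_mul] at h3
      rw [map_mul, hev]
      have h4 : ((1 : ℂ) + t * x) ≠ 0 := left_ne_zero_of_mul_eq_one h3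
      push_cast
      rw [eq_div_iff h4]
      linear_combination (x : ℂ) * h3
    rw [h1, h2, intervalIntegral.integral_ofReal]
    congr 1
    have h5 : ∀ t ∈ uIcc (0 : ℝ) 1, HasDerivAt (fun t => Real.log (1 + t * x)) (x / (1 + t * x)) t := by
      intro t ht
      rw [uIcc_of_le zero_le_one] at ht
      have h6 : 0 < 1 + t * x := by have := mul_nonneg ht.1 hx; positivity
      exact (((hasDerivAt_id t).mul_const x).const_add 1).log h6.ne' |>.congr_deriv (by simp)
    rw [intervalIntegral.integral_eq_sub_of_hasDerivAt h5]
    · simp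
    · refine ContinuousOn.intervalIntegrable ?_
      refine continuousOn_const.div (by fun_prop) fun t ht => ?_
      rw [uIcc_of_le zero_le_one] at ht
      have := mul_nonneg ht.1 hx
      positivity
  refine ⟨∫ t in (0 : ℝ)..1, q t, ?_, ?_⟩
  · refine isSelfAdjoint_iff.2 fun ζ => ?_
    rw [hval, Complex.ofReal_im]
  · refine evC_injective fun ζ => ?_
    rw [evC_exp, hval, map_add, map_one, ← Complex.ofReal_exp, Real.exp_log, hev ζ]
    · push_cast; rfl
    · have := h ζ; positivity

theorem exists_disc_eq {F : ℂ → ℂ} (hF : DifferentiableOn ℂ F (Metric.ball 0 1)) {r : ℝ} (h0 : 0 ≤ r)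
    (h1 : r < 1) : ∃ c : Wien ℕ, ∀ z : ℂ, ‖z‖ ≤ 1 → disc c z = F (r * z) := by
  obtain ⟨R, hrR, hR1⟩ := exists_between h1
  lift R to NNReal using h0.trans hrR.le
  have hR0 : 0 < R := by exact_mod_cast h0.trans_lt hrR
  have hps := (hF.mono (Metric.closedBall_subset_ball hR1)).hasFPowerSeriesOnBall hR0
  set P := cauchyPowerSeries F 0 R
  lift r to NNReal using h0
  have hlt : (r : ENNReal) < P.radius := lt_of_lt_of_le (by exact_mod_cast hrR) hps.r_le
  have hs := P.summable_norm_mul_pow hlt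
  refine ⟨mk (fun n => P.coeff n * r ^ n) ?_, fun z hz => ?_⟩
  · refine hs.congr fun n => ?_
    rw [norm_mul, norm_pow, P.norm_apply_eq_norm_coef]; simp
  · have h2 : ((r : ℝ) : ℂ) * z ∈ Metric.eball (0 : ℂ) R := by
      rw [Metric.mem_eball, edist_zero_right, ← ofReal_norm, norm_mul, Complex.norm_real,
        ENNReal.ofReal_lt_coe_iff (by positivity)]
      refine lt_of_le_of_lt (mul_le_of_le_one_right (norm_nonneg _) hz) ?_
      simpa using hrR
    have h3 := (hps.hasSum h2).tsum_eq
    rw [zero_add] at h3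
    rw [← h3, disc]
    refine tsum_congr fun n => ?_
    rw [FormalMultilinearSeries.apply_eq_pow_smul_coeff, coef_mk, smul_eq_mul, mul_pow]
    ring

end Wien

/-- The sum of a power series. -/
def powSum (c : ℕ → ℂ) (z : ℂ) : ℂ := ∑' n, c n * z ^ n

theorem summable_natCast_mul_pow_pred {r : ℝ} (hr0 : 0 ≤ r) (hr1 : r < 1) :
    Summable fun n : ℕ => (n : ℝ) * r ^ (n - 1) := by
  rw [← summable_nat_add_iff 1]
  have h1 := summable_pow_mul_geometric_of_norm_lt_one 1 (by rwa [Real.norm_of_nonneg hr0] : ‖r‖ < 1)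
  have h2 := summable_geometric_of_lt_one hr0 hr1
  refine (h1.add h2).congr fun n => ?_
  simp; ring

theorem norm_mul_pow_le {c : ℕ → ℂ} {M : ℝ} (hc : ∀ n, ‖c n‖ ≤ M) (z : ℂ) (n : ℕ) :
    ‖c n * z ^ n‖ ≤ M * ‖z‖ ^ n := by
  rw [norm_mul, norm_pow]; gcongr; exact hc n

theorem norm_mul_deriv_pow_le {c : ℕ → ℂ} {M : ℝ} (hc : ∀ n, ‖c n‖ ≤ M) (z : ℂ) (n : ℕ) :
    ‖c n * (n * z ^ (n - 1))‖ ≤ M * (n * ‖z‖ ^ (n - 1)) := by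
  rw [norm_mul, norm_mul, norm_pow, Complex.norm_natCast]; gcongr; exact hc n

theorem hasDerivAt_powSum {c : ℕ → ℂ} {M : ℝ} (hc : ∀ n, ‖c n‖ ≤ M) {z : ℂ} (hz : ‖z‖ < 1) :
    HasDerivAt (powSum c) (∑' n : ℕ, c n * (n * z ^ (n - 1))) z := by
  obtain ⟨r, hzr, hr1⟩ := exists_between hz
  have hr0 : 0 ≤ r := (norm_nonneg z).trans hzr.le
  have hM : 0 ≤ M := (norm_nonneg _).trans (hc 0)
  refine hasDerivAt_tsum_of_isPreconnected ((summable_natCast_mul_pow_pred hr0 hr1).mul_left M)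
    (Metric.isOpen_ball (x := (0 : ℂ)) (ε := r)) (convex_ball _ _).isPreconnected
    (fun n y _ => (hasDerivAt_pow n y).const_mul (c n)) (fun n y hy => ?_)
    (Metric.mem_ball_self ((norm_nonneg z).trans_lt hzr)) ?_ (by simpa using hzr)
  · refine (norm_mul_deriv_pow_le hc y n).trans ?_
    have : ‖y‖ ≤ r := by simpa using (mem_ball_zero_iff.1 hy).le
    gcongr
  · exact summable_of_ne_finset_zero (s := {0}) fun n hn => by
      rw [zero_pow (by simpa using hn), mul_zero]

theorem exists_subseq_powSum {c : ℕ → ℕ → ℂ} {M : ℝ} (hc : ∀ k n, ‖c k n‖ ≤ M) :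
    ∃ (d : ℕ → ℂ) (φ : ℕ → ℕ), StrictMono φ ∧ (∀ n, ‖d n‖ ≤ M) ∧ ∀ z : ℂ, ‖z‖ < 1 →
      Tendsto (fun k => powSum (c (φ k)) z) atTop (𝓝 (powSum d z)) ∧
      Tendsto (fun k => deriv (powSum (c (φ k))) z) atTop (𝓝 (deriv (powSum d) z)) := by
  obtain ⟨d, hd, φ, hφ, hlim⟩ := (isCompact_univ_pi fun _ : ℕ => isCompact_closedBall (0 : ℂ) M).tendsto_subseq
    (x := c) fun k n _ => by simpa using hc k n
  have hd' : ∀ n, ‖d n‖ ≤ M := fun n => by simpa using hd n (mem_univ n)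
  rw [tendsto_pi_nhds] at hlim
  refine ⟨d, φ, hφ, hd', fun z hz => ⟨?_, ?_⟩⟩
  · exact tendsto_tsum_of_dominated_convergence
      ((summable_geometric_of_lt_one (norm_nonneg z) hz).mul_left M)
      (fun n => (hlim n).mul_const _) (Eventually.of_forall fun k n => norm_mul_pow_le (hc (φ k)) z n)
  · simp_rw [(hasDerivAt_powSum hd' hz).deriv, fun k => (hasDerivAt_powSum (hc (φ k)) hz).deriv]
    exact tendsto_tsum_of_dominated_convergence
      ((summable_natCast_mul_pow_pred (norm_nonneg z) hz).mul_left M)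
      (fun n => (hlim n).mul_const _) (Eventually.of_forall fun k n => norm_mul_deriv_pow_le (hc (φ k)) z n)

/-- Composition with a dilation. -/
theorem SubJet.comp_mul {ψ : ℂ → ℝ} {r : ℝ} (hr : 0 < r) {z : ℂ} {L : ℝ} (h : SubJet ψ (r * z) L) :
    SubJet (fun x => ψ (r * x)) z (r ^ 2 * L) := by
  obtain ⟨b, c, h⟩ := h
  refine ⟨r * b, r ^ 2 * c, fun ε hε => ?_⟩
  have ht : Tendsto (fun w : ℂ => (r : ℂ) * w) (𝓝 0) (𝓝 0) := by
    have : ContinuousAt (fun w : ℂ => (r : ℂ) * w) 0 := by fun_prop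
    simpa [ContinuousAt] using this
  filter_upwards [ht.eventually (h (ε / r ^ 2) (by positivity))] with w hw
  rw [mul_add]
  refine le_trans (le_of_eq ?_) hw
  have h1 : ‖(r : ℂ) * w‖ ^ 2 = r ^ 2 * ‖w‖ ^ 2 := by
    rw [norm_mul, Complex.norm_real, mul_pow, Real.norm_eq_abs, sq_abs]
  rw [h1]
  have h2 : (L - ε / r ^ 2) * (r ^ 2 * ‖w‖ ^ 2) = (r ^ 2 * L - ε) * ‖w‖ ^ 2 := by
    field_simp
  rw [h2]
  ring_nf

namespace Wien

theorem Sol.neg_le_coef_zero {c : Wien ℕ} {f : Wien ℤ} (h : Sol c f) {V : ℂ → ℝ}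
    (hVc : ContinuousOn V (Metric.closedBall 0 1)) (hV0 : ∀ z, ‖z‖ = 1 → 0 ≤ V z)
    (hV : ∀ z, ‖z‖ < 1 → SubJet (fun x => -V x) z (‖disc c z‖ ^ 2)) : -V 0 ≤ (f.coef 0).re := by
  set a := disc (schw f)
  set G := disc (integ (source c f)) with hG
  have key := nonpos_of_subJet (ψ := fun z => Real.log (1 - ‖G z‖ ^ 2) + (-a z).re + -V z)
    ((h.continuousOn_log.add
      (Complex.continuous_re.comp_continuousOn (continuousOn_disc _).neg)).add hVc.neg)
    (fun z hz => ?_) (fun z hz _ => ?_) 0 (by simp)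
  · have hG0 : G 0 = 0 := disc_integ_zero _
    have ha0 : a 0 = f.coef 0 := by simp only [a, disc_zero_right, coef_schw]; simp
    rw [hG0, Complex.neg_re, ha0] at key
    simp at key
    linarith
  · have h1 := h.exp_eq (⟨z, by simpa [Submonoid.unitSphere] using hz⟩ : Circle)
    change Real.exp (a z).re = 1 - ‖G z‖ ^ 2 at h1
    rw [← h1, Real.log_exp, Complex.neg_re]
    have := hV0 z hz
    linarith
  · have hGa : AnalyticAt ℂ G z := analyticAt_disc _ hz
    have h1 := SubJet.log_one_sub_normSq hGa (h.norm_lt_one hz.le)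
    have h2 : SubJet (fun x => (-a x).re) z 0 := SubJet.re (analyticAt_disc (schw f) hz).neg
    refine ((h1.add h2).add (hV z hz)).mono ?_
    have h3 : deriv G z = disc c z * Complex.exp (a z) := by
      rw [hG, (hasDerivAt_disc_integ _ hz).deriv, disc_source _ _ hz.le]
    have h4 := h.exp_le hz.le
    have h5 := h.one_sub_pos hz.le
    have h6 : ‖deriv G z‖ / (1 - ‖G z‖ ^ 2) ≤ ‖disc c z‖ := by
      rw [div_le_iff₀ h5, h3, norm_mul, Complex.norm_exp]
      gcongr
    have h7 : 0 ≤ ‖deriv G z‖ / (1 - ‖G z‖ ^ 2) := div_nonneg (norm_nonneg _) h5.le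
    nlinarith

theorem norm_coef_schw_le (f : Wien ℤ) {C : ℝ} (hC : ∀ k, ‖f.coef k‖ ≤ C) (n : ℕ) :
    ‖(schw f).coef n‖ ≤ 2 * C := by
  rw [coef_schw, norm_mul]
  have h1 : ‖(if n = 0 then 1 else 2 : ℂ)‖ ≤ 2 := by split_ifs <;> simp
  exact mul_le_mul h1 (hC _) (norm_nonneg _) zero_le_two

theorem Sol.norm_coef_le {c : Wien ℕ} {f : Wien ℤ} (h : Sol c f) {C : ℝ} (hC : -C ≤ (f.coef 0).re)
    (n : ℕ) : ‖(schw f).coef n‖ ≤ 2 * C := by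
  refine norm_coef_schw_le f (fun k => ?_) n
  have hn : ∀ k, (-f).coef k = -f.coef k := fun k => by
    have := coef_smul (-1) f k
    simpa using this
  have h1 := norm_coef_le_coef_zero h.1.neg (fun ζ => ?_) k
  · rw [hn, hn, norm_neg, Complex.neg_re] at h1
    linarith
  · rw [map_neg, Complex.neg_re, ← re_disc_schw h.1]
    have h2 := h.re_le_log (Circle.norm_coe ζ).le
    have h3 := Real.log_nonpos (h.one_sub_pos (Circle.norm_coe ζ).le).le (by nlinarith [norm_nonneg (disc (integ (source c f)) ζ)])
    linarith

/-- The oscillation of `disc g` is dominated by any supersolution. -/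
theorem re_disc_schw_sqMod_sub_le (g : Wien ℕ) {V : ℂ → ℝ}
    (hVc : ContinuousOn V (Metric.closedBall 0 1)) (hV0 : ∀ z, ‖z‖ = 1 → 0 ≤ V z)
    (hV : ∀ z, ‖z‖ < 1 → SubJet (fun x => -V x) z (‖deriv (disc g) z‖ ^ 2)) {z : ℂ} (hz : ‖z‖ ≤ 1) :
    (disc (schw (sqMod g)) z).re - ‖disc g z‖ ^ 2 ≤ V z := by
  have key := nonpos_of_subJet
    (ψ := fun z => (disc (schw (sqMod g)) z).re + -‖disc g z‖ ^ 2 + -V z)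
    (((Complex.continuous_re.comp_continuousOn (continuousOn_disc _)).add
      ((continuousOn_disc g).norm.pow 2).neg).add hVc.neg)
    (fun z hz => ?_) (fun z hz _ => ?_) z hz
  · linarith
  · obtain ⟨ζ, rfl⟩ : ∃ ζ : Circle, (ζ : ℂ) = z := ⟨⟨z, by simpa [Submonoid.unitSphere] using hz⟩, rfl⟩
    rw [re_disc_schw (isSelfAdjoint_sqMod g), evC_sqMod, Complex.ofReal_re]
    have := hV0 _ hz
    linarith
  · refine (((SubJet.re (analyticAt_disc _ hz)).add (SubJet.neg_normSq (analyticAt_disc g hz))).add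
      (hV z hz)).mono ?_
    linarith

end Wien

/-! ### Poisson integrals over the unit circle -/

/-- Normalized arc length, in the angle variable. -/
def circMeas : Measure ℝ :=
  ENNReal.ofReal (2 * Real.pi)⁻¹ • volume.restrict (Ioc 0 (2 * Real.pi))

instance isProbabilityMeasure_circMeas : IsProbabilityMeasure circMeas := by
  constructor
  have h2 : (0 : ℝ) < 2 * Real.pi := by positivity
  simp only [circMeas, Measure.smul_apply, Measure.restrict_apply_univ, Real.volume_Ioc, sub_zero,
    smul_eq_mul]
  rw [← ENNReal.ofReal_mul (by positivity), inv_mul_cancel₀ h2.ne', ENNReal.ofReal_one]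

lemma integral_circMeas {E : Type*} [NormedAddCommGroup E] [NormedSpace ℝ E] (f : ℝ → E) :
    ∫ θ, f θ ∂circMeas = (2 * Real.pi)⁻¹ • ∫ θ in Ioc 0 (2 * Real.pi), f θ := by
  rw [circMeas, integral_smul_measure, ENNReal.toReal_ofReal (by positivity)]

lemma ae_circMeas {P : ℝ → Prop} :
    (∀ᵐ θ ∂circMeas, P θ) ↔ ∀ᵐ θ ∂(volume.restrict (Ioc 0 (2 * Real.pi))), P θ := by
  unfold circMeas
  rw [Measure.ae_ennreal_smul_measure_eq]
  simp only [ne_eq, ENNReal.ofReal_eq_zero, not_le]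
  positivity

lemma circlePt_eq_circleMap (θ : ℝ) : circlePt θ = circleMap 0 1 θ := by
  simp [circlePt, circleMap]

@[fun_prop]
lemma continuous_circlePt : Continuous circlePt := by
  unfold circlePt; fun_prop

@[simp]
lemma norm_circlePt (θ : ℝ) : ‖circlePt θ‖ = 1 := by
  simp [circlePt, Complex.norm_exp_ofReal_mul_I]

lemma circlePt_add_two_pi (θ : ℝ) : circlePt (θ + 2 * Real.pi) = circlePt θ := by
  simp only [circlePt]
  push_cast
  rw [add_mul, Complex.exp_add, Complex.exp_two_pi_mul_I, mul_one]

lemma circleAverage_eq_integral {E : Type*} [NormedAddCommGroup E] [NormedSpace ℝ E] (f : ℂ → E) :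
    Real.circleAverage f 0 1 = ∫ θ, f (circlePt θ) ∂circMeas := by
  rw [Real.circleAverage_def, integral_circMeas,
    intervalIntegral.integral_of_le (by positivity)]
  simp_rw [circlePt_eq_circleMap]

lemma circleIntegrable_iff_integrable {E : Type*} [NormedAddCommGroup E] [NormedSpace ℝ E]
    (f : ℂ → E) :
    CircleIntegrable f 0 1 ↔ Integrable (fun θ => f (circlePt θ)) circMeas := by
  rw [CircleIntegrable, intervalIntegrable_iff, uIoc_of_le (by positivity), circMeas,
    integrable_smul_measure (by simp; positivity) (by simp), IntegrableOn]
  simp_rw [circlePt_eq_circleMap]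

/-- The Poisson kernel of the unit disc. -/
def pk (z : ℂ) (θ : ℝ) : ℝ := (1 - ‖z‖ ^ 2) / ‖circlePt θ - z‖ ^ 2

lemma pk_eq_poissonKernel (z : ℂ) (θ : ℝ) : pk z θ = poissonKernel 0 z (circlePt θ) := by
  simp [pk, poissonKernel_def]

lemma pk_nonneg {z : ℂ} (hz : ‖z‖ < 1) (θ : ℝ) : 0 ≤ pk z θ := by
  have : ‖z‖ ^ 2 ≤ 1 := by nlinarith [norm_nonneg z]
  exact div_nonneg (by linarith) (by positivity)

lemma one_sub_norm_le (z : ℂ) (θ : ℝ) : 1 - ‖z‖ ≤ ‖circlePt θ - z‖ := by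
  have := norm_sub_norm_le (circlePt θ) z
  simpa using this

lemma circlePt_sub_ne_zero {z : ℂ} (hz : ‖z‖ < 1) (θ : ℝ) : circlePt θ - z ≠ 0 := by
  rw [← norm_pos_iff]
  linarith [one_sub_norm_le z θ]

lemma pk_le {z : ℂ} (hz : ‖z‖ < 1) (θ : ℝ) : pk z θ ≤ 2 / (1 - ‖z‖) := by
  have h1 : 0 < 1 - ‖z‖ := by linarith
  have h := one_sub_norm_le z θ
  have hn := norm_nonneg z
  have h2 : 0 < ‖circlePt θ - z‖ := h1.trans_le h
  rw [pk, div_le_div_iff₀ (by positivity) h1]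
  nlinarith [mul_self_le_mul_self h1.le h]

lemma norm_herglotzRieszKernel_le {z : ℂ} (hz : ‖z‖ < 1) (θ : ℝ) :
    ‖herglotzRieszKernel 0 z (circlePt θ)‖ ≤ 2 / (1 - ‖z‖) := by
  have h1 : 0 < 1 - ‖z‖ := by linarith
  have h := one_sub_norm_le z θ
  simp only [herglotzRieszKernel_def, sub_zero, norm_div]
  gcongr
  calc ‖circlePt θ + z‖ ≤ ‖circlePt θ‖ + ‖z‖ := norm_add_le _ _
    _ ≤ 2 := by rw [norm_circlePt]; linarith

lemma continuous_pk {z : ℂ} (hz : ‖z‖ < 1) : Continuous (pk z) := by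
  unfold pk
  refine Continuous.div (by fun_prop) (by fun_prop) fun θ => ?_
  have := circlePt_sub_ne_zero hz θ
  positivity

lemma mem_ball_one {z : ℂ} : z ∈ Metric.ball (0 : ℂ) 1 ↔ ‖z‖ < 1 := mem_ball_zero_iff

lemma integral_pk_smul {F : ℂ → ℂ} (hF : DiffContOnCl ℂ F (Metric.ball 0 1)) {z : ℂ}
    (hz : ‖z‖ < 1) : ∫ θ, pk z θ • F (circlePt θ) ∂circMeas = F z := by
  have h := hF.circleAverage_poissonKernel_smul (mem_ball_one.2 hz)
  rw [circleAverage_eq_integral] at h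
  simpa [pk_eq_poissonKernel] using h

lemma integral_pk {z : ℂ} (hz : ‖z‖ < 1) : ∫ θ, pk z θ ∂circMeas = 1 := by
  have h := integral_pk_smul (F := fun _ => 1) diffContOnCl_const hz
  have h2 : ∀ θ, pk z θ • (1 : ℂ) = ((pk z θ : ℝ) : ℂ) := fun θ => by simp
  simp_rw [h2, integral_complex_ofReal] at h
  exact_mod_cast h

/-- Bounded measurable functions against the Poisson kernel. -/
lemma integrable_pk_smul {E : Type*} [NormedAddCommGroup E] [NormedSpace ℝ E] {z : ℂ}
    (hz : ‖z‖ < 1) {f : ℝ → E} (hf : Integrable f circMeas) :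
    Integrable (fun θ => pk z θ • f θ) circMeas := by
  refine hf.bdd_smul (C := 2 / (1 - ‖z‖))
    (continuous_pk hz).aestronglyMeasurable (ae_of_all _ fun θ => ?_)
  rw [Real.norm_of_nonneg (pk_nonneg hz θ)]
  exact pk_le hz θ

/-- `g` is a bounded (by `M`) boundary function of the analytic function `Φ`. -/
structure Bdry (Φ g : ℂ → ℂ) (M : ℝ) : Prop where
  diff : DifferentiableOn ℂ Φ (Metric.ball 0 1)
  bound : ∀ z, ‖z‖ < 1 → ‖Φ z‖ ≤ M
  meas : AEStronglyMeasurable (fun θ => g (circlePt θ)) circMeas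
  gbound : ∀ ζ, ‖g ζ‖ ≤ M
  lim : ∀ᵐ θ ∂circMeas, Tendsto (fun r : ℝ => Φ (r * circlePt θ)) (𝓝[<] 1) (𝓝 (g (circlePt θ)))

lemma norm_ofReal_mul_circlePt {r : ℝ} (hr : 0 ≤ r) (θ : ℝ) : ‖(r : ℂ) * circlePt θ‖ = r := by
  simp [abs_of_nonneg hr]

lemma eventually_mem_Ioo_one : ∀ᶠ r : ℝ in 𝓝[<] 1, 0 < r ∧ r < 1 :=
  Ioo_mem_nhdsLT zero_lt_one

lemma continuous_comp_circle {Φ : ℂ → ℂ} (hΦ : DifferentiableOn ℂ Φ (Metric.ball 0 1)) {r : ℝ}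
    (h0 : 0 ≤ r) (h1 : r < 1) : Continuous fun θ => Φ (r * circlePt θ) :=
  hΦ.continuousOn.comp_continuous (by fun_prop) fun θ =>
    mem_ball_one.2 (by rwa [norm_ofReal_mul_circlePt h0])

lemma Bdry.tendsto_integral {E : Type*} [NormedAddCommGroup E] [NormedSpace ℝ E] {Φ g : ℂ → ℂ}
    {M : ℝ} (h : Bdry Φ g M) {Q : ℂ × ℂ → E} (hQ : Continuous Q) {w : ℝ → ℝ} (hw : Continuous w)
    {C : ℝ} (hC : ∀ θ, |w θ| ≤ C) :
    Tendsto (fun r : ℝ => ∫ θ, w θ • Q (g (circlePt θ), Φ (r * circlePt θ)) ∂circMeas) (𝓝[<] 1)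
      (𝓝 (∫ θ, w θ • Q (g (circlePt θ), g (circlePt θ)) ∂circMeas)) := by
  obtain ⟨B, hB⟩ := ((isCompact_closedBall (0 : ℂ) M).prod
    (isCompact_closedBall (0 : ℂ) M)).exists_bound_of_continuousOn hQ.continuousOn
  have hC0 : 0 ≤ C := (abs_nonneg _).trans (hC 0)
  refine tendsto_integral_filter_of_dominated_convergence (fun _ => C * B) ?_ ?_
    (integrable_const _) ?_
  · filter_upwards [eventually_mem_Ioo_one] with r hr
    exact hw.aestronglyMeasurable.smul (hQ.comp_aestronglyMeasurable
      (h.meas.prodMk (continuous_comp_circle h.diff hr.1.le hr.2).aestronglyMeasurable))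
  · filter_upwards [eventually_mem_Ioo_one] with r hr
    refine ae_of_all _ fun θ => ?_
    rw [norm_smul]
    refine mul_le_mul (hC θ) (hB _ ⟨?_, ?_⟩) (norm_nonneg _) hC0
    · simpa using h.gbound _
    · simpa using h.bound _ (by rw [norm_ofReal_mul_circlePt hr.1.le]; exact hr.2)
  · filter_upwards [h.lim] with θ hθ
    exact ((hQ.tendsto _).comp (tendsto_const_nhds.prodMk_nhds hθ)).const_smul _

lemma diffContOnCl_comp_mul {Φ : ℂ → ℂ} (hΦ : DifferentiableOn ℂ Φ (Metric.ball 0 1)) {r : ℝ}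
    (h0 : 0 ≤ r) (h1 : r < 1) : DiffContOnCl ℂ (fun z => Φ (r * z)) (Metric.ball 0 1) := by
  apply DifferentiableOn.diffContOnCl
  rw [closure_ball _ one_ne_zero]
  refine hΦ.comp (by fun_prop) fun z hz => mem_ball_one.2 ?_
  have hz' : ‖z‖ ≤ 1 := by simpa using hz
  rw [norm_mul, Complex.norm_real, Real.norm_of_nonneg h0]
  nlinarith [norm_nonneg z]

lemma tendsto_comp_mul {E : Type*} [TopologicalSpace E] {Φ : ℂ → E}
    (hΦ : ContinuousOn Φ (Metric.ball 0 1)) {z : ℂ} (hz : ‖z‖ < 1) :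
    Tendsto (fun r : ℝ => Φ (r * z)) (𝓝[<] 1) (𝓝 (Φ z)) := by
  have h1 : ContinuousAt Φ z := hΦ.continuousAt (Metric.isOpen_ball.mem_nhds (mem_ball_one.2 hz))
  have h2 : Tendsto (fun r : ℝ => (r : ℂ) * z) (𝓝[<] 1) (𝓝 z) := by
    have : Tendsto (fun r : ℝ => (r : ℂ) * z) (𝓝 1) (𝓝 (((1 : ℝ) : ℂ) * z)) := by
      exact Continuous.tendsto (by fun_prop) _
    rw [Complex.ofReal_one, one_mul] at this
    exact this.mono_left nhdsWithin_le_nhds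
  exact h1.tendsto.comp h2

lemma abs_pk_le {z : ℂ} (hz : ‖z‖ < 1) (θ : ℝ) : |pk z θ| ≤ 2 / (1 - ‖z‖) := by
  rw [abs_of_nonneg (pk_nonneg hz θ)]
  exact pk_le hz θ

lemma Bdry.integral_pk_smul {Φ g : ℂ → ℂ} {M : ℝ} (h : Bdry Φ g M) {z : ℂ} (hz : ‖z‖ < 1) :
    ∫ θ, pk z θ • g (circlePt θ) ∂circMeas = Φ z := by
  have h1 := h.tendsto_integral (Q := Prod.snd) continuous_snd (continuous_pk hz) (abs_pk_le hz)
  refine tendsto_nhds_unique h1 ?_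
  refine (tendsto_comp_mul h.diff.continuousOn hz).congr' ?_
  filter_upwards [eventually_mem_Ioo_one] with r hr
  exact (_root_.integral_pk_smul (diffContOnCl_comp_mul h.diff hr.1.le hr.2) hz).symm

lemma integrable_of_bound {E : Type*} [NormedAddCommGroup E] {f : ℝ → E}
    (hf : AEStronglyMeasurable f circMeas) {C : ℝ} (h : ∀ θ, ‖f θ‖ ≤ C) : Integrable f circMeas :=
  Integrable.of_bound hf C (ae_of_all _ h)

lemma integral_pk_mul_normSq_sub {g : ℝ → ℂ} (hm : AEStronglyMeasurable g circMeas) {M : ℝ}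
    (hM : ∀ θ, ‖g θ‖ ≤ M) {z w : ℂ} (hz : ‖z‖ < 1) (hw : ∫ θ, pk z θ • g θ ∂circMeas = w) :
    ∫ θ, pk z θ * ‖g θ - w‖ ^ 2 ∂circMeas = ∫ θ, pk z θ * ‖g θ‖ ^ 2 ∂circMeas - ‖w‖ ^ 2 := by
  have hi1 : Integrable (fun θ => pk z θ * ‖g θ‖ ^ 2) circMeas := by
    refine integrable_pk_smul hz (f := fun θ => ‖g θ‖ ^ 2)
      (integrable_of_bound (hm.norm.pow 2) (C := M ^ 2) fun θ => ?_)
    rw [norm_pow, norm_norm]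
    gcongr
    exact hM θ
  have hi2 : Integrable (fun θ => pk z θ • g θ) circMeas :=
    integrable_pk_smul hz (integrable_of_bound hm hM)
  have hi3 : Integrable (pk z) circMeas := by
    simpa using integrable_pk_smul hz (integrable_const (1 : ℝ))
  have hi4 : Integrable (fun θ => (pk z θ • g θ * (starRingEnd ℂ) w).re) circMeas :=
    (hi2.mul_const _).re
  have he : ∀ θ, pk z θ * ‖g θ - w‖ ^ 2 = pk z θ * ‖g θ‖ ^ 2 -
      2 * (pk z θ • g θ * (starRingEnd ℂ) w).re + pk z θ * ‖w‖ ^ 2 := fun θ => by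
    have : ‖g θ - w‖ ^ 2 = ‖g θ‖ ^ 2 + ‖w‖ ^ 2 - 2 * (g θ * (starRingEnd ℂ) w).re := by
      simp only [← Complex.normSq_eq_norm_sq, Complex.normSq_sub]
    rw [this, smul_mul_assoc, Complex.smul_re, smul_eq_mul]
    ring
  simp_rw [he]
  rw [integral_add (f := fun θ => pk z θ * ‖g θ‖ ^ 2 -
      2 * (pk z θ • g θ * (starRingEnd ℂ) w).re) (hi1.sub (hi4.const_mul 2)) (hi3.mul_const _),
    integral_sub hi1 (hi4.const_mul 2), integral_const_mul, integral_mul_const, _root_.integral_pk hz]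
  have h5 : ∫ θ, (pk z θ • g θ * (starRingEnd ℂ) w).re ∂circMeas = ‖w‖ ^ 2 := by
    have := integral_re (hi2.mul_const ((starRingEnd ℂ) w))
    simp only [RCLike.re_to_complex] at this
    rw [this, integral_mul_const, hw, Complex.mul_conj, Complex.ofReal_re,
      Complex.normSq_eq_norm_sq]
  rw [h5]
  ring

/-- The analytic function whose real part is the Poisson integral of `f`. -/
def herg (f : ℂ → ℝ) (z : ℂ) : ℂ :=
  ∫ θ, herglotzRieszKernel 0 z (circlePt θ) * f (circlePt θ) ∂circMeas

lemma differentiableOn_herg {f : ℂ → ℝ} (hf : Integrable (fun θ => f (circlePt θ)) circMeas) :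
    DifferentiableOn ℂ (herg f) (Metric.ball 0 1) := by
  have h := differentiableOn_circleAverage_herglotzRieszKernel_smul (f := fun ζ => (f ζ : ℂ))
    ((circleIntegrable_iff_integrable _).2 hf.ofReal)
  simp only [circleAverage_eq_integral] at h
  exact h

lemma re_herg {f : ℂ → ℝ} (hf : Integrable (fun θ => f (circlePt θ)) circMeas) {z : ℂ}
    (hz : ‖z‖ < 1) : (herg f z).re = ∫ θ, pk z θ * f (circlePt θ) ∂circMeas := by
  have h := re_circleAverage_herglotzRieszKernel_smul
    ((circleIntegrable_iff_integrable _).2 hf) (mem_ball_one.2 hz)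
  rw [← poissonKernel_eq_re_herglotzRieszKernel] at h
  simp only [circleAverage_eq_integral] at h
  refine h.trans (integral_congr_ae (ae_of_all _ fun θ => ?_))
  simp [pk_eq_poissonKernel]

lemma norm_herg_le {f : ℂ → ℝ} (hf : Integrable (fun θ => f (circlePt θ)) circMeas)
    (h0 : ∀ ζ, 0 ≤ f ζ) {z : ℂ} (hz : ‖z‖ < 1) :
    ‖herg f z‖ ≤ 2 / (1 - ‖z‖) * ∫ θ, f (circlePt θ) ∂circMeas := by
  rw [← integral_const_mul]
  refine norm_integral_le_of_norm_le (hf.const_mul _) (ae_of_all _ fun θ => ?_)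
  rw [norm_mul, Complex.norm_real, Real.norm_of_nonneg (h0 _)]
  exact mul_le_mul_of_nonneg_right (norm_herglotzRieszKernel_le hz θ) (h0 _)

lemma Wien.re_disc_schw_eq {f : Wien ℤ} (hf : IsSelfAdjoint f) {z : ℂ} (hz : ‖z‖ < 1) {φ : ℂ → ℝ}
    (h : ∀ ζ : Circle, (Wien.evC ζ f).re = φ ζ) :
    (Wien.disc (Wien.schw f) z).re = ∫ θ, pk z θ * φ (circlePt θ) ∂circMeas := by
  have hd : DiffContOnCl ℂ (Wien.disc (Wien.schw f)) (Metric.ball 0 1) :=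
    ⟨Wien.differentiableOn_disc _, by
      rw [closure_ball _ one_ne_zero]; exact Wien.continuousOn_disc _⟩
  have h1 := integral_pk_smul hd hz
  rw [← h1]
  have hcont : Continuous fun θ => Wien.disc (Wien.schw f) (circlePt θ) :=
    (Wien.continuousOn_disc _).comp_continuous (by fun_prop) fun θ => by simp
  have hi : Integrable (fun θ => pk z θ • Wien.disc (Wien.schw f) (circlePt θ)) circMeas := by
    refine integrable_pk_smul hz ?_
    obtain ⟨C, hC⟩ := (isCompact_closedBall (0 : ℂ) 1).exists_bound_of_continuousOn
      (Wien.continuousOn_disc (Wien.schw f))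
    exact integrable_of_bound hcont.aestronglyMeasurable fun θ => hC _ (by simp)
  have := integral_re hi
  simp only [RCLike.re_to_complex] at this
  rw [← this]
  refine integral_congr_ae (ae_of_all _ fun θ => ?_)
  have h2 := Wien.re_disc_schw hf ⟨circlePt θ, by simp [Submonoid.unitSphere]⟩
  have h3 := h2.trans (h ⟨circlePt θ, by simp [Submonoid.unitSphere]⟩)
  simp only [Complex.smul_re, smul_eq_mul]
  exact congrArg _ h3

/-! ### Radial limits of bounded analytic functions -/

lemma exists_lipschitz_primitive {Φ : ℂ → ℂ} (hd : DifferentiableOn ℂ Φ (Metric.ball 0 1)) {M : ℝ}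
    (hM : ∀ z, ‖z‖ < 1 → ‖Φ z‖ ≤ M) :
    ∃ (𝒢 : ℂ → ℂ) (K : NNReal), LipschitzWith K 𝒢 ∧ ∀ z, ‖z‖ < 1 → HasDerivAt 𝒢 (Φ z) z := by
  obtain ⟨G, hG⟩ := hd.isExactOn_ball
  have hM0 : 0 ≤ M := (norm_nonneg _).trans (hM 0 (by simp))
  have hlip : LipschitzOnWith M.toNNReal G (Metric.ball 0 1) := by
    refine Convex.lipschitzOnWith_of_nnnorm_hasDerivWithin_le (f' := Φ) (convex_ball _ _)
      (fun z hz => (hG z hz).hasDerivWithinAt) fun z hz => ?_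
    rw [← NNReal.coe_le_coe, Real.coe_toNNReal _ hM0]
    exact hM z (mem_ball_one.1 hz)
  obtain ⟨𝒢, h1, h2⟩ := hlip.extend_finite_dimension
  refine ⟨𝒢, _, h1, fun z hz => ?_⟩
  refine (hG z (mem_ball_one.2 hz)).congr_of_eventuallyEq ?_
  filter_upwards [Metric.isOpen_ball.mem_nhds (mem_ball_one.2 hz)] with w hw
  exact (h2 hw).symm

lemma circlePt_injOn {θ θ₀ : ℝ} (h0 : θ₀ ∈ Ioo 0 (2 * Real.pi)) (h : θ ∈ Icc 0 (2 * Real.pi))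
    (he : circlePt θ = circlePt θ₀) : θ = θ₀ := by
  simp only [circlePt, Complex.exp_eq_exp_iff_exists_int] at he
  obtain ⟨n, hn⟩ := he
  have h1 : θ = θ₀ + n * (2 * Real.pi) := by
    have h2 : (θ : ℂ) * Complex.I = ((θ₀ + n * (2 * Real.pi) : ℝ) : ℂ) * Complex.I := by
      rw [hn]; push_cast; ring
    exact_mod_cast mul_right_cancel₀ Complex.I_ne_zero h2
  have hpi := Real.pi_pos
  have hn1 : (n : ℝ) < 1 := by
    by_contra! hc
    nlinarith [h0.1, h.2]
  have hn2 : (-1 : ℝ) < n := by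
    by_contra! hc
    nlinarith [h0.2, h.1]
  have : n = 0 := by
    have a : n < 1 := by exact_mod_cast hn1
    have b : -1 < n := by exact_mod_cast hn2
    omega
  simp [h1, this]

/-- The difference quotient of `𝒢` at `ζ₀`. -/
def dq (𝒢 : ℂ → ℂ) (ζ₀ z : ℂ) : ℂ := (𝒢 z - 𝒢 ζ₀) / (z - ζ₀)

lemma norm_dq_le {𝒢 : ℂ → ℂ} {K : NNReal} (hL : LipschitzWith K 𝒢) (ζ₀ z : ℂ) :
    ‖dq 𝒢 ζ₀ z‖ ≤ K := by
  rw [dq, norm_div]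
  refine div_le_of_le_mul₀ (norm_nonneg _) K.2 ?_
  simpa [dist_eq_norm] using hL.dist_le_mul z ζ₀

lemma bdry_dq {𝒢 Φ : ℂ → ℂ} {K : NNReal} (hL : LipschitzWith K 𝒢)
    (hd : ∀ z, ‖z‖ < 1 → HasDerivAt 𝒢 (Φ z) z) {θ₀ : ℝ} (h0 : θ₀ ∈ Ioo 0 (2 * Real.pi)) :
    Bdry (dq 𝒢 (circlePt θ₀)) (dq 𝒢 (circlePt θ₀)) K where
  diff z hz := by
    have hz' := mem_ball_one.1 hz
    refine ((((hd z hz').differentiableAt.sub_const _).div (differentiableAt_id.sub_const _)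
      ?_)).differentiableWithinAt
    rw [id, sub_ne_zero]
    rintro rfl
    simp at hz'
  bound z _ := norm_dq_le hL _ z
  meas := by
    refine Measurable.aestronglyMeasurable ?_
    unfold dq
    have := hL.continuous
    exact Measurable.div (by fun_prop) (by fun_prop)
  gbound := norm_dq_le hL _
  lim := by
    rw [ae_circMeas]
    have h1 : ∀ᵐ θ ∂(volume.restrict (Ioc 0 (2 * Real.pi))), θ ≠ θ₀ :=
      ae_restrict_of_ae (by simp [ae_iff, measure_singleton])
    filter_upwards [h1, ae_restrict_mem measurableSet_Ioc] with θ hθ hm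
    have hne : circlePt θ - circlePt θ₀ ≠ 0 := by
      rw [sub_ne_zero]
      exact fun he => hθ (circlePt_injOn h0 (Ioc_subset_Icc_self hm) he)
    have hc : ContinuousAt (dq 𝒢 (circlePt θ₀)) (circlePt θ) :=
      ContinuousAt.div (hL.continuous.continuousAt.sub continuousAt_const)
        (continuousAt_id.sub continuousAt_const) hne
    have h2 : Tendsto (fun r : ℝ => (r : ℂ) * circlePt θ) (𝓝[<] 1) (𝓝 (circlePt θ)) := by
      have : Tendsto (fun r : ℝ => (r : ℂ) * circlePt θ) (𝓝 1) (𝓝 (((1 : ℝ) : ℂ) * circlePt θ)) :=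
        Continuous.tendsto (by fun_prop) _
      rw [Complex.ofReal_one, one_mul] at this
      exact this.mono_left nhdsWithin_le_nhds
    exact hc.tendsto.comp h2

lemma tendsto_dq {𝒢 : ℂ → ℂ} {θ₀ : ℝ} {v : ℂ}
    (h : HasDerivAt (fun θ => 𝒢 (circlePt θ)) v θ₀) :
    Tendsto (fun θ => dq 𝒢 (circlePt θ₀) (circlePt θ)) (𝓝[≠] θ₀)
      (𝓝 (v / (circlePt θ₀ * Complex.I))) := by
  have h1 : HasDerivAt circlePt (circlePt θ₀ * Complex.I) θ₀ := by
    have := ((hasDerivAt_id θ₀).ofReal_comp.mul_const Complex.I).cexp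
    simp only [id, Complex.ofReal_one, one_mul] at this
    exact this
  have h2 := hasDerivAt_iff_tendsto_slope.1 h
  have h3 := hasDerivAt_iff_tendsto_slope.1 h1
  have hne : circlePt θ₀ * Complex.I ≠ 0 := by
    rw [← norm_pos_iff]; simp
  refine (h2.div h3 hne).congr' ?_
  filter_upwards [self_mem_nhdsWithin] with θ hθ
  have hθ' : (θ - θ₀)⁻¹ ≠ 0 := inv_ne_zero (sub_ne_zero.2 hθ)
  have h4 : (((θ - θ₀)⁻¹ : ℝ) : ℂ) ≠ 0 := by exact_mod_cast hθ'
  simp only [Pi.div_apply, slope_def_module, dq, Complex.real_smul]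
  rw [mul_div_mul_left _ _ h4]

/-- If the boundary values converge at a point, then so do the interior values. -/
lemma Bdry.exists_delta {H g : ℂ → ℂ} {K : ℝ} (hH : Bdry H g K) {θ₀ : ℝ}
    (h0 : θ₀ ∈ Ioo 0 (2 * Real.pi)) {L : ℂ}
    (hL : Tendsto (fun θ => g (circlePt θ)) (𝓝[≠] θ₀) (𝓝 L)) {ε : ℝ} (hε : 0 < ε) :
    ∃ δ > 0, ∀ z, ‖z‖ < 1 → ‖z - circlePt θ₀‖ < δ → ‖H z - L‖ ≤ ε := by
  have hK : 0 ≤ K := (norm_nonneg _).trans (hH.gbound 0)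
  rw [Metric.tendsto_nhdsWithin_nhds] at hL
  obtain ⟨η, hη, hη'⟩ := hL (ε / 2) (by positivity)
  have hS : IsCompact (Icc 0 (2 * Real.pi) ∩ {θ | η ≤ |θ - θ₀|}) :=
    isCompact_Icc.inter_right (isClosed_le continuous_const (by fun_prop))
  obtain ⟨δ, hδ, hδ'⟩ : ∃ δ > 0, ∀ θ ∈ Icc 0 (2 * Real.pi) ∩ {θ | η ≤ |θ - θ₀|},
      δ ≤ ‖circlePt θ - circlePt θ₀‖ := by
    refine hS.exists_forall_le' (by fun_prop) fun θ hθ => ?_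
    rw [norm_pos_iff, sub_ne_zero]
    intro he
    have := circlePt_injOn h0 hθ.1 he
    have h2 := hθ.2
    rw [this] at h2
    simp at h2
    linarith
  set B := K + ‖L‖ with hB
  have hB0 : 0 ≤ B := by positivity
  refine ⟨min (δ / 2) (ε * δ ^ 2 / (16 * (B + 1))), by positivity, fun z hz hz' => ?_⟩
  have hz1 : ‖z - circlePt θ₀‖ < δ / 2 := hz'.trans_le (min_le_left _ _)
  have hz2 : ‖z - circlePt θ₀‖ < ε * δ ^ 2 / (16 * (B + 1)) := hz'.trans_le (min_le_right _ _)
  have hgi := integrable_of_bound hH.meas fun θ => hH.gbound (circlePt θ)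
  have hInt : H z - L = ∫ θ, pk z θ • (g (circlePt θ) - L) ∂circMeas := by
    simp_rw [smul_sub]
    rw [integral_sub (integrable_pk_smul hz hgi) (integrable_pk_smul hz (integrable_const L)),
      hH.integral_pk_smul hz, integral_smul_const, integral_pk hz, one_smul]
  have hsub : 1 - ‖z‖ ≤ ‖z - circlePt θ₀‖ := by
    rw [norm_sub_rev]; exact one_sub_norm_le z θ₀
  have hbd : ∀ᵐ θ ∂circMeas, ‖pk z θ • (g (circlePt θ) - L)‖ ≤ pk z θ * (ε / 2) + ε / 2 := by
    rw [ae_circMeas]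
    have h1 : ∀ᵐ θ ∂(volume.restrict (Ioc 0 (2 * Real.pi))), θ ≠ θ₀ :=
      ae_restrict_of_ae (by simp [ae_iff, measure_singleton])
    filter_upwards [h1, ae_restrict_mem measurableSet_Ioc] with θ hθ hm
    have hpk := pk_nonneg hz θ
    rw [norm_smul, Real.norm_of_nonneg hpk]
    rcases lt_or_ge |θ - θ₀| η with hlt | hge
    · have := hη' hθ (by rwa [Real.dist_eq])
      rw [dist_eq_norm] at this
      nlinarith
    · have hd := hδ' θ ⟨Ioc_subset_Icc_self hm, hge⟩
      have h3 : δ / 2 ≤ ‖circlePt θ - z‖ := by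
        have := norm_sub_le_norm_sub_add_norm_sub (circlePt θ) z (circlePt θ₀)
        linarith
      have h4 : pk z θ ≤ 8 / δ ^ 2 * ‖z - circlePt θ₀‖ := by
        have h5 : 0 < ‖circlePt θ - z‖ := by linarith
        rw [pk, div_le_iff₀ (by positivity)]
        have h6 : (δ / 2) ^ 2 ≤ ‖circlePt θ - z‖ ^ 2 := by gcongr
        calc 1 - ‖z‖ ^ 2 ≤ 2 * ‖z - circlePt θ₀‖ := by nlinarith [norm_nonneg z]
          _ = 8 / δ ^ 2 * ‖z - circlePt θ₀‖ * (δ / 2) ^ 2 := by field_simp; ring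
          _ ≤ _ := by gcongr
      have h7 : ‖g (circlePt θ) - L‖ ≤ B := (norm_sub_le _ _).trans
        (add_le_add (hH.gbound _) le_rfl)
      calc pk z θ * ‖g (circlePt θ) - L‖ ≤ 8 / δ ^ 2 * ‖z - circlePt θ₀‖ * B := by gcongr
        _ ≤ 8 / δ ^ 2 * (ε * δ ^ 2 / (16 * (B + 1))) * (B + 1) := by
          gcongr
          linarith
        _ = ε / 2 := by field_simp; ring
        _ ≤ _ := by linarith [mul_nonneg hpk (half_pos hε).le]
  have hip : Integrable (pk z) circMeas := by
    simpa using integrable_pk_smul hz (integrable_const (1 : ℝ))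
  rw [hInt]
  refine (norm_integral_le_of_norm_le (g := fun θ => pk z θ * (ε / 2) + ε / 2)
    ((hip.mul_const _).add (integrable_const _)) hbd).trans ?_
  rw [integral_add (hip.mul_const _) (integrable_const _), integral_mul_const, integral_pk hz]
  simp

lemma tendsto_radial {𝒢 Φ : ℂ → ℂ} {ζ L : ℂ} (hζ : ‖ζ‖ = 1)
    (hd : ∀ z, ‖z‖ < 1 → HasDerivAt 𝒢 (Φ z) z)
    (hL : ∀ ε > 0, ∃ δ > 0, ∀ z, ‖z‖ < 1 → ‖z - ζ‖ < δ → ‖dq 𝒢 ζ z - L‖ ≤ ε) :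
    Tendsto (fun r : ℝ => Φ (r * ζ)) (𝓝[<] 1) (𝓝 L) := by
  rw [Metric.tendsto_nhdsWithin_nhds]
  intro ε hε
  obtain ⟨δ, hδ, h⟩ := hL (ε / 4) (by positivity)
  refine ⟨min 1 (δ / 2), by positivity, fun r hr hr' => ?_⟩
  rw [mem_Iio] at hr
  rw [Real.dist_eq, abs_of_neg (by linarith), lt_min_iff] at hr'
  have hr0 : 0 < r := by linarith [hr'.1]
  have hs : ∀ w ∈ Metric.closedBall ((r : ℂ) * ζ) ((1 - r) / 2),
      ‖w‖ < 1 ∧ ‖w - ζ‖ ≤ 3 / 2 * (1 - r) := by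
    intro w hw
    rw [mem_closedBall_iff_norm] at hw
    constructor
    · have := norm_le_norm_add_norm_sub' w (r * ζ)
      rw [norm_mul, Complex.norm_real, Real.norm_of_nonneg hr0.le, hζ] at this
      linarith
    · have h1 : ‖(r : ℂ) * ζ - ζ‖ = 1 - r := by
        rw [← sub_one_mul, norm_mul, hζ, mul_one, ← Complex.ofReal_one, ← Complex.ofReal_sub,
          Complex.norm_real, Real.norm_eq_abs, abs_of_neg (by linarith)]
        ring
      have := norm_sub_le_norm_sub_add_norm_sub w (r * ζ) ζ
      linarith
  set E : ℂ → ℂ := fun w => 𝒢 w - 𝒢 ζ - L * (w - ζ) with hE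
  have hEd : ∀ w, ‖w‖ < 1 → HasDerivAt E (Φ w - L) w := fun w hw => by
    have := ((hd w hw).sub_const (𝒢 ζ)).sub (((hasDerivAt_id w).sub_const ζ).const_mul L)
    simp only [mul_one] at this
    exact this
  have hEb : ∀ w ∈ Metric.sphere ((r : ℂ) * ζ) ((1 - r) / 2), ‖E w‖ ≤ ε / 4 * (3 / 2 * (1 - r)) := by
    intro w hw
    obtain ⟨h1, h2⟩ := hs w (Metric.sphere_subset_closedBall hw)
    have hne : w - ζ ≠ 0 := by
      rw [sub_ne_zero]; rintro rfl; linarith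
    have h3 : E w = (dq 𝒢 ζ w - L) * (w - ζ) := by
      simp only [hE, dq]
      rw [sub_mul, div_mul_cancel₀ _ hne]
    rw [h3, norm_mul]
    gcongr
    exact h w h1 (by linarith [hr'.2])
  have hc := Complex.norm_deriv_le_of_forall_mem_sphere_norm_le (f := E)
    (show 0 < (1 - r) / 2 by linarith) ?_ hEb
  · have hrz : ‖(r : ℂ) * ζ‖ < 1 := (hs _ (Metric.mem_closedBall_self (by linarith))).1
    rw [(hEd _ hrz).deriv] at hc
    rw [dist_eq_norm]
    have : ε / 4 * (3 / 2 * (1 - r)) / ((1 - r) / 2) = 3 / 4 * ε := by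
      have : 1 - r ≠ 0 := by linarith
      field_simp
    linarith
  · apply DifferentiableOn.diffContOnCl
    rw [closure_ball _ (by linarith)]
    exact fun w hw => (hEd w (hs w hw).1).differentiableAt.differentiableWithinAt

theorem exists_bdry {Φ : ℂ → ℂ} (hd : DifferentiableOn ℂ Φ (Metric.ball 0 1)) {M : ℝ}
    (hM : ∀ z, ‖z‖ < 1 → ‖Φ z‖ ≤ M) : ∃ g, Bdry Φ g M := by
  classical
  have hM0 : 0 ≤ M := (norm_nonneg _).trans (hM 0 (by simp))
  obtain ⟨𝒢, K, hL, hG⟩ := exists_lipschitz_primitive hd hM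
  let P : ℂ → ℂ → Prop := fun ζ L =>
    ‖ζ‖ = 1 ∧ Tendsto (fun r : ℝ => Φ (r * ζ)) (𝓝[<] 1) (𝓝 L)
  let g : ℂ → ℂ := fun ζ => if h : ∃ L, P ζ L then h.choose else 0
  have hg : ∀ ζ, (∃ L, P ζ L) → P ζ (g ζ) := fun ζ h => by
    simp only [g, dif_pos h]
    exact h.choose_spec
  have hlim : ∀ᵐ θ ∂circMeas,
      Tendsto (fun r : ℝ => Φ (r * circlePt θ)) (𝓝[<] 1) (𝓝 (g (circlePt θ))) := by
    have hlipc : LipschitzWith 1 circlePt := by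
      have h1 : LipschitzWith 1 (circleMap 0 1) := by simpa using lipschitzWith_circleMap 0 1
      rwa [← funext circlePt_eq_circleMap] at h1
    have hae := (hL.comp hlipc).ae_differentiableAt_real
    rw [ae_circMeas]
    have h1 : ∀ᵐ θ ∂(volume.restrict (Ioc 0 (2 * Real.pi))), θ ≠ 2 * Real.pi :=
      ae_restrict_of_ae (by simp [ae_iff, measure_singleton])
    filter_upwards [ae_restrict_of_ae hae, h1, ae_restrict_mem measurableSet_Ioc] with θ hθ hne hm
    have hm' : θ ∈ Ioo 0 (2 * Real.pi) := ⟨hm.1, lt_of_le_of_ne hm.2 hne⟩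
    have ht := tendsto_dq (𝒢 := 𝒢) hθ.hasDerivAt
    exact (hg _ ⟨_, norm_circlePt θ, tendsto_radial (norm_circlePt θ) hG fun ε hε =>
      (bdry_dq hL hG hm').exists_delta hm' ht hε⟩).2
  refine ⟨g, hd, hM, ?_, fun ζ => ?_, hlim⟩
  · have hr : Tendsto (fun n : ℕ => 1 - 1 / ((n : ℝ) + 1)) atTop (𝓝[<] 1) := by
      refine tendsto_nhdsWithin_iff.2 ⟨?_, Eventually.of_forall fun n => ?_⟩
      · simpa using (tendsto_one_div_add_atTop_nhds_zero_nat (𝕜 := ℝ)).const_sub 1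
      · have : 0 < 1 / ((n : ℝ) + 1) := by positivity
        simp only [mem_Iio]; linarith
    refine aestronglyMeasurable_of_tendsto_ae atTop
      (f := fun n : ℕ => fun θ => Φ ((1 - 1 / ((n : ℝ) + 1) : ℝ) * circlePt θ)) (fun n => ?_) ?_
    · refine (continuous_comp_circle hd ?_ ?_).aestronglyMeasurable
      · rw [sub_nonneg, div_le_one (by positivity)]; simp
      · have : 0 < 1 / ((n : ℝ) + 1) := by positivity
        linarith
    · filter_upwards [hlim] with θ hθ
      exact hθ.comp hr
  · by_cases h : ∃ L, P ζ L
    · obtain ⟨h1, h2⟩ := hg ζ h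
      refine le_of_tendsto h2.norm ?_
      filter_upwards [eventually_mem_Ioo_one] with r hr
      refine hM _ ?_
      rw [norm_mul, Complex.norm_real, Real.norm_of_nonneg hr.1.le, h1, mul_one]
      exact hr.2
    · simp only [g, dif_neg h, norm_zero]
      exact hM0

/-! ### Quotient representation of Hardy functions -/

lemma exists_schw_log {F : ℂ → ℂ} (hF : DifferentiableOn ℂ F (Metric.ball 0 1)) {r : ℝ}
    (h0 : 0 ≤ r) (h1 : r < 1) :
    ∃ a : Wien ℕ, (∀ z, ‖z‖ ≤ 1 → 0 ≤ (Wien.disc a z).re ∧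
        ‖F (r * z)‖ ≤ Real.exp (Wien.disc a z).re) ∧
      ∀ n, ‖a.coef n‖ ≤ 2 * ∫ θ, Real.log (1 + ‖F (r * circlePt θ)‖ ^ 2) ∂circMeas := by
  obtain ⟨c, hc⟩ := Wien.exists_disc_eq hF h0 h1
  obtain ⟨f, hf, hfe⟩ := Wien.exists_exp_eq_one_add (Wien.isSelfAdjoint_sqMod c) fun ζ => by
    rw [Wien.evC_sqMod, Complex.ofReal_re]; positivity
  have hexp : ∀ ζ : Circle, Real.exp (Wien.evC ζ f).re = 1 + ‖F (r * ζ)‖ ^ 2 := fun ζ => by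
    have h2 := congrArg (fun g => ‖Wien.evC ζ g‖) hfe
    simp only [Wien.evC_exp, Complex.norm_exp, map_add, map_one, Wien.evC_sqMod] at h2
    rw [h2, hc _ (Circle.norm_coe ζ).le, ← Complex.ofReal_one, ← Complex.ofReal_add,
      Complex.norm_real, Real.norm_of_nonneg (by positivity)]
  have hlog : ∀ ζ : Circle, (Wien.evC ζ f).re = Real.log (1 + ‖F (r * ζ)‖ ^ 2) := fun ζ => by
    rw [← hexp, Real.log_exp]
  have hpos : ∀ ζ : Circle, 0 ≤ (Wien.evC ζ f).re := fun ζ => by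
    rw [hlog]
    exact Real.log_nonneg (by nlinarith [sq_nonneg ‖F (r * ζ)‖])
  have hre : ∀ ζ : Circle, (Wien.disc (-Wien.schw f) ζ).re = -(Wien.evC ζ f).re := fun ζ => by
    rw [← Wien.re_disc_schw hf, ← neg_one_smul ℂ, Wien.disc_smul _ _ (Circle.norm_coe ζ).le]
    simp
  have hneg : ∀ z, ‖z‖ ≤ 1 → Wien.disc (-Wien.schw f) z = -Wien.disc (Wien.schw f) z :=
    fun z hz => by
      rw [← neg_one_smul ℂ, Wien.disc_smul _ _ hz]
      ring
  refine ⟨Wien.schw f, fun z hz => ⟨?_, ?_⟩, ?_⟩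
  · have := Wien.norm_disc_le_of_circle (NormedSpace.exp (-Wien.schw f)) (m := 1) (fun ζ => ?_) hz
    · rw [Wien.disc_exp _ hz, hneg z hz, Complex.norm_exp, Real.exp_le_one_iff] at this
      simpa using this
    · rw [Wien.disc_exp _ (Circle.norm_coe ζ).le, Complex.norm_exp, hre, Real.exp_le_one_iff]
      simpa using hpos ζ
  · have := Wien.norm_disc_le_of_circle (c * NormedSpace.exp (-Wien.schw f)) (m := 1)
      (fun ζ => ?_) hz
    · rw [Wien.disc_mul _ _ hz, Wien.disc_exp _ hz, hneg z hz, norm_mul, Complex.norm_exp, hc z hz,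
        Complex.neg_re, Real.exp_neg, ← div_eq_mul_inv, div_le_one (Real.exp_pos _)] at this
      exact this
    · rw [Wien.disc_mul _ _ (Circle.norm_coe ζ).le, Wien.disc_exp _ (Circle.norm_coe ζ).le, norm_mul,
        Complex.norm_exp, hc _ (Circle.norm_coe ζ).le, hre, Real.exp_neg, hexp, ← div_eq_mul_inv,
        div_le_one (by positivity)]
      nlinarith [sq_nonneg (‖F (r * ζ)‖ - 1)]
  · intro n
    refine Wien.norm_coef_schw_le f (fun k => ?_) n
    refine (Wien.norm_coef_le_coef_zero hf hpos k).trans ?_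
    have h3 := Wien.re_disc_schw_eq hf (z := 0) (by simp)
      (φ := fun ζ => Real.log (1 + ‖F (r * ζ)‖ ^ 2)) hlog
    rw [Wien.disc_zero_right, Wien.coef_schw] at h3
    simp [pk] at h3
    rw [h3]

lemma exists_majorant_of_log {F : ℂ → ℂ} (hF : DifferentiableOn ℂ F (Metric.ball 0 1)) {B : ℝ}
    (hB : ∀ r : ℝ, 0 < r → r < 1 → ∫ θ, Real.log (1 + ‖F (r * circlePt θ)‖ ^ 2) ∂circMeas ≤ B) :
    ∃ A : ℂ → ℂ, DifferentiableOn ℂ A (Metric.ball 0 1) ∧ ∀ z, ‖z‖ < 1 → 0 ≤ (A z).re ∧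
      ‖F z‖ ≤ Real.exp (A z).re := by
  obtain ⟨r, -, hr, hrt⟩ := exists_seq_strictMono_tendsto' (show (0 : ℝ) < 1 from one_pos)
  choose a ha hac using fun k => exists_schw_log hF (hr k).1.le (hr k).2
  obtain ⟨d, φ, hφ, hd, hlim⟩ := exists_subseq_powSum (c := fun k => (a k).coef) (M := 2 * B)
    fun k n => (hac k n).trans (by linarith [hB _ (hr k).1 (hr k).2])
  refine ⟨powSum d, fun z hz => (hasDerivAt_powSum hd
    (mem_ball_one.1 hz)).differentiableAt.differentiableWithinAt, fun z hz => ?_⟩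
  have h1 := (hlim z hz).1
  have h2 : Tendsto (fun k => (powSum (a (φ k)).coef z).re) atTop (𝓝 (powSum d z).re) :=
    (Complex.continuous_re.tendsto _).comp h1
  have hrt' : Tendsto (fun k => r (φ k)) atTop (𝓝[<] 1) :=
    tendsto_nhdsWithin_iff.2 ⟨hrt.comp hφ.tendsto_atTop, Eventually.of_forall fun k => (hr _).2⟩
  have h3 := (tendsto_comp_mul hF.continuousOn hz).comp hrt'
  exact ⟨ge_of_tendsto' h2 fun k => (ha (φ k) z hz.le).1,
    le_of_tendsto_of_tendsto' h3.norm ((Real.continuous_exp.tendsto _).comp h2)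
      fun k => (ha (φ k) z hz.le).2⟩

lemma log_one_add_sq_le {x p : ℝ} (hx : 0 ≤ x) (hp : 0 < p) :
    Real.log (1 + x ^ 2) ≤ 1 + 2 / p * x ^ p := by
  have hxp : 0 ≤ 2 / p * x ^ p := by positivity
  have hl2 : Real.log 2 ≤ 1 := by linarith [Real.log_two_lt_d9]
  rcases le_or_gt x 1 with h | h
  · calc Real.log (1 + x ^ 2) ≤ Real.log 2 := Real.log_le_log (by positivity) (by nlinarith)
      _ ≤ _ := by linarith
  · have h1 := Real.log_le_rpow_div hx hp
    calc Real.log (1 + x ^ 2) ≤ Real.log (2 * x ^ 2) := Real.log_le_log (by positivity) (by nlinarith)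
      _ = Real.log 2 + 2 * Real.log x := by
        rw [Real.log_mul two_ne_zero (by positivity), Real.log_pow]; norm_num
      _ ≤ 1 + 2 * (x ^ p / p) := by linarith
      _ = _ := by ring

lemma unitDisc_eq : unitDisc = Metric.ball 0 1 := by
  ext z; simp [unitDisc]

theorem MemHardyE.exists_majorant {p : ENNReal} (hp : 0 < p) {F : ℂ → ℂ} (hF : MemHardyE p F) :
    DifferentiableOn ℂ F (Metric.ball 0 1) ∧
    ∃ A : ℂ → ℂ, DifferentiableOn ℂ A (Metric.ball 0 1) ∧ ∀ z, ‖z‖ < 1 → 0 ≤ (A z).re ∧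
      ‖F z‖ ≤ Real.exp (A z).re := by
  unfold MemHardyE at hF
  split_ifs at hF with h
  · obtain ⟨hd, M, hM⟩ := hF
    rw [unitDisc_eq] at hd hM
    refine ⟨hd, fun _ => (|M| : ℝ), differentiableOn_const _, fun z hz => ?_⟩
    rw [Complex.ofReal_re]
    refine ⟨abs_nonneg _, (hM z (mem_ball_one.2 hz)).trans ?_⟩
    linarith [le_abs_self M, Real.add_one_le_exp |M|]
  · obtain ⟨hd, M, hM⟩ := hF
    rw [unitDisc_eq] at hd
    refine ⟨hd, exists_majorant_of_log (B := 1 + 2 / p.toReal * ((2 * Real.pi)⁻¹ * M)) hd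
      fun r h0 h1 => ?_⟩
    have hp' : 0 < p.toReal := ENNReal.toReal_pos hp.ne' h
    have hc := continuous_comp_circle hd h0.le h1
    have hM' := hM r h0 h1
    have hci : ∀ {f : ℝ → ℝ}, Continuous f → Integrable f circMeas := fun {f} hf => by
      unfold circMeas
      exact ((hf.integrableOn_Icc (a := 0) (b := 2 * Real.pi)).mono_set
        Ioc_subset_Icc_self).smul_measure (by simp)
    have hc2 : Continuous fun θ => ‖F (r * circlePt θ)‖ ^ p.toReal :=
      hc.norm.rpow_const fun _ => Or.inr hp'.le
    have hI : ∫ θ, ‖F (r * circlePt θ)‖ ^ p.toReal ∂circMeas ≤ (2 * Real.pi)⁻¹ * M := by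
      rw [integral_circMeas, smul_eq_mul]
      gcongr
      exact hM'
    calc ∫ θ, Real.log (1 + ‖F (r * circlePt θ)‖ ^ 2) ∂circMeas
        ≤ ∫ θ, (1 + 2 / p.toReal * ‖F (r * circlePt θ)‖ ^ p.toReal) ∂circMeas := by
          refine integral_mono (hci ?_) ((integrable_const _).add ((hci hc2).const_mul _))
            fun θ => log_one_add_sq_le (norm_nonneg _) hp'
          exact Continuous.log (continuous_const.add (hc.norm.pow 2)) fun θ => by positivity
      _ = 1 + 2 / p.toReal * ∫ θ, ‖F (r * circlePt θ)‖ ^ p.toReal ∂circMeas := by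
          rw [integral_add (integrable_const _) ((hci hc2).const_mul _), integral_const_mul]
          simp
      _ ≤ _ := by gcongr

/-! ### A supersolution for the square of the gradient -/

lemma SubJet.neg_sqrt_mul {a b : ℂ → ℝ} {z : ℂ} {L : ℝ} (ha : SubJet (fun x => -a x) z L)
    (hb : SubJet (fun x => -b x) z 0) (ha0 : 0 < a z) (hb0 : 0 < b z) (han : ∀ᶠ x in 𝓝 z, 0 ≤ a x)
    (hbn : ∀ᶠ x in 𝓝 z, 0 ≤ b x) :
    SubJet (fun x => -√(a x * b x)) z (√(b z / a z) / 2 * L) := by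
  set s := √(b z / a z) with hs
  have hs0 : 0 < s := Real.sqrt_pos.2 (by positivity)
  have h := (ha.const_mul (s := s / 2) (by positivity)).add
    (hb.const_mul (s := s⁻¹ / 2) (by positivity))
  refine (h.mono (K := s / 2 * L) (by simp)).of_touching ?_ ?_
  · have e1 : √(a z * b z) = s * a z := by
      rw [← Real.sqrt_sq ha0.le, hs, ← Real.sqrt_mul (by positivity), Real.sqrt_sq ha0.le]
      congr 1; field_simp
    have e2 : s ^ 2 = b z / a z := Real.sq_sqrt (by positivity)
    have e3 : s⁻¹ * b z = s * a z := by
      rw [eq_div_iff ha0.ne'] at e2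
      field_simp
      linarith
    rw [e1]
    linear_combination (-(1 : ℝ) / 2) * e3
  · filter_upwards [han, hbn] with x hx hy
    have h1 : √(a x * b x) ^ 2 = a x * b x := Real.sq_sqrt (by positivity)
    have h2 : √(a x * b x) ≤ (s * a x + s⁻¹ * b x) / 2 := by
      refine abs_le_of_sq_le_sq' ?_ (by positivity) |>.2
      rw [h1]
      have : s * a x * (s⁻¹ * b x) = a x * b x := by field_simp
      nlinarith [sq_nonneg (s * a x - s⁻¹ * b x)]
    linarith

lemma Bdry.exists_dilation {Φ g : ℂ → ℂ} {M : ℝ} (h : Bdry Φ g M) {c : ℝ} (hc : 0 < c) :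
    ∃ s : ℝ, 0 < s ∧ s < 1 ∧ ∫ θ, ‖g (circlePt θ) - Φ (s * circlePt θ)‖ ^ 2 ∂circMeas ≤ c := by
  have h1 := h.tendsto_integral (Q := fun p => ‖p.1 - p.2‖ ^ 2) (by fun_prop) (w := fun _ => 1)
    continuous_const (C := 1) (by simp)
  simp only [smul_eq_mul, one_mul, sub_self, norm_zero, ne_eq, OfNat.ofNat_ne_zero,
    not_false_eq_true, zero_pow, integral_zero] at h1
  obtain ⟨s, hs, hs'⟩ := ((h1.eventually (ge_mem_nhds hc)).and eventually_mem_Ioo_one).exists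
  exact ⟨s, hs'.1, hs'.2, hs⟩

/-- The squared distance between boundary values and a dilation. -/
def dilErr (Φ g : ℂ → ℂ) (s : ℝ) (ζ : ℂ) : ℝ := ‖g ζ - Φ (s * ζ)‖ ^ 2

section
variable {Φ g : ℂ → ℂ} {s : ℝ} {z : ℂ} (h : Bdry Φ g 1) (h0 : 0 < s) (h1 : s < 1)
include h h0 h1

lemma Bdry.meas_sub : AEStronglyMeasurable (fun θ => g (circlePt θ) - Φ (s * circlePt θ)) circMeas :=
  h.meas.sub (continuous_comp_circle h.diff h0.le h1).aestronglyMeasurable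

lemma Bdry.norm_sub_le (θ : ℝ) : ‖g (circlePt θ) - Φ (s * circlePt θ)‖ ≤ 2 := by
  refine (_root_.norm_sub_le _ _).trans ?_
  have := h.bound (s * circlePt θ) (by rwa [norm_ofReal_mul_circlePt h0.le])
  linarith [h.gbound (circlePt θ)]

lemma Bdry.integrable_dilErr : Integrable (fun θ => dilErr Φ g s (circlePt θ)) circMeas := by
  refine integrable_of_bound ((h.meas_sub h0 h1).norm.pow 2) (C := 4) fun θ => ?_
  unfold dilErr
  rw [norm_pow, norm_norm]
  nlinarith [h.norm_sub_le h0 h1 θ, norm_nonneg (g (circlePt θ) - Φ (s * circlePt θ))]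

lemma Bdry.integral_pk_sub (hz : ‖z‖ < 1) :
    ∫ θ, pk z θ • (g (circlePt θ) - Φ (s * circlePt θ)) ∂circMeas = Φ z - Φ (s * z) := by
  simp_rw [smul_sub]
  rw [integral_sub (integrable_pk_smul hz (integrable_of_bound h.meas fun θ => h.gbound _)),
    h.integral_pk_smul hz, _root_.integral_pk_smul (diffContOnCl_comp_mul h.diff h0.le h1) hz]
  refine integrable_pk_smul hz (integrable_of_bound
    (continuous_comp_circle h.diff h0.le h1).aestronglyMeasurable (C := 1) fun θ => h.bound _ ?_)
  rwa [norm_ofReal_mul_circlePt h0.le]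

lemma Bdry.normSq_sub_le (hz : ‖z‖ < 1) :
    ‖Φ z - Φ (s * z)‖ ^ 2 ≤ (herg (dilErr Φ g s) z).re := by
  rw [re_herg (h.integrable_dilErr h0 h1) hz, ← sub_nonneg]
  have := integral_pk_mul_normSq_sub (h.meas_sub h0 h1) (h.norm_sub_le h0 h1) hz
    (h.integral_pk_sub h0 h1 hz)
  unfold dilErr
  rw [← this]
  exact integral_nonneg fun θ => mul_nonneg (pk_nonneg hz θ) (by positivity)

lemma Bdry.re_herg_le (hz : ‖z‖ < 1) : (herg (dilErr Φ g s) z).re ≤ 4 := by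
  rw [re_herg (h.integrable_dilErr h0 h1) hz]
  have hip : Integrable (pk z) circMeas := by
    simpa using integrable_pk_smul hz (integrable_const (1 : ℝ))
  calc ∫ θ, pk z θ * dilErr Φ g s (circlePt θ) ∂circMeas ≤ ∫ θ, pk z θ * 4 ∂circMeas := by
        refine integral_mono (integrable_pk_smul hz (h.integrable_dilErr h0 h1)) (hip.mul_const _)
          fun θ => mul_le_mul_of_nonneg_left ?_ (pk_nonneg hz θ)
        unfold dilErr
        nlinarith [h.norm_sub_le h0 h1 θ, norm_nonneg (g (circlePt θ) - Φ (s * circlePt θ))]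
    _ = 4 := by rw [integral_mul_const, integral_pk hz, one_mul]

end

/-- Summation of small harmonic functions with growing weights. -/
lemma exists_weighted_sum {S : ℕ → ℂ → ℂ} (hS : ∀ n, DifferentiableOn ℂ (S n) (Metric.ball 0 1))
    (hre : ∀ n z, ‖z‖ < 1 → 0 ≤ (S n z).re)
    (hb : ∀ n z, ‖z‖ < 1 → ‖S n z‖ ≤ 2 / (1 - ‖z‖) * ((1 / 2) ^ n / (n + 1))) :
    ∃ U : ℂ → ℂ, DifferentiableOn ℂ U (Metric.ball 0 1) ∧
      ∀ n z, ‖z‖ < 1 → (n + 1) * (S n z).re ≤ (U z).re := by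
  have hb' : ∀ (n : ℕ) (z : ℂ), ‖z‖ < 1 → ‖((n : ℂ) + 1) * S n z‖ ≤ 2 / (1 - ‖z‖) * (1 / 2) ^ n := by
    intro n z hz
    have e : ‖(n : ℂ) + 1‖ = n + 1 := by
      have : ((n : ℂ) + 1) = ((n + 1 : ℝ) : ℂ) := by push_cast; rfl
      rw [this, Complex.norm_real, Real.norm_of_nonneg (by positivity)]
    rw [norm_mul, e]
    calc ((n : ℝ) + 1) * ‖S n z‖ ≤ (n + 1) * (2 / (1 - ‖z‖) * ((1 / 2) ^ n / (n + 1))) := by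
          gcongr
          exact hb n z hz
      _ = _ := by field_simp
  have hsum : ∀ z, ‖z‖ < 1 → Summable fun n : ℕ => ((n : ℂ) + 1) * S n z := fun z hz =>
    Summable.of_norm_bounded (summable_geometric_two.mul_left _) fun n => hb' n z hz
  refine ⟨fun z => ∑' n : ℕ, ((n : ℂ) + 1) * S n z, fun z hz => ?_, fun n z hz => ?_⟩
  · obtain ⟨R, hR1, hR2⟩ := exists_between (mem_ball_one.1 hz)
    have hsub : Metric.ball (0 : ℂ) R ⊆ Metric.ball 0 1 := Metric.ball_subset_ball hR2.le
    refine ((Complex.differentiableOn_tsum_of_summable_norm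
      (u := fun n : ℕ => 2 / (1 - R) * (1 / 2) ^ n) (summable_geometric_two.mul_left _)
      (fun n => ((hS n).mono hsub).const_mul _) Metric.isOpen_ball fun n w hw => ?_).differentiableAt
      (Metric.isOpen_ball.mem_nhds (mem_ball_zero_iff.2 hR1))).differentiableWithinAt
    have hw' : ‖w‖ < R := mem_ball_zero_iff.1 hw
    refine (hb' n w (hw'.trans hR2)).trans ?_
    gcongr
  · have hs := (hsum z hz).hasSum.mapL Complex.reCLM
    have e : ∀ n : ℕ, (((n : ℂ) + 1) * S n z).re = (n + 1) * (S n z).re := fun n => by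
      have : ((n : ℂ) + 1) = ((n + 1 : ℝ) : ℂ) := by push_cast; rfl
      rw [this, Complex.re_ofReal_mul]
    simp only [Complex.reCLM_apply, e] at hs
    exact le_hasSum hs n fun j _ => mul_nonneg (by positivity) (hre j z hz)

/-- Fractional powers of a function with real part at least one. -/
lemma exists_damping {U : ℂ → ℂ} (hU : DifferentiableOn ℂ U (Metric.ball 0 1))
    (h0 : ∀ z, ‖z‖ < 1 → 0 ≤ (U z).re) :
    ∃ E R : ℂ → ℂ, DifferentiableOn ℂ E (Metric.ball 0 1) ∧ DifferentiableOn ℂ R (Metric.ball 0 1) ∧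
      ∀ z, ‖z‖ < 1 → E z ≠ 0 ∧ ‖E z‖ ≤ 1 ∧ 0 < (R z).re ∧ (R z).re ≤ 1 ∧
        (R z).re ^ 2 * (U z).re ≤ 1 ∧ ‖E z‖ ^ 2 ≤ 2 * √((R z).re) := by
  have hs : ∀ z, ‖z‖ < 1 → 1 + U z ∈ Complex.slitPlane := fun z hz => by
    refine Or.inl ?_
    have := h0 z hz
    simp only [Complex.add_re, Complex.one_re]; linarith
  have hl : DifferentiableOn ℂ (fun z => Complex.log (1 + U z)) (Metric.ball 0 1) :=
    DifferentiableOn.clog (hU.const_add 1) fun z hz => hs z (mem_ball_one.1 hz)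
  refine ⟨fun z => Complex.exp (-(1 / 8 : ℝ) * Complex.log (1 + U z)),
    fun z => Complex.exp (-(1 / 2 : ℝ) * Complex.log (1 + U z)), (hl.const_mul _).cexp,
    (hl.const_mul _).cexp, fun z hz => ⟨Complex.exp_ne_zero _, ?_⟩⟩
  set x := ‖1 + U z‖ with hx
  have hUz := h0 z hz
  have hxU : 1 + (U z).re ≤ x := by
    have := Complex.re_le_norm (1 + U z)
    simpa using this
  have hx1 : 1 ≤ x := by linarith
  have hx0 : 0 < x := by linarith
  have hlogx : 0 ≤ Real.log x := Real.log_nonneg hx1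
  have harg : |(1 + U z).arg| < Real.pi / 2 := by
    rw [Complex.abs_arg_lt_pi_div_two_iff]
    left
    simp only [Complex.add_re, Complex.one_re]; linarith
  have hE : ‖Complex.exp (-(1 / 8 : ℝ) * Complex.log (1 + U z))‖ = Real.exp (-(Real.log x / 8)) := by
    rw [Complex.norm_exp, ← Complex.ofReal_neg, Complex.re_ofReal_mul, Complex.log_re, ← hx]
    ring_nf
  have hR : (Complex.exp (-(1 / 2 : ℝ) * Complex.log (1 + U z))).re =
      Real.exp (-(Real.log x / 2)) * Real.cos ((1 + U z).arg / 2) := by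
    rw [Complex.exp_re, ← Complex.ofReal_neg, Complex.re_ofReal_mul, Complex.im_ofReal_mul,
      Complex.log_re, Complex.log_im, ← Real.cos_neg ((1 + U z).arg / 2), ← hx]
    ring_nf
  have hcos : 1 / 2 ≤ Real.cos ((1 + U z).arg / 2) := by
    rw [← Real.cos_abs, abs_div, abs_two, ← Real.cos_pi_div_three]
    apply Real.cos_le_cos_of_nonneg_of_le_pi <;> linarith [Real.pi_pos, abs_nonneg (1 + U z).arg]
  have hcos1 := Real.cos_le_one ((1 + U z).arg / 2)
  set q := Real.exp (-(Real.log x / 8)) with hq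
  have hq0 : 0 < q := Real.exp_pos _
  have hq1 : q ≤ 1 := Real.exp_le_one_iff.2 (by linarith)
  have hq4 : Real.exp (-(Real.log x / 2)) = q ^ 4 := by
    rw [hq, ← Real.exp_nat_mul]; push_cast; ring_nf
  have hq8 : q ^ 8 * x = 1 := by
    rw [hq, ← Real.exp_nat_mul, ← Real.exp_log hx0, ← Real.exp_add, Real.log_exp]
    push_cast
    rw [Real.exp_eq_one_iff]
    ring
  rw [hE, hR, hq4]
  set k := Real.cos ((1 + U z).arg / 2)
  have hk0 : 0 < k := by linarith
  have hq41 : q ^ 4 ≤ 1 := pow_le_one₀ hq0.le hq1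
  refine ⟨hq1, by positivity, by nlinarith, ?_, ?_⟩
  · calc (q ^ 4 * k) ^ 2 * (U z).re = q ^ 8 * (k ^ 2 * (U z).re) := by ring
      _ ≤ q ^ 8 * (1 * x) := by
        gcongr
        · nlinarith
        · linarith
      _ = 1 := by rw [one_mul, hq8]
  · have h1 : q ^ 2 = √(q ^ 4) := by
      rw [show q ^ 4 = (q ^ 2) ^ 2 by ring, Real.sqrt_sq (by positivity)]
    have h2 : (2 : ℝ) = √4 := by
      rw [show (4 : ℝ) = 2 ^ 2 by norm_num, Real.sqrt_sq (by norm_num)]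
    rw [h1, h2, ← Real.sqrt_mul (by norm_num)]
    apply Real.sqrt_le_sqrt
    nlinarith [pow_pos hq0 4]

/-- `w` has small supersolutions: for each `ε`, a function `V` with `-ΔV ≥ 4‖w‖²`
whose boundary values are at most `ε`. -/
def HasSmallSuper (w : ℂ → ℂ) : Prop :=
  ∀ ε > 0, ∃ (V : ℂ → ℝ) (K : ℝ), 0 ≤ K ∧ ContinuousOn V (Metric.ball 0 1) ∧
    ∀ z, ‖z‖ < 1 → 0 ≤ V z ∧ V z ≤ ε + K * (1 - ‖z‖ ^ 2) ∧
      SubJet (fun x => -V x) z (‖w z‖ ^ 2)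

lemma HasSmallSuper.of_sq_le {w₁ w₂ w : ℂ → ℂ} {C : ℝ} (h₁ : HasSmallSuper w₁)
    (h₂ : HasSmallSuper w₂) (hC : 0 < C)
    (h : ∀ z, ‖z‖ < 1 → ‖w z‖ ^ 2 ≤ C * (‖w₁ z‖ ^ 2 + ‖w₂ z‖ ^ 2)) : HasSmallSuper w := by
  intro ε hε
  obtain ⟨V₁, K₁, hK₁, c₁, H₁⟩ := h₁ (ε / (2 * C)) (by positivity)
  obtain ⟨V₂, K₂, hK₂, c₂, H₂⟩ := h₂ (ε / (2 * C)) (by positivity)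
  refine ⟨fun z => C * (V₁ z + V₂ z), C * (K₁ + K₂), by positivity, by fun_prop, fun z hz => ?_⟩
  obtain ⟨a₁, b₁, j₁⟩ := H₁ z hz
  obtain ⟨a₂, b₂, j₂⟩ := H₂ z hz
  refine ⟨by positivity, ?_, ?_⟩
  · have := mul_le_mul_of_nonneg_left (add_le_add b₁ b₂) hC.le
    have e : C * (ε / (2 * C)) = ε / 2 := by field_simp
    nlinarith
  · refine (((j₁.add j₂).const_mul hC.le).mono (h z hz)).congr (Eventually.of_forall fun x => ?_)
    simp only []; ring

lemma exists_mul_deriv_hasSmallSuper {Φ : ℂ → ℂ} (hd : DifferentiableOn ℂ Φ (Metric.ball 0 1))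
    (hM : ∀ z, ‖z‖ < 1 → ‖Φ z‖ ≤ 1) :
    ∃ E : ℂ → ℂ, DifferentiableOn ℂ E (Metric.ball 0 1) ∧
      (∀ z, ‖z‖ < 1 → E z ≠ 0 ∧ ‖E z‖ ≤ 1) ∧ HasSmallSuper fun z => E z * deriv Φ z := by
  obtain ⟨g, hg⟩ := exists_bdry hd hM
  have hc : ∀ n : ℕ, (0 : ℝ) < (1 / 2) ^ n / (n + 1) := fun n => by positivity
  choose s hs0 hs1 hs using fun n : ℕ => hg.exists_dilation (hc n)
  have hInt := fun n => hg.integrable_dilErr (hs0 n) (hs1 n)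
  have hSd : ∀ n, DifferentiableOn ℂ (herg (dilErr Φ g (s n))) (Metric.ball 0 1) :=
    fun n => differentiableOn_herg (hInt n)
  have hS0 : ∀ n z, ‖z‖ < 1 → 0 ≤ (herg (dilErr Φ g (s n)) z).re := fun n z hz =>
    (sq_nonneg _).trans (hg.normSq_sub_le (hs0 n) (hs1 n) hz)
  obtain ⟨U, hU, hU'⟩ := exists_weighted_sum hSd hS0 fun n z hz => by
    refine (norm_herg_le (hInt n) (fun ζ => sq_nonneg _) hz).trans ?_
    have := sub_pos.2 hz
    gcongr
    exact hs n
  obtain ⟨E, R, hE, hR, hER⟩ := exists_damping hU fun z hz =>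
    (mul_nonneg (by positivity) (hS0 0 z hz)).trans (hU' 0 z hz)
  refine ⟨E, hE, fun z hz => ⟨(hER z hz).1, (hER z hz).2.1⟩, fun ε hε => ?_⟩
  obtain ⟨n, hn⟩ := exists_nat_gt (16 / ((ε / 20) ^ 2) ^ 2)
  set η := (ε / 20) ^ 2 with hη
  have hη0 : 0 < η := by positivity
  set δ := min 1 (η / 2) with hδ
  have hδ0 : 0 < δ := lt_min one_pos (by positivity)
  set t := s n
  have ht0 : 0 < t := hs0 n
  have ht1 : t < 1 := hs1 n
  set S := herg (dilErr Φ g t)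
  set f : ℂ → ℂ := fun z => Φ z - Φ (t * z) with hf
  have hmt : ∀ {z : ℂ}, ‖z‖ ≤ 1 → ‖(t : ℂ) * z‖ < 1 := fun {z} hz => by
    rw [norm_mul, Complex.norm_real, Real.norm_of_nonneg ht0.le]
    nlinarith [norm_nonneg z]
  have hΦa : ∀ {z : ℂ}, ‖z‖ < 1 → AnalyticAt ℂ Φ z := fun {z} hz =>
    hd.analyticAt (Metric.isOpen_ball.mem_nhds (mem_ball_one.2 hz))
  have hfd : ∀ {z : ℂ}, ‖z‖ < 1 → HasDerivAt f (deriv Φ z - t * deriv Φ (t * z)) z := fun {z} hz => by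
    have h1 := (hΦa hz).differentiableAt.hasDerivAt
    have h2 := (hΦa (hmt hz.le)).differentiableAt.hasDerivAt
    have h3 : HasDerivAt (fun x : ℂ => (t : ℂ) * x) (t : ℂ) z := by
      simpa using (hasDerivAt_id z).const_mul (t : ℂ)
    have h4 := h1.sub (h2.comp z h3)
    rw [mul_comm (t : ℂ) (deriv Φ _)]
    exact h4
  have hfD : DifferentiableOn ℂ f (Metric.ball 0 1) := fun z hz =>
    (hfd (mem_ball_one.1 hz)).differentiableAt.differentiableWithinAt
  have hfa : ∀ {z : ℂ}, ‖z‖ < 1 → AnalyticAt ℂ f z := fun {z} hz =>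
    hfD.analyticAt (Metric.isOpen_ball.mem_nhds (mem_ball_one.2 hz))
  obtain ⟨B, hB⟩ : ∃ B, ∀ z ∈ Metric.closedBall (0 : ℂ) 1, ‖deriv Φ (t * z)‖ ≤ B := by
    refine (isCompact_closedBall (0 : ℂ) 1).exists_bound_of_continuousOn ?_
    refine (hd.deriv Metric.isOpen_ball).continuousOn.comp (by fun_prop) fun z hz => ?_
    exact mem_ball_one.2 (hmt (mem_closedBall_zero_iff.1 hz))
  set a : ℂ → ℝ := fun z => (S z).re - ‖f z‖ ^ 2 + δ with ha
  set ρ : ℂ → ℝ := fun z => (R z).re with hρ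
  have haδ : ∀ z, ‖z‖ < 1 → δ ≤ a z := fun z hz => by
    have : ‖f z‖ ^ 2 ≤ (S z).re := hg.normSq_sub_le ht0 ht1 hz
    simp only [ha]; linarith
  have ha5 : ∀ z, ‖z‖ < 1 → a z ≤ 5 := fun z hz => by
    have h1 : (S z).re ≤ 4 := hg.re_herg_le ht0 ht1 hz
    have h2 : δ ≤ 1 := min_le_left _ _
    simp only [ha]; nlinarith [sq_nonneg ‖f z‖]
  have haρ : ∀ z, ‖z‖ < 1 → a z * ρ z ≤ η := fun z hz => by
    obtain ⟨-, -, r0, r1, rU, -⟩ := hER z hz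
    have h1 : (S z).re ≤ 4 := hg.re_herg_le ht0 ht1 hz
    have h2 : δ ≤ η / 2 := min_le_right _ _
    have h0 : 0 ≤ (S z).re := hS0 n z hz
    have h3 : (n + 1) * (S z).re ≤ (U z).re := hU' n z hz
    have h4 : ((S z).re * ρ z) ^ 2 * (n + 1) ≤ 4 := by
      calc ((S z).re * ρ z) ^ 2 * (n + 1) = (S z).re * (ρ z ^ 2 * ((n + 1) * (S z).re)) := by ring
        _ ≤ 4 * (ρ z ^ 2 * (U z).re) := by gcongr
        _ ≤ 4 := by simp only [hρ]; linarith
    have h5 : (S z).re * ρ z ≤ η / 2 := by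
      refine le_of_sq_le_sq ?_ (by positivity)
      rw [div_lt_iff₀ (by positivity)] at hn
      have hn1 : (0 : ℝ) < n + 1 := by positivity
      refine le_of_mul_le_mul_right (h4.trans ?_) hn1
      nlinarith [sq_nonneg η]
    have h6 : a z ≤ (S z).re + δ := by simp only [ha]; linarith [sq_nonneg ‖f z‖]
    calc a z * ρ z ≤ ((S z).re + δ) * ρ z := by gcongr
      _ ≤ η := by
        have : δ * ρ z ≤ δ * 1 := by gcongr
        linarith
  refine ⟨fun z => 20 * √(a z * ρ z) + 2 * B ^ 2 * (1 - ‖z‖ ^ 2), 2 * B ^ 2, by positivity, ?_,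
    fun z hz => ?_⟩
  · have hSc := (hSd n).continuousOn
    have hRc := hR.continuousOn
    have hfc := hfD.continuousOn
    have h1 : ContinuousOn a (Metric.ball 0 1) :=
      ((Complex.continuous_re.comp_continuousOn hSc).sub (hfc.norm.pow 2)).add continuousOn_const
    have h2 : ContinuousOn ρ (Metric.ball 0 1) := Complex.continuous_re.comp_continuousOn hRc
    fun_prop
  · obtain ⟨-, e1, r0, r1, rU, eρ⟩ := hER z hz
    have ha0 := hδ0.trans_le (haδ z hz)
    have hnz : 0 ≤ 1 - ‖z‖ ^ 2 := by nlinarith [norm_nonneg z]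
    refine ⟨by positivity, ?_, ?_⟩
    · have : √(a z * ρ z) ≤ ε / 20 := by
        rw [Real.sqrt_le_left (by positivity)]
        exact haρ z hz
      linarith
    · have hball : ∀ᶠ x in 𝓝 z, ‖x‖ < 1 := continuous_norm.continuousAt.eventually (gt_mem_nhds hz)
      have hSa : AnalyticAt ℂ S z := (hSd n).analyticAt (Metric.isOpen_ball.mem_nhds (mem_ball_one.2 hz))
      have hRa : AnalyticAt ℂ R z := hR.analyticAt (Metric.isOpen_ball.mem_nhds (mem_ball_one.2 hz))
      have ja : SubJet (fun x => -a x) z (‖deriv f z‖ ^ 2) := by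
        refine ((((SubJet.re hSa.neg).add (SubJet.normSq (hfa hz))).add
          (SubJet.const (-δ) z)).mono (by simp)).congr (Eventually.of_forall fun x => ?_)
        simp only [ha, Pi.neg_apply, Complex.neg_re]; ring
      have jρ : SubJet (fun x => -ρ x) z 0 :=
        (SubJet.re hRa.neg).congr (Eventually.of_forall fun x => by simp [hρ])
      have j := SubJet.neg_sqrt_mul ja jρ ha0 r0
        (hball.mono fun x hx => (hδ0.trans_le (haδ x hx)).le)
        (hball.mono fun x hx => (hER x hx).2.2.1.le)
      have jn : SubJet (fun x : ℂ => ‖x‖ ^ 2) z 1 := by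
        simpa using SubJet.normSq (f := fun x : ℂ => x) (z := z) analyticAt_id
      have J := ((j.const_mul (s := 20) (by norm_num)).add
        (jn.const_mul (s := 2 * B ^ 2) (by positivity))).add (SubJet.const (-(2 * B ^ 2)) z)
      refine (J.mono ?_).congr (Eventually.of_forall fun x => ?_)
      · rw [(hfd hz).deriv, norm_mul, mul_pow]
        set D := deriv Φ z - t * deriv Φ (t * z) with hD
        have k1 : ‖deriv Φ z‖ ≤ ‖D‖ + B := by
          calc ‖deriv Φ z‖ = ‖D + t * deriv Φ (t * z)‖ := by rw [hD]; congr 1; ring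
            _ ≤ ‖D‖ + ‖(t : ℂ) * deriv Φ (t * z)‖ := norm_add_le _ _
            _ ≤ ‖D‖ + B := by
              gcongr
              rw [norm_mul, Complex.norm_real, Real.norm_of_nonneg ht0.le]
              have := hB z (mem_closedBall_zero_iff.2 hz.le)
              nlinarith [norm_nonneg (deriv Φ (t * z))]
        have k2 : ‖deriv Φ z‖ ^ 2 ≤ 2 * ‖D‖ ^ 2 + 2 * B ^ 2 := by
          nlinarith [norm_nonneg (deriv Φ z), sq_nonneg (‖D‖ - B)]
        have k3 : √(ρ z) ≤ 5 / 2 * √(ρ z / a z) := by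
          have hh : (5 / 2 : ℝ) = √(25 / 4) := by
            rw [show (25 / 4 : ℝ) = (5 / 2) ^ 2 by norm_num, Real.sqrt_sq (by norm_num)]
          rw [hh, ← Real.sqrt_mul (by norm_num)]
          apply Real.sqrt_le_sqrt
          rw [mul_div_assoc', le_div_iff₀ ha0]
          have : ρ z * a z ≤ ρ z * 5 := mul_le_mul_of_nonneg_left (ha5 z hz) r0.le
          have : 0 < ρ z := r0
          linarith
        have k4 : ‖E z‖ ^ 2 ≤ 5 * √(ρ z / a z) := by
          have : ‖E z‖ ^ 2 ≤ 2 * √(ρ z) := eρ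
          linarith
        have k5 : ‖E z‖ ^ 2 ≤ 1 := pow_le_one₀ (norm_nonneg _) e1
        calc ‖E z‖ ^ 2 * ‖deriv Φ z‖ ^ 2 ≤ ‖E z‖ ^ 2 * (2 * ‖D‖ ^ 2 + 2 * B ^ 2) := by gcongr
          _ = ‖E z‖ ^ 2 * (2 * ‖D‖ ^ 2) + ‖E z‖ ^ 2 * (2 * B ^ 2) := by ring
          _ ≤ 5 * √(ρ z / a z) * (2 * ‖D‖ ^ 2) + 1 * (2 * B ^ 2) := by gcongr
          _ = _ := by ring
      · simp only []; ring

/-- A Hardy class derivative becomes the gradient-like part of a bounded problem after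
multiplication by a zero-free function. -/
lemma exists_mul_deriv_hasSmallSuper_of_majorant {F A : ℂ → ℂ}
    (hF : DifferentiableOn ℂ F (Metric.ball 0 1)) (hA : DifferentiableOn ℂ A (Metric.ball 0 1))
    (hFA : ∀ z, ‖z‖ < 1 → 0 ≤ (A z).re ∧ ‖F z‖ ≤ Real.exp (A z).re) :
    ∃ m : ℂ → ℂ, DifferentiableOn ℂ m (Metric.ball 0 1) ∧ (∀ z, ‖z‖ < 1 → m z ≠ 0) ∧
      HasSmallSuper fun z => m z * deriv F z := by
  have hq : ∀ z, ‖z‖ < 1 → ‖Complex.exp (-A z)‖ ≤ 1 ∧ ‖F z * Complex.exp (-A z)‖ ≤ 1 := by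
    intro z hz
    obtain ⟨h0, h1⟩ := hFA z hz
    rw [norm_mul, Complex.norm_exp, Complex.neg_re]
    refine ⟨Real.exp_le_one_iff.2 (by linarith), ?_⟩
    calc ‖F z‖ * Real.exp (-(A z).re) ≤ Real.exp (A z).re * Real.exp (-(A z).re) := by gcongr
      _ = 1 := by rw [← Real.exp_add]; simp
  obtain ⟨E₁, d₁, n₁, s₁⟩ := exists_mul_deriv_hasSmallSuper
    (Φ := fun z => F z * Complex.exp (-A z) * Complex.exp (-A z))
    ((hF.mul hA.neg.cexp).mul hA.neg.cexp) fun z hz => by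
      rw [norm_mul]; exact mul_le_one₀ (hq z hz).2 (norm_nonneg _) (hq z hz).1
  obtain ⟨E₂, d₂, n₂, s₂⟩ := exists_mul_deriv_hasSmallSuper (Φ := fun z => Complex.exp (-A z))
    hA.neg.cexp fun z hz => (hq z hz).1
  refine ⟨fun z => Complex.exp (-A z) * Complex.exp (-A z) * (E₁ z * E₂ z),
    (hA.neg.cexp.mul hA.neg.cexp).mul (d₁.mul d₂), fun z hz => ?_,
    s₁.of_sq_le (C := 8) s₂ (by norm_num) fun z hz => ?_⟩
  · exact mul_ne_zero (mul_ne_zero (Complex.exp_ne_zero _) (Complex.exp_ne_zero _))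
      (mul_ne_zero (n₁ z hz).1 (n₂ z hz).1)
  · have hnh : Metric.ball (0 : ℂ) 1 ∈ 𝓝 z := Metric.isOpen_ball.mem_nhds (mem_ball_one.2 hz)
    have hF' := (hF.differentiableAt hnh).hasDerivAt
    have hA' := (hA.differentiableAt hnh).hasDerivAt.neg.cexp
    have e2 : deriv (fun z => Complex.exp (-A z)) z = Complex.exp (-A z) * -deriv A z := hA'.deriv
    have e1 : deriv (fun z => F z * Complex.exp (-A z) * Complex.exp (-A z)) z = _ :=
      ((hF'.mul hA').mul hA').deriv
    rw [e1, e2]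
    set q := Complex.exp (-A z) with hqq
    set X := (deriv F z * q + F z * (q * -deriv A z)) * q + F z * q * (q * -deriv A z)
    set Y := q * -deriv A z
    have hm : q * q * (E₁ z * E₂ z) * deriv F z
        = E₂ z * (E₁ z * X) - 2 * (F z * q) * E₁ z * (E₂ z * Y) := by
      simp only [X, Y]; ring
    have hb : ‖q * q * (E₁ z * E₂ z) * deriv F z‖ ≤ ‖E₁ z * X‖ + 2 * ‖E₂ z * Y‖ := by
      rw [hm]
      refine (norm_sub_le _ _).trans (add_le_add ?_ ?_)
      · rw [norm_mul]
        exact mul_le_of_le_one_left (norm_nonneg _) (n₂ z hz).2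
      · rw [norm_mul _ (E₂ z * Y), norm_mul, norm_mul, Complex.norm_ofNat]
        have := mul_le_one₀ (hq z hz).2 (norm_nonneg _) (n₁ z hz).2
        gcongr
        rw [mul_assoc]
        linarith
    have := pow_le_pow_left₀ (norm_nonneg _) hb 2
    change ‖q * q * (E₁ z * E₂ z) * deriv F z‖ ^ 2 ≤ 8 * (‖E₁ z * X‖ ^ 2 + ‖E₂ z * Y‖ ^ 2)
    nlinarith [sq_nonneg (‖E₁ z * X‖ - 2 * ‖E₂ z * Y‖), sq_nonneg ‖E₁ z * X‖]

lemma norm_ofReal_mul_lt_one {r : ℝ} (h0 : 0 < r) (h1 : r < 1) {z : ℂ} (hz : ‖z‖ ≤ 1) :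
    ‖(r : ℂ) * z‖ < 1 := by
  rw [norm_mul, Complex.norm_real, Real.norm_of_nonneg h0.le]
  nlinarith [norm_nonneg z]

lemma Wien.exists_sol_dilation {h : ℂ → ℂ} (hh : DifferentiableOn ℂ h (Metric.ball 0 1)) {V : ℂ → ℝ}
    {C r : ℝ} (hVc : ContinuousOn V (Metric.ball 0 1))
    (hV : ∀ z, ‖z‖ < 1 → 0 ≤ V z ∧ SubJet (fun x => -V x) z (‖h z‖ ^ 2)) (hC : V 0 ≤ C)
    (h0 : 0 < r) (h1 : r < 1) :
    ∃ (c : Wien ℕ) (f : Wien ℤ), (∀ z, ‖z‖ ≤ 1 → disc c z = r * h (r * z)) ∧ Sol c f ∧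
      ∀ n, ‖(schw f).coef n‖ ≤ 2 * C := by
  obtain ⟨c, hc⟩ := exists_disc_eq (hh.const_mul (r : ℂ)) h0.le h1
  obtain ⟨f, hf⟩ := exists_sol c
  refine ⟨c, f, hc, hf, hf.norm_coef_le ?_⟩
  have hb : ∀ z : ℂ, ‖z‖ ≤ 1 → ‖(r : ℂ) * z‖ < 1 := fun z => norm_ofReal_mul_lt_one h0 h1
  have := hf.neg_le_coef_zero (V := fun z => V (r * z))
    (hVc.comp (by fun_prop) fun z hz => mem_ball_one.2 (hb z (mem_closedBall_zero_iff.1 hz)))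
    (fun z hz => (hV _ (hb z hz.le)).1) fun z hz => by
      rw [hc z hz.le, norm_mul, mul_pow, Complex.norm_real, Real.norm_eq_abs, sq_abs]
      exact SubJet.comp_mul h0 (hV _ (hb z hz.le)).2
  rw [mul_zero] at this
  linarith

/-- Solving the boundary problem `log(1 - |G|²) = Re a` for `G' = h exp a` by exhaustion. -/
lemma exists_bounded_primitive {h : ℂ → ℂ} (hh : DifferentiableOn ℂ h (Metric.ball 0 1)) {V : ℂ → ℝ}
    (hVc : ContinuousOn V (Metric.ball 0 1))
    (hV : ∀ z, ‖z‖ < 1 → 0 ≤ V z ∧ SubJet (fun x => -V x) z (‖h z‖ ^ 2)) :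
    ∃ a G : ℂ → ℂ, DifferentiableOn ℂ a (Metric.ball 0 1) ∧ DifferentiableOn ℂ G (Metric.ball 0 1) ∧
      ∀ z, ‖z‖ < 1 → (a z).re ≤ 0 ∧ ‖G z‖ ≤ 1 ∧ deriv G z = h z * Complex.exp (a z) := by
  obtain ⟨r, -, hr, hr1⟩ := exists_seq_strictMono_tendsto' (zero_lt_one (α := ℝ))
  choose c f hc hf hn using fun k =>
    Wien.exists_sol_dilation hh hVc hV le_rfl (hr k).1 (hr k).2
  obtain ⟨α, φ, hφ, hα, Hα⟩ := exists_subseq_powSum (c := fun k => (Wien.schw (f k)).coef) hn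
  have hG1 : ∀ k z, ‖z‖ ≤ 1 → ‖Wien.disc (Wien.integ (Wien.source (c k) (f k))) z‖ ≤ 1 :=
    fun k z hz => ((hf k).norm_lt_one hz).le
  have hG2 : ∀ k n, ‖(Wien.integ (Wien.source (c k) (f k))).coef n‖ ≤ 1 := fun k n => by
    have := Wien.sum_normSq_coef_le_disc _ (fun z hz => hG1 k z hz.le) {n}
    rw [Finset.sum_singleton] at this
    exact le_of_sq_le_sq (by linarith) zero_le_one
  obtain ⟨β, ψ, hψ, hβ, Hβ⟩ := exists_subseq_powSum
    (c := fun k => (Wien.integ (Wien.source (c (φ k)) (f (φ k)))).coef) fun k n => hG2 (φ k) n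
  have hd : ∀ {d : ℕ → ℂ} {M : ℝ}, (∀ n, ‖d n‖ ≤ M) →
      DifferentiableOn ℂ (powSum d) (Metric.ball 0 1) := fun hd z hz =>
    (hasDerivAt_powSum hd (mem_ball_one.1 hz)).differentiableAt.differentiableWithinAt
  refine ⟨powSum α, powSum β, hd hα, hd hβ, fun z hz => ?_⟩
  have Ha := (Hα z hz).1.comp hψ.tendsto_atTop
  obtain ⟨HG, HG'⟩ := Hβ z hz
  refine ⟨?_, ?_, ?_⟩
  · refine le_of_tendsto ((Complex.continuous_re.tendsto _).comp Ha) (Eventually.of_forall fun k => ?_)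
    have h1 := (hf (φ (ψ k))).exp_le hz.le
    have h2 := sq_nonneg ‖Wien.disc (Wien.integ (Wien.source (c (φ (ψ k))) (f (φ (ψ k))))) z‖
    have h3 : Real.exp (Wien.disc (Wien.schw (f (φ (ψ k)))) z).re ≤ 1 := by linarith
    exact Real.exp_le_one_iff.1 h3
  · exact le_of_tendsto HG.norm (Eventually.of_forall fun k => hG1 _ z hz.le)
  · refine tendsto_nhds_unique HG' ?_
    have hrk : Tendsto (fun k => ((r (φ (ψ k)) : ℝ) : ℂ)) atTop (𝓝 1) := by
      have := (Complex.continuous_ofReal.tendsto (1 : ℝ)).comp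
        (hr1.comp (hφ.tendsto_atTop.comp hψ.tendsto_atTop))
      rwa [Complex.ofReal_one] at this
    have hz1 : Tendsto (fun k => ((r (φ (ψ k)) : ℝ) : ℂ) * z) atTop (𝓝 z) := by
      simpa using hrk.mul_const z
    have hcont : ContinuousAt h z := hh.continuousOn.continuousAt
      (Metric.isOpen_ball.mem_nhds (mem_ball_one.2 hz))
    have := (hrk.mul (hcont.tendsto.comp hz1)).mul ((Complex.continuous_exp.tendsto _).comp Ha)
    rw [one_mul] at this
    refine this.congr fun k => ?_
    have e := (Wien.hasDerivAt_disc_integ (Wien.source (c (φ (ψ k))) (f (φ (ψ k)))) hz).deriv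
    rw [Wien.disc_source _ _ hz.le, hc _ z hz.le] at e
    exact e.symm

/-- Green's formula in supersolution form: the variance of the boundary values with respect to
harmonic measure is at most `V`. -/
lemma Bdry.integral_pk_normSq_sub_le {G g : ℂ → ℂ} (hg : Bdry G g 1) {V : ℂ → ℝ}
    (hVc : ContinuousOn V (Metric.ball 0 1))
    (hV : ∀ z, ‖z‖ < 1 → 0 ≤ V z ∧ SubJet (fun x => -V x) z (‖deriv G z‖ ^ 2)) {z : ℂ}
    (hz : ‖z‖ < 1) : ∫ θ, pk z θ * ‖g (circlePt θ) - G z‖ ^ 2 ∂circMeas ≤ V z := by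
  rw [integral_pk_mul_normSq_sub hg.meas (fun θ => hg.gbound _) hz (hg.integral_pk_smul hz)]
  have h1 := hg.tendsto_integral (Q := fun p => ‖p.2‖ ^ 2) (by fun_prop) (w := pk z)
    (continuous_pk hz) (abs_pk_le hz)
  have h2 := (h1.sub ((tendsto_comp_mul hg.diff.continuousOn hz).norm.pow 2))
  refine le_of_tendsto_of_tendsto h2 (tendsto_comp_mul hVc hz) ?_
  filter_upwards [eventually_mem_Ioo_one] with r ⟨h0, hr1⟩
  have hb : ∀ {z : ℂ}, ‖z‖ ≤ 1 → ‖(r : ℂ) * z‖ < 1 := norm_ofReal_mul_lt_one h0 hr1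
  obtain ⟨c, hc⟩ := Wien.exists_disc_eq hg.diff h0.le hr1
  have hcd : ∀ z, ‖z‖ < 1 → deriv (Wien.disc c) z = r * deriv G (r * z) := fun z hz => by
    have e : Wien.disc c =ᶠ[𝓝 z] fun z => G (r * z) := by
      filter_upwards [Metric.isOpen_ball.mem_nhds (mem_ball_one.2 hz)] with x hx
      exact hc x (mem_ball_one.1 hx).le
    rw [e.deriv_eq]
    have := deriv_comp_mul_left (r : ℂ) G z
    simpa using this
  have key := Wien.re_disc_schw_sqMod_sub_le c (V := fun z => V (r * z))
    (hVc.comp (by fun_prop) fun z hz => mem_ball_one.2 (hb (mem_closedBall_zero_iff.1 hz)))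
    (fun z hz => (hV _ (hb hz.le)).1) (fun z hz => by
      rw [hcd z hz, norm_mul, mul_pow, Complex.norm_real, Real.norm_eq_abs, sq_abs]
      exact SubJet.comp_mul h0 (hV _ (hb hz.le)).2) hz.le
  rw [hc z hz.le, Wien.re_disc_schw_eq (Wien.isSelfAdjoint_sqMod c) hz
    (φ := fun ζ => ‖G (r * ζ)‖ ^ 2) fun ζ => by
      rw [Wien.evC_sqMod, ← hc ζ (Circle.norm_coe ζ).le]
      norm_cast] at key
  exact key

lemma meanOsc_le {f : ℝ → ℂ} {θ₀ t : ℝ} (ht : 0 < t)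
    (hf : IntegrableOn f (Ioo (θ₀ - Real.pi * t) (θ₀ + Real.pi * t))) (w : ℂ) :
    meanOsc f θ₀ t ≤ 2 * ((2 * Real.pi * t)⁻¹ *
      ∫ θ in Ioo (θ₀ - Real.pi * t) (θ₀ + Real.pi * t), ‖f θ - w‖) := by
  set I := Ioo (θ₀ - Real.pi * t) (θ₀ + Real.pi * t) with hI
  set ℓ := 2 * Real.pi * t with hℓ
  have hℓ0 : 0 < ℓ := by positivity
  have hvol : volume.real I = ℓ := by
    rw [hI, Real.volume_real_Ioo_of_le (by nlinarith [Real.pi_pos])]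
    ring
  have hc : ∀ v : ℂ, IntegrableOn (fun _ => v) I := fun v => integrableOn_const (by simp [hI])
  have havg : arcAvg f θ₀ t - w = ℓ⁻¹ • ∫ θ in I, (f θ - w) := by
    rw [integral_sub hf (hc w), setIntegral_const, hvol, smul_sub, smul_smul,
      inv_mul_cancel₀ hℓ0.ne', one_smul]
    rfl
  have hn : ‖arcAvg f θ₀ t - w‖ ≤ ℓ⁻¹ * ∫ θ in I, ‖f θ - w‖ := by
    rw [havg, norm_smul, Real.norm_of_nonneg (by positivity)]
    gcongr
    exact norm_integral_le_integral_norm _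
  have hi : IntegrableOn (fun θ => ‖f θ - w‖) I := (hf.sub (hc w)).norm
  have hcr : ∀ v : ℝ, IntegrableOn (fun _ => v) I := fun v => integrableOn_const (by simp [hI])
  have hle : ∫ θ in I, ‖f θ - arcAvg f θ₀ t‖ ≤ ∫ θ in I, (‖f θ - w‖ + ‖arcAvg f θ₀ t - w‖) := by
    refine integral_mono (hf.sub (hc _)).norm
      (hi.add (hcr _)) fun θ => ?_
    have : f θ - arcAvg f θ₀ t = (f θ - w) - (arcAvg f θ₀ t - w) := by ring
    rw [this]
    exact norm_sub_le _ _
  rw [integral_add hi (hcr _), setIntegral_const, hvol,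
    smul_eq_mul] at hle
  calc meanOsc f θ₀ t = ℓ⁻¹ * ∫ θ in I, ‖f θ - arcAvg f θ₀ t‖ := rfl
    _ ≤ ℓ⁻¹ * ((∫ θ in I, ‖f θ - w‖) + ℓ * ‖arcAvg f θ₀ t - w‖) := by gcongr
    _ = ℓ⁻¹ * (∫ θ in I, ‖f θ - w‖) + ‖arcAvg f θ₀ t - w‖ := by field_simp
    _ ≤ _ := by linarith

lemma meanOsc_le_of_sq {f : ℝ → ℂ} {θ₀ t η B : ℝ} (ht : 0 < t) (hη : 0 < η) {w : ℂ}
    (hf : IntegrableOn f (Ioo (θ₀ - Real.pi * t) (θ₀ + Real.pi * t)))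
    (hf2 : IntegrableOn (fun θ => ‖f θ - w‖ ^ 2) (Ioo (θ₀ - Real.pi * t) (θ₀ + Real.pi * t)))
    (hB : (2 * Real.pi * t)⁻¹ *
      ∫ θ in Ioo (θ₀ - Real.pi * t) (θ₀ + Real.pi * t), ‖f θ - w‖ ^ 2 ≤ B) :
    meanOsc f θ₀ t ≤ η + B / η := by
  refine (meanOsc_le ht hf w).trans ?_
  set I := Ioo (θ₀ - Real.pi * t) (θ₀ + Real.pi * t) with hI
  set ℓ := 2 * Real.pi * t with hℓ
  have hℓ0 : 0 < ℓ := by positivity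
  have hvol : volume.real I = ℓ := by
    rw [hI, Real.volume_real_Ioo_of_le (by nlinarith [Real.pi_pos])]
    ring
  have hc : ∀ v : ℂ, IntegrableOn (fun _ => v) I := fun v => integrableOn_const (by simp [hI])
  have hcr : ∀ v : ℝ, IntegrableOn (fun _ => v) I := fun v => integrableOn_const (by simp [hI])
  have hle : ∫ θ in I, ‖f θ - w‖ ≤ ∫ θ in I, (η / 2 + η⁻¹ / 2 * ‖f θ - w‖ ^ 2) := by
    refine integral_mono (hf.sub (hc _)).norm
      ((hcr _).add (hf2.const_mul _)) fun θ => ?_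
    simp only []
    set x := ‖f θ - w‖
    have : η * (η / 2 + η⁻¹ / 2 * x ^ 2) = η ^ 2 / 2 + x ^ 2 / 2 := by field_simp
    refine le_of_mul_le_mul_left ?_ hη
    rw [this]
    nlinarith [sq_nonneg (η - x)]
  rw [integral_add (hcr _) (hf2.const_mul _), setIntegral_const, hvol,
    integral_const_mul, smul_eq_mul] at hle
  calc 2 * (ℓ⁻¹ * ∫ θ in I, ‖f θ - w‖)
      ≤ 2 * (ℓ⁻¹ * (ℓ * (η / 2) + η⁻¹ / 2 * ∫ θ in I, ‖f θ - w‖ ^ 2)) := by gcongr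
    _ = η + η⁻¹ * (ℓ⁻¹ * ∫ θ in I, ‖f θ - w‖ ^ 2) := by field_simp
    _ ≤ η + η⁻¹ * B := by gcongr
    _ = η + B / η := by ring

lemma norm_circlePt_sub_le (θ θ₀ : ℝ) : ‖circlePt θ - circlePt θ₀‖ ≤ |θ - θ₀| := by
  have h : circlePt θ - circlePt θ₀
      = circlePt θ₀ * (Complex.exp (Complex.I * ((θ - θ₀ : ℝ) : ℂ)) - 1) := by
    unfold circlePt
    rw [mul_sub, ← Complex.exp_add, mul_one]
    congr 2
    push_cast; ring
  rw [h, norm_mul, norm_circlePt, one_mul]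
  exact Real.norm_exp_I_mul_ofReal_sub_one_le

lemma le_pk {θ₀ t θ : ℝ} (ht : 0 < t) (ht1 : t ≤ 1) (h : |θ - θ₀| ≤ Real.pi * t) :
    (25 * t)⁻¹ ≤ pk (((1 - t : ℝ) : ℂ) * circlePt θ₀) θ := by
  have hz : ‖((1 - t : ℝ) : ℂ) * circlePt θ₀‖ = 1 - t := norm_ofReal_mul_circlePt (by linarith) _
  have hlow := one_sub_norm_le (((1 - t : ℝ) : ℂ) * circlePt θ₀) θ
  rw [hz] at hlow
  have hd : ‖circlePt θ - ((1 - t : ℝ) : ℂ) * circlePt θ₀‖ ≤ 5 * t := by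
    have e : circlePt θ - ((1 - t : ℝ) : ℂ) * circlePt θ₀
        = (circlePt θ - circlePt θ₀) + (t : ℂ) * circlePt θ₀ := by push_cast; ring
    rw [e]
    refine (norm_add_le _ _).trans ?_
    rw [norm_ofReal_mul_circlePt ht.le]
    nlinarith [norm_circlePt_sub_le θ θ₀, Real.pi_lt_four]
  unfold pk
  rw [hz]
  rw [inv_eq_one_div, div_le_div_iff₀ (by positivity) (by
    have : 0 < ‖circlePt θ - ((1 - t : ℝ) : ℂ) * circlePt θ₀‖ := by linarith
    positivity)]
  have := pow_le_pow_left₀ (norm_nonneg _) hd 2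
  nlinarith

/-- Bounded boundary values whose variances are controlled lie in `VMO`. -/
lemma Bdry.isVMO {G g : ℂ → ℂ} (hg : Bdry G g 1)
    (hV : ∀ ε > 0, ∃ K, 0 ≤ K ∧ ∀ z, ‖z‖ < 1 →
      ∫ θ, pk z θ * ‖g (circlePt θ) - G z‖ ^ 2 ∂circMeas ≤ ε + K * (1 - ‖z‖ ^ 2)) :
    IsVMO fun θ => g (circlePt θ) := by
  set f : ℝ → ℂ := fun θ => g (circlePt θ) with hf
  have hT : (0 : ℝ) < 2 * Real.pi := by positivity
  have hper : Function.Periodic f (2 * Real.pi) := fun θ => by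
    simp only [hf, circlePt_add_two_pi]
  have hcirc : ∀ {E : Type} [NormedAddCommGroup E] {u : ℝ → E}, Integrable u circMeas →
      IntegrableOn u (Ioc 0 (2 * Real.pi)) := fun {E} _ {u} hu => by
    unfold circMeas at hu
    exact (integrable_smul_measure (by simp [Real.pi_pos]) (by simp)).1 hu
  have harc : ∀ {E : Type} [NormedAddCommGroup E] {u : ℝ → E}, Function.Periodic u (2 * Real.pi) →
      Integrable u circMeas → ∀ a b, a ≤ b → IntegrableOn u (Ioo a b) := fun {E} _ {u} hu hi a b hab => by
    have h1 : IntervalIntegrable u volume 0 (0 + 2 * Real.pi) := by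
      rw [zero_add, intervalIntegrable_iff_integrableOn_Ioc_of_le hT.le]
      exact hcirc hi
    have h2 := hu.intervalIntegrable hT.ne' h1 a b
    rw [intervalIntegrable_iff_integrableOn_Ioc_of_le hab] at h2
    exact h2.mono_set Ioo_subset_Ioc_self
  have hfi : Integrable f circMeas := integrable_of_bound hg.meas fun θ => hg.gbound _
  have hsub : ∀ θ₀ t : ℝ, 0 < t → θ₀ - Real.pi * t ≤ θ₀ + Real.pi * t := fun θ₀ t ht => by
    nlinarith [Real.pi_pos]
  have hsq : ∀ w : ℂ, Integrable (fun θ => ‖f θ - w‖ ^ 2) circMeas := fun w => by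
    refine integrable_of_bound ((hg.meas.sub aestronglyMeasurable_const).norm.pow 2)
      (C := (1 + ‖w‖) ^ 2) fun θ => ?_
    rw [norm_pow, norm_norm]
    gcongr
    exact (_root_.norm_sub_le _ _).trans (by linarith [hg.gbound (circlePt θ)])
  have hsqper : ∀ w : ℂ, Function.Periodic (fun θ => ‖f θ - w‖ ^ 2) (2 * Real.pi) := fun w θ => by
    simp only [hper θ]
  have hvar : ∀ θ₀ t : ℝ, 0 < t → t ≤ 1 →
      (2 * Real.pi * t)⁻¹ * ∫ θ in Ioo (θ₀ - Real.pi * t) (θ₀ + Real.pi * t),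
        ‖f θ - G (((1 - t : ℝ) : ℂ) * circlePt θ₀)‖ ^ 2
      ≤ 25 * ∫ θ, pk (((1 - t : ℝ) : ℂ) * circlePt θ₀) θ *
        ‖f θ - G (((1 - t : ℝ) : ℂ) * circlePt θ₀)‖ ^ 2 ∂circMeas := by
    intro θ₀ t ht ht1
    set z := ((1 - t : ℝ) : ℂ) * circlePt θ₀ with hz
    have hzn : ‖z‖ < 1 := by
      rw [hz, norm_ofReal_mul_circlePt (by linarith)]; linarith
    set u : ℝ → ℝ := fun θ => pk z θ * ‖f θ - G z‖ ^ 2 with hu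
    have hui : Integrable u circMeas := integrable_pk_smul hzn (hsq (G z))
    have hup : Function.Periodic u (2 * Real.pi) := fun θ => by
      simp only [hu, hper θ, pk, circlePt_add_two_pi]
    have hu0 : ∀ θ, 0 ≤ u θ := fun θ => mul_nonneg (pk_nonneg hzn θ) (sq_nonneg _)
    have h1 : ∫ θ, u θ ∂circMeas
        = (2 * Real.pi)⁻¹ * ∫ θ in Ioo (θ₀ - Real.pi) (θ₀ - Real.pi + 2 * Real.pi), u θ := by
      rw [integral_circMeas, smul_eq_mul, ← integral_Ioc_eq_integral_Ioo,
        ← intervalIntegral.integral_of_le (by linarith : θ₀ - Real.pi ≤ θ₀ - Real.pi + 2 * Real.pi),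
        hup.intervalIntegral_add_eq (θ₀ - Real.pi) 0, zero_add,
        intervalIntegral.integral_of_le hT.le]
    have h2 : ∫ θ in Ioo (θ₀ - Real.pi * t) (θ₀ + Real.pi * t), u θ
        ≤ ∫ θ in Ioo (θ₀ - Real.pi) (θ₀ - Real.pi + 2 * Real.pi), u θ := by
      refine setIntegral_mono_set (harc hup hui _ _ (by linarith))
        (Eventually.of_forall hu0) (LE.le.eventuallyLE (Ioo_subset_Ioo ?_ ?_))
      · nlinarith [Real.pi_pos]
      · nlinarith [Real.pi_pos]
    have h3 : (25 * t)⁻¹ * ∫ θ in Ioo (θ₀ - Real.pi * t) (θ₀ + Real.pi * t), ‖f θ - G z‖ ^ 2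
        ≤ ∫ θ in Ioo (θ₀ - Real.pi * t) (θ₀ + Real.pi * t), u θ := by
      rw [← integral_const_mul]
      refine setIntegral_mono_on ((harc (hsqper _) (hsq _) _ _ (hsub θ₀ t ht)).const_mul _)
        (harc hup hui _ _ (hsub θ₀ t ht)) measurableSet_Ioo fun θ hθ => ?_
      refine mul_le_mul_of_nonneg_right (le_pk ht ht1 ?_) (sq_nonneg _)
      rw [abs_le]
      exact ⟨by linarith [hθ.1], by linarith [hθ.2]⟩
    rw [h1]
    have h4 := mul_le_mul_of_nonneg_left (h3.trans h2) (by positivity : 0 ≤ 25 * (2 * Real.pi)⁻¹)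
    calc _ = 25 * (2 * Real.pi)⁻¹ * ((25 * t)⁻¹ *
          ∫ θ in Ioo (θ₀ - Real.pi * t) (θ₀ + Real.pi * t), ‖f θ - G z‖ ^ 2) := by field_simp
      _ ≤ _ := h4
      _ = _ := by ring
  refine ⟨⟨hper, hcirc hfi, 2, fun θ₀ t ht ht1 => ?_⟩, fun ε hε => ?_⟩
  · refine (meanOsc_le ht (harc hper hfi _ _ (hsub θ₀ t ht)) 0).trans ?_
    have : ∫ θ in Ioo (θ₀ - Real.pi * t) (θ₀ + Real.pi * t), ‖f θ - 0‖ ≤ 2 * Real.pi * t := by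
      have h1 : ∫ θ in Ioo (θ₀ - Real.pi * t) (θ₀ + Real.pi * t), ‖f θ - 0‖
          ≤ ∫ θ in Ioo (θ₀ - Real.pi * t) (θ₀ + Real.pi * t), (1 : ℝ) := by
        refine integral_mono ?_ (integrableOn_const (by simp)) fun θ => ?_
        · simpa using (harc hper hfi _ _ (hsub θ₀ t ht)).norm
        · simpa using hg.gbound (circlePt θ)
      refine h1.trans_eq ?_
      rw [setIntegral_const, Real.volume_real_Ioo_of_le (hsub θ₀ t ht), smul_eq_mul]
      ring
    have h2 : (2 * Real.pi * t)⁻¹ *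
        ∫ θ in Ioo (θ₀ - Real.pi * t) (θ₀ + Real.pi * t), ‖f θ - 0‖ ≤ 1 := by
      rw [inv_mul_le_iff₀ (by positivity), mul_one]; exact this
    linarith
  · obtain ⟨K, hK, H⟩ := hV (ε ^ 2 / 200) (by positivity)
    refine ⟨min 1 (ε ^ 2 / (400 * (K + 1))), by positivity, fun θ₀ t ht htδ => ?_⟩
    have ht1 : t ≤ 1 := (htδ.trans_le (min_le_left _ _)).le
    have ht2 : t * (400 * (K + 1)) ≤ ε ^ 2 := by
      rw [← le_div_iff₀ (by positivity)]; exact (htδ.trans_le (min_le_right _ _)).le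
    have hzn : ‖((1 - t : ℝ) : ℂ) * circlePt θ₀‖ = 1 - t := norm_ofReal_mul_circlePt (by linarith) _
    have hH := H (((1 - t : ℝ) : ℂ) * circlePt θ₀) (by linarith)
    rw [hzn] at hH
    have hb : 25 * ∫ θ, pk (((1 - t : ℝ) : ℂ) * circlePt θ₀) θ *
        ‖f θ - G (((1 - t : ℝ) : ℂ) * circlePt θ₀)‖ ^ 2 ∂circMeas ≤ ε ^ 2 / 4 := by
      have : K * (1 - (1 - t) ^ 2) ≤ K * (2 * t) := by gcongr; nlinarith
      nlinarith
    have := meanOsc_le_of_sq ht (half_pos hε) (harc hper hfi _ _ (hsub θ₀ t ht))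
      (harc (hsqper _) (hsq _) _ _ (hsub θ₀ t ht)) ((hvar θ₀ t ht ht1).trans hb)
    refine this.trans_eq ?_
    field_simp
    ring

/-- Multiplication by a zero-free factor preserves orders of vanishing. -/
lemma iteratedDeriv_vanishing_iff {f g q : ℂ → ℂ} {z : ℂ} (hf : AnalyticAt ℂ f z)
    (hq : AnalyticAt ℂ q z) (hq0 : q z ≠ 0) (hg : g =ᶠ[𝓝 z] fun w => q w * f w) (n : ℕ) :
    (iteratedDeriv n f z ≠ 0 ∧ ∀ k < n, iteratedDeriv k f z = 0) ↔
      (iteratedDeriv n g z ≠ 0 ∧ ∀ k < n, iteratedDeriv k g z = 0) := by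
  have hga : AnalyticAt ℂ g z := (hq.mul hf).congr hg.symm
  have ho : analyticOrderAt g z = analyticOrderAt f z := by
    rw [analyticOrderAt_congr hg]
    change analyticOrderAt (q * f) z = _
    rw [analyticOrderAt_mul hq hf, hq.analyticOrderAt_eq_zero.2 hq0, zero_add]
  rw [and_comm, ← analyticOrderAt_eq_nat_iff_iteratedDeriv_eq_zero hf, ← ho,
    analyticOrderAt_eq_nat_iff_iteratedDeriv_eq_zero hga, and_comm]

/-- Theorem 3: for `0 < p ≤ ∞` and `F ∈ ℍ^p` there is `G ∈ QA` such that the zeros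
of `F'` and `G'` coincide with the same multiplicities: for every `z ∈ 𝔻` and `n`,
`F'` vanishes at `z` exactly to order `n` iff `G'` does. -/
theorem stmt_3 (p : ENNReal) (hp : 0 < p) (F : ℂ → ℂ) (hF : MemHardyE p F) :
    ∃ (G : ℂ → ℂ) (Gb : ℝ → ℂ), MemQA G Gb ∧
      ∀ z ∈ unitDisc, ∀ n : ℕ,
        ((iteratedDeriv n (deriv F) z ≠ 0 ∧ ∀ k < n, iteratedDeriv k (deriv F) z = 0) ↔
         (iteratedDeriv n (deriv G) z ≠ 0 ∧ ∀ k < n, iteratedDeriv k (deriv G) z = 0)) := by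
  obtain ⟨hFd, A, hA, hFA⟩ := hF.exists_majorant hp
  obtain ⟨m, hm, hm0, hs⟩ := exists_mul_deriv_hasSmallSuper_of_majorant hFd hA hFA
  have hF'd := hFd.deriv Metric.isOpen_ball
  obtain ⟨V, K, -, hVc, hV⟩ := hs 1 one_pos
  obtain ⟨a, G, ha, hG, haG⟩ := exists_bounded_primitive (hm.mul hF'd) hVc
    fun z hz => ⟨(hV z hz).1, (hV z hz).2.2⟩
  obtain ⟨g, hg⟩ := exists_bdry hG fun z hz => (haG z hz).2.1
  refine ⟨G, fun θ => g (circlePt θ), ⟨⟨unitDisc_eq ▸ hG, 1, fun z hz => (haG z hz).2.1⟩,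
    ae_circMeas.1 hg.lim, hg.isVMO fun ε hε => ?_⟩, fun z hz n => ?_⟩
  · obtain ⟨V, K, hK, hVc, hV⟩ := hs ε hε
    refine ⟨K, hK, fun z hz => (hg.integral_pk_normSq_sub_le hVc (fun z hz => ?_) hz).trans
      (hV z hz).2.1⟩
    refine ⟨(hV z hz).1, (hV z hz).2.2.mono ?_⟩
    rw [(haG z hz).2.2, norm_mul _ (Complex.exp _), Complex.norm_exp]
    refine pow_le_pow_left₀ (by positivity) (mul_le_of_le_one_right (norm_nonneg _) ?_) 2
    exact Real.exp_le_one_iff.2 (haG z hz).1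
  · have hn : Metric.ball (0 : ℂ) 1 ∈ 𝓝 z := Metric.isOpen_ball.mem_nhds (mem_ball_one.2 hz)
    refine iteratedDeriv_vanishing_iff (q := fun w => m w * Complex.exp (a w))
      (hF'd.analyticAt hn) ((hm.analyticAt hn).mul (ha.analyticAt hn).cexp)
      (mul_ne_zero (hm0 z hz) (Complex.exp_ne_zero _)) ?_ n
    filter_upwards [hn] with w hw
    rw [(haG w (mem_ball_one.1 hw)).2.2]
    simp only [Pi.mul_apply]
    ring

end
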